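/- Let ℓ be a prime, r ≥ 1 with ℓ^r ≠ 2, let F be a finite field with ℓ^{2r} elements, and let σ : F → F be the involution σ(x) = x^{ℓ^r}. Then H_d(U(n,F,σ); F_ℓ) = 0 for all d with 0 < 2d < n, where F_ℓ is the ℓ-element field with trivial action. -/

import Mathlib

/-! # Group homology via the inhomogeneous bar complex (trivial coefficients) -/

namespace GroupHomologyBar

variable (G : Type) [Group G] (A : Type) [AddCommGroup A]

/-- Inhomogeneous `n`-chains of `G` with coefficients in `A`. -/
abbrev chains (n : ℕ) : Type := (Fin n → G) →₀ A

/-- The differential of the inhomogeneous bar complex with trivial `G`-action on the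
coefficients, sending `[g₁|…|g_{n+1}] ⊗ a` to
`[g₂|…|g_{n+1}] ⊗ a + ∑ⱼ (-1)^{j+1} [g₁|…|gⱼg_{j+1}|…|g_{n+1}] ⊗ a`
(the last summand of the sum being `(-1)^{n+1} [g₁|…|g_n] ⊗ a`). -/
noncomputable def d (n : ℕ) : chains G A (n + 1) →ₗ[ℤ] chains G A n :=
  Finsupp.lsum ℤ fun g =>
    (Finsupp.lsingle (Fin.tail g) : A →ₗ[ℤ] chains G A n)
      + ∑ j : Fin (n + 1),
          ((-1 : ℤ) ^ ((j : ℕ) + 1)) • Finsupp.lsingle (Fin.contractNth j (· * ·) g)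

/-- The `n`-cycles. -/
noncomputable def cycles : (n : ℕ) → Submodule ℤ (chains G A n)
  | 0 => ⊤
  | (n + 1) => LinearMap.ker (d G A n)

/-- The `n`-boundaries, viewed as a submodule of the `n`-cycles. -/
noncomputable def boundaries (n : ℕ) : Submodule ℤ (cycles G A n) :=
  Submodule.comap (cycles G A n).subtype (LinearMap.range (d G A n))

/-- The group homology `H_n(G; A)` of `G` with trivial coefficients in `A`. -/
abbrev Homology (n : ℕ) : Type := cycles G A n ⧸ boundaries G A n

variable {G}
variable {G' : Type} [Group G']

/-- The map on chains induced by a group homomorphism. -/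
noncomputable def chainsMap (φ : G →* G') (n : ℕ) : chains G A n →ₗ[ℤ] chains G' A n :=
  Finsupp.lmapDomain A ℤ fun v => φ ∘ v

lemma chainsMap_single (φ : G →* G') {n : ℕ} (v : Fin n → G) (a : A) :
    chainsMap A φ n (Finsupp.single v a) = Finsupp.single (φ ∘ v) a := by
  simp [chainsMap, Finsupp.mapDomain_single]

lemma d_single {n : ℕ} (g : Fin (n + 1) → G) (a : A) :
    d G A n (Finsupp.single g a)
      = Finsupp.single (Fin.tail g) a
        + ∑ j : Fin (n + 1),
            ((-1 : ℤ) ^ ((j : ℕ) + 1)) • Finsupp.single (Fin.contractNth j (· * ·) g) a := by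
  simp [d, Finsupp.lsum_single]

lemma d_chainsMap (φ : G →* G') (n : ℕ) :
    (d G' A n).comp (chainsMap A φ (n + 1)) = (chainsMap A φ n).comp (d G A n) := by
  apply Finsupp.lhom_ext
  intro g a
  have hc : ∀ j : Fin (n + 1),
      φ ∘ Fin.contractNth j (· * ·) g = Fin.contractNth j (· * ·) (φ ∘ g) := by
    intro j
    funext k
    simp only [Function.comp_apply, Fin.contractNth]
    split_ifs <;> simp
  simp only [LinearMap.comp_apply, chainsMap_single, d_single, map_add, map_sum, map_smul,
    chainsMap_single, Fin.comp_tail, hc]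

lemma chainsMap_mem_cycles (φ : G →* G') (n : ℕ) :
    ∀ x ∈ cycles G A n, chainsMap A φ n x ∈ cycles G' A n := by
  intro x hx
  cases n with
  | zero => trivial
  | succ n =>
    simp only [cycles, LinearMap.mem_ker] at hx ⊢
    have := congrArg (fun L : chains G A (n + 1) →ₗ[ℤ] chains G' A n => L x) (d_chainsMap A φ n)
    simp only [LinearMap.comp_apply] at this
    rw [this, hx, map_zero]

/-- The map on cycles induced by a group homomorphism. -/
noncomputable def cyclesMap (φ : G →* G') (n : ℕ) : cycles G A n →ₗ[ℤ] cycles G' A n :=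
  (chainsMap A φ n).restrict (chainsMap_mem_cycles A φ n)

/-- The map `H_n(G; A) → H_n(G'; A)` on group homology induced by a group
homomorphism `φ : G →* G'`. -/
noncomputable def inducedMap (φ : G →* G') (n : ℕ) :
    Homology G A n →ₗ[ℤ] Homology G' A n :=
  Submodule.mapQ _ _ (cyclesMap A φ n) (by
    rintro ⟨x, hx⟩ hmem
    simp only [boundaries, Submodule.mem_comap, Submodule.subtype_apply,
      LinearMap.mem_range] at hmem ⊢
    obtain ⟨y, hy⟩ := hmem
    refine ⟨chainsMap A φ (n + 1) y, ?_⟩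
    have := congrArg (fun L : chains G A (n + 1) →ₗ[ℤ] chains G' A n => L y) (d_chainsMap A φ n)
    simp only [LinearMap.comp_apply] at this
    rw [this, hy]
    rfl)

end GroupHomologyBar

section Isometries

variable (F : Type) [Field F] {W : Type} [AddCommGroup W] [Module F W]

/-- The group of linear automorphisms of a vector space `V` preserving a
function `Q : V → F` (e.g. a quadratic form). -/
def quadIsoms {V : Type} [AddCommGroup V] [Module F V] (Q : V → F) :
    Subgroup (V ≃ₗ[F] V) where
  carrier := {g | ∀ v, Q (g v) = Q v}
  one_mem' := fun _ => rfl
  mul_mem' := fun {a b} ha hb v => by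
    rw [show (a * b) v = a (b v) from rfl, ha, hb]
  inv_mem' := fun {a} ha v => by
    rw [show (a⁻¹ : V ≃ₗ[F] V) v = a.symm v from rfl, ← ha (a.symm v), a.apply_symm_apply]

/-- The group of linear automorphisms of a vector space `V` preserving a
pairing `ω : V → V → F` (e.g. a bilinear or sesquilinear form). -/
def bilinIsoms {V : Type} [AddCommGroup V] [Module F V] (ω : V → V → F) :
    Subgroup (V ≃ₗ[F] V) where
  carrier := {g | ∀ v w, ω (g v) (g w) = ω v w}
  one_mem' := fun _ _ => rfl
  mul_mem' := fun {a b} ha hb v w => by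
    rw [show (a * b) v = a (b v) from rfl, show (a * b) w = a (b w) from rfl, ha, hb]
  inv_mem' := fun {a} ha v w => by
    rw [show (a⁻¹ : V ≃ₗ[F] V) v = a.symm v from rfl,
      show (a⁻¹ : V ≃ₗ[F] V) w = a.symm w from rfl,
      ← ha (a.symm v) (a.symm w), a.apply_symm_apply, a.apply_symm_apply]

/-- The "orthogonal sum" form `x ↦ ∑ i, q (x i)` on `W^n`. -/
def sumForm (q : W → F) (n : ℕ) (x : Fin n → W) : F := ∑ i, q (x i)

/-- The "orthogonal sum" pairing `(x, y) ↦ ∑ i, β (x i) (y i)` on `W^n`. -/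
def pairForm (β : W → W → F) (n : ℕ) (x y : Fin n → W) : F := ∑ i, β (x i) (y i)

/-- The linear equivalence `W^{n+1} ≃ W^n × W` splitting off the last coordinate. -/
def lastSplit (n : ℕ) : (Fin (n + 1) → W) ≃ₗ[F] (Fin n → W) × W where
  toLinearMap := (LinearMap.funLeft F W Fin.castSucc).prod (LinearMap.proj (Fin.last n))
  invFun p := Fin.snoc p.1 p.2
  left_inv x := Fin.snoc_init_self x
  right_inv p := by
    refine Prod.ext (funext fun i => ?_) ?_
    · exact @Fin.snoc_castSucc n (fun _ => W) p.2 p.1 i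
    · exact @Fin.snoc_last n (fun _ => W) p.2 p.1

lemma lastSplit_symm_apply (n : ℕ) (p : Fin n → W) (w : W) :
    (lastSplit F n).symm (p, w) = Fin.snoc p w := rfl

/-- Extension of an automorphism of `W^n` to `W^{n+1}` by the identity on the
added last coordinate. -/
def stabAut (n : ℕ) (g : (Fin n → W) ≃ₗ[F] (Fin n → W)) :
    (Fin (n + 1) → W) ≃ₗ[F] (Fin (n + 1) → W) :=
  (lastSplit F n).trans ((g.prodCongr (LinearEquiv.refl F W)).trans (lastSplit F n).symm)

lemma stabAut_symm_apply (n : ℕ) (g : (Fin n → W) ≃ₗ[F] (Fin n → W))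
    (p : Fin n → W) (w : W) :
    stabAut F n g ((lastSplit F n).symm (p, w)) = (lastSplit F n).symm (g p, w) := by
  simp [stabAut, LinearEquiv.trans_apply, LinearEquiv.apply_symm_apply, LinearEquiv.prodCongr_apply]

lemma sumForm_snoc (q : W → F) (n : ℕ) (p : Fin n → W) (w : W) :
    sumForm F q (n + 1) ((lastSplit F n).symm (p, w)) = sumForm F q n p + q w := by
  simp [sumForm, lastSplit_symm_apply, Fin.sum_univ_castSucc, Fin.snoc_castSucc, Fin.snoc_last]

lemma pairForm_snoc (β : W → W → F) (n : ℕ) (p p' : Fin n → W) (w w' : W) :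
    pairForm F β (n + 1) ((lastSplit F n).symm (p, w)) ((lastSplit F n).symm (p', w'))
      = pairForm F β n p p' + β w w' := by
  simp [pairForm, lastSplit_symm_apply, Fin.sum_univ_castSucc, Fin.snoc_castSucc, Fin.snoc_last]

/-- The stabilization homomorphism on the isometry group of the form `sumForm q n`,
extending an isometry by the identity on the added summand. -/
def quadStab (q : W → F) (n : ℕ) :
    quadIsoms F (sumForm F q n) →* quadIsoms F (sumForm F q (n + 1)) where
  toFun g := ⟨stabAut F n g.1, by
    intro v
    obtain ⟨⟨p, w⟩, rfl⟩ : ∃ x, (lastSplit F n).symm x = v :=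
      ⟨lastSplit F n v, (lastSplit F n).symm_apply_apply v⟩
    rw [stabAut_symm_apply, sumForm_snoc, sumForm_snoc, g.2 p]⟩
  map_one' := by
    refine Subtype.ext (LinearEquiv.ext fun v => ?_)
    show stabAut F n 1 v = v
    obtain ⟨⟨p, w⟩, rfl⟩ : ∃ x, (lastSplit F n).symm x = v :=
      ⟨lastSplit F n v, (lastSplit F n).symm_apply_apply v⟩
    rw [stabAut_symm_apply]
    rfl
  map_mul' g h := by
    refine Subtype.ext (LinearEquiv.ext fun v => ?_)
    show stabAut F n (g.1 * h.1) v = stabAut F n g.1 (stabAut F n h.1 v)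
    obtain ⟨⟨p, w⟩, rfl⟩ : ∃ x, (lastSplit F n).symm x = v :=
      ⟨lastSplit F n v, (lastSplit F n).symm_apply_apply v⟩
    rw [stabAut_symm_apply, stabAut_symm_apply, stabAut_symm_apply]
    rfl

/-- The stabilization homomorphism on the isometry group of the pairing `pairForm β n`,
extending an isometry by the identity on the added summand. -/
def bilinStab (β : W → W → F) (n : ℕ) :
    bilinIsoms F (pairForm F β n) →* bilinIsoms F (pairForm F β (n + 1)) where
  toFun g := ⟨stabAut F n g.1, by
    intro v v'
    obtain ⟨⟨p, w⟩, rfl⟩ : ∃ x, (lastSplit F n).symm x = v :=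
      ⟨lastSplit F n v, (lastSplit F n).symm_apply_apply v⟩
    obtain ⟨⟨p', w'⟩, rfl⟩ : ∃ x, (lastSplit F n).symm x = v' :=
      ⟨lastSplit F n v', (lastSplit F n).symm_apply_apply v'⟩
    rw [stabAut_symm_apply, stabAut_symm_apply, pairForm_snoc, pairForm_snoc, g.2 p p']⟩
  map_one' := by
    refine Subtype.ext (LinearEquiv.ext fun v => ?_)
    show stabAut F n 1 v = v
    obtain ⟨⟨p, w⟩, rfl⟩ : ∃ x, (lastSplit F n).symm x = v :=
      ⟨lastSplit F n v, (lastSplit F n).symm_apply_apply v⟩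
    rw [stabAut_symm_apply]
    rfl
  map_mul' g h := by
    refine Subtype.ext (LinearEquiv.ext fun v => ?_)
    show stabAut F n (g.1 * h.1) v = stabAut F n g.1 (stabAut F n h.1 v)
    obtain ⟨⟨p, w⟩, rfl⟩ : ∃ x, (lastSplit F n).symm x = v :=
      ⟨lastSplit F n v, (lastSplit F n).symm_apply_apply v⟩
    rw [stabAut_symm_apply, stabAut_symm_apply, stabAut_symm_apply]
    rfl

end Isometries

namespace UEH

/-! ## Part A: chain calculus on lists -/

section Chains

variable {k : Type} [Field k]

/-- lists with the entrywise action -/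
instance listAct {G A : Type} [Group G] [MulAction G A] : MulAction G (List A) where
  smul g l := l.map (g • ·)
  one_smul l := by show l.map _ = l; simp
  mul_smul g h l := by show l.map _ = (l.map _).map _; simp [mul_smul]

theorem smul_list_def {G A : Type} [Group G] [MulAction G A] (g : G) (l : List A) :
    g • l = l.map (g • ·) := rfl

@[simp] theorem smul_list_nil {G A : Type} [Group G] [MulAction G A] (g : G) :
    g • ([] : List A) = [] := rfl

@[simp] theorem smul_list_cons {G A : Type} [Group G] [MulAction G A] (g : G) (x : A)
    (l : List A) : g • (x :: l) = (g • x) :: (g • l) := rfl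

@[simp] theorem smul_list_length {G A : Type} [Group G] [MulAction G A] (g : G)
    (l : List A) : (g • l).length = l.length := by simp [smul_list_def]

variable (k) in
/-- pushforward -/
noncomputable abbrev pf {X Y : Type} (f : X → Y) : (X →₀ k) →ₗ[k] (Y →₀ k) :=
  Finsupp.lmapDomain k k f

theorem pf_single {X Y : Type} (f : X → Y) (x : X) (c : k) :
    pf k f (Finsupp.single x c) = Finsupp.single (f x) c := by
  simp [Finsupp.mapDomain_single]

theorem pf_pf {X Y Z : Type} (f : X → Y) (g : Y → Z) (a : X →₀ k) :
    pf k g (pf k f a) = pf k (g ∘ f) a := by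
  simp [Finsupp.mapDomain_comp]

theorem lin_ext {X : Type} {N : Type} [AddCommGroup N] [Module k N]
    {f g : (X →₀ k) →ₗ[k] N} (h : ∀ x, f (Finsupp.single x 1) = g (Finsupp.single x 1)) :
    f = g := by
  apply Finsupp.lhom_ext'
  intro x
  apply LinearMap.ext_ring
  exact h x

variable (k) in
/-- boundary on basis -/
noncomputable def bd {A : Type} : List A → (List A →₀ k)
  | [] => 0
  | x :: l => Finsupp.single l 1 - pf k (List.cons x) (bd l)

variable (k) in
/-- boundary -/
noncomputable def del {A : Type} : (List A →₀ k) →ₗ[k] (List A →₀ k) :=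
  Finsupp.linearCombination k (bd k)

theorem del_single {A : Type} (l : List A) :
    del k (Finsupp.single l 1) = bd k l := by
  simp [del]

theorem del_nil {A : Type} : del k (Finsupp.single ([] : List A) 1) = 0 := by
  simp [del_single, bd]

theorem del_cons' {A : Type} (x : A) (l : List A) :
    del k (Finsupp.single (x :: l) 1) =
      Finsupp.single l 1 - pf k (List.cons x) (del k (Finsupp.single l 1)) := by
  simp only [del_single, bd]

theorem del_cons {A : Type} (x : A) (a : List A →₀ k) :
    del k (pf k (List.cons x) a) = a - pf k (List.cons x) (del k a) := by
  have : (del k ∘ₗ pf k (List.cons x)) = LinearMap.id - pf k (List.cons x) ∘ₗ del k := by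
    apply lin_ext
    intro l
    simp only [LinearMap.comp_apply, pf_single, LinearMap.sub_apply, LinearMap.id_apply]
    exact del_cons' x l
  exact LinearMap.congr_fun this a

theorem del_del {A : Type} (a : List A →₀ k) : del k (del k a) = 0 := by
  have : (del k ∘ₗ del k : (List A →₀ k) →ₗ[k] _) = 0 := by
    apply lin_ext
    intro l
    simp only [LinearMap.comp_apply, LinearMap.zero_apply]
    induction l with
    | nil => simp [del_nil]
    | cons x l ih => rw [del_cons', map_sub, del_cons, ih]; simp
  exact LinearMap.congr_fun this a

theorem del_map {A A' : Type} (f : A → A') (a : List A →₀ k) :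
    del k (pf k (List.map f) a) = pf k (List.map f) (del k a) := by
  have : (del k ∘ₗ pf k (List.map f)) = pf k (List.map f) ∘ₗ del k := by
    apply lin_ext
    intro l
    simp only [LinearMap.comp_apply, pf_single]
    induction l with
    | nil => simp [del_nil]
    | cons x l ih =>
      rw [List.map_cons, del_cons', del_cons', ih, map_sub, pf_single, pf_pf, pf_pf]
      rfl
  exact LinearMap.congr_fun this a

variable (k) in
/-- chains supported on a set -/
abbrev sp {X : Type} (S : Set X) : Submodule k (X →₀ k) := Finsupp.supported k k S

theorem sp_eq_span {X : Type} (S : Set X) :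
    sp k S = Submodule.span k ((fun x => Finsupp.single x (1 : k)) '' S) :=
  Finsupp.supported_eq_span_single k S

theorem single_mem_sp {X : Type} {S : Set X} {x : X} (h : x ∈ S) (c : k) :
    Finsupp.single x c ∈ sp k S := Finsupp.single_mem_supported k c h

/-- a linear map sends supported chains into N if it does so on the basis -/
theorem sp_map {X N : Type} [AddCommGroup N] [Module k N] {S : Set X} {P : Submodule k N}
    (f : (X →₀ k) →ₗ[k] N) (h : ∀ x ∈ S, f (Finsupp.single x 1) ∈ P) {a : X →₀ k}
    (ha : a ∈ sp k S) : f a ∈ P := by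
  rw [sp_eq_span] at ha
  have : Submodule.span k ((fun x => Finsupp.single x (1 : k)) '' S) ≤ P.comap f := by
    rw [Submodule.span_le]
    rintro _ ⟨x, hx, rfl⟩
    exact h x hx
  exact this ha

theorem pf_sp {X Y : Type} (f : X → Y) {S : Set X} {S' : Set Y} (h : ∀ x ∈ S, f x ∈ S')
    {a : X →₀ k} (ha : a ∈ sp k S) : pf k f a ∈ sp k S' := by
  refine sp_map (pf k f) (fun x hx => ?_) ha
  rw [pf_single]; exact single_mem_sp (h x hx) 1

/-- the boundary of a basis element is supported on facets -/
theorem del_single_sp {A : Type} (l : List A) :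
    del k (Finsupp.single l 1) ∈
      sp k {t : List A | t.Sublist l ∧ t.length + 1 = l.length} := by
  induction l with
  | nil => rw [del_nil]; exact Submodule.zero_mem _
  | cons x l ih =>
    rw [del_cons']
    refine Submodule.sub_mem _ (single_mem_sp (S := {t : List A | t.Sublist (x :: l) ∧
      t.length + 1 = (x :: l).length}) ⟨List.sublist_cons_self x l, by simp⟩ 1) ?_
    refine pf_sp _ ?_ ih
    rintro t ⟨h1, h2⟩
    exact ⟨h1.cons_cons x, by simp [h2]⟩

theorem del_sp {A : Type} {S S' : Set (List A)}
    (h : ∀ l ∈ S, ∀ t, t.Sublist l → t.length + 1 = l.length → t ∈ S')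
    {a : List A →₀ k} (ha : a ∈ sp k S) : del k a ∈ sp k S' := by
  refine sp_map (del k) (fun l hl => ?_) ha
  refine Finsupp.supported_mono ?_ (del_single_sp l)
  rintro t ⟨h1, h2⟩
  exact h l hl t h1 h2

/-! ### coinvariants -/

variable {G : Type} [Group G]

variable (k) in
/-- span of `h x - x` for `h` in `H` -/
noncomputable def co (H : Subgroup G) (X : Type) [MulAction G X] : Submodule k (X →₀ k) :=
  Submodule.span k {c | ∃ h ∈ H, ∃ x : X, c = Finsupp.single (h • x) 1 - Finsupp.single x 1}

theorem co_basic {H : Subgroup G} {X : Type} [MulAction G X] {h : G} (hh : h ∈ H) (x : X) :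
    (Finsupp.single (h • x) 1 - Finsupp.single x 1 : X →₀ k) ∈ co k H X :=
  Submodule.subset_span ⟨h, hh, x, rfl⟩

theorem co_map {H : Subgroup G} {X N : Type} [MulAction G X] [AddCommGroup N] [Module k N]
    {P : Submodule k N} (f : (X →₀ k) →ₗ[k] N)
    (hf : ∀ h ∈ H, ∀ x : X, f (Finsupp.single (h • x) 1) - f (Finsupp.single x 1) ∈ P)
    {a : X →₀ k} (ha : a ∈ co k H X) : f a ∈ P := by
  have : co k H X ≤ P.comap f := by
    unfold co
    rw [Submodule.span_le]
    rintro _ ⟨h, hh, x, rfl⟩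
    simpa using hf h hh x
  exact this ha

theorem co_mono {H H' : Subgroup G} (hle : H ≤ H') {X : Type} [MulAction G X] :
    co k H X ≤ co k H' X := by
  refine Submodule.span_mono ?_
  rintro _ ⟨h, hh, x, rfl⟩
  exact ⟨h, hle hh, x, rfl⟩

theorem pf_smul_sub {H : Subgroup G} {X : Type} [MulAction G X] {h : G} (hh : h ∈ H)
    (a : X →₀ k) : pf k (h • ·) a - a ∈ co k H X := by
  have := sp_map (S := Set.univ) (P := co k H X) (pf k (fun x : X => h • x) - LinearMap.id)
    (fun x _ => by
      simp only [LinearMap.sub_apply, pf_single, LinearMap.id_apply]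
      exact co_basic hh x) (a := a) (by simp [sp])
  simpa using this

theorem pf_smul_del {A : Type} [MulAction G A] (g : G) (a : List A →₀ k) :
    del k (pf k (g • ·) a) = pf k (g • ·) (del k a) := del_map (fun x => g • x) a

theorem del_co {H : Subgroup G} {A : Type} [MulAction G A] {a : List A →₀ k}
    (ha : a ∈ co k H (List A)) : del k a ∈ co k H (List A) := by
  refine co_map (del k) (fun h hh x => ?_) ha
  have := pf_smul_del (k := k) h (Finsupp.single x 1)
  rw [pf_single] at this
  rw [this]
  exact pf_smul_sub hh _

/-- equivariant maps preserve coinvariant relations, possibly along a map of groups -/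
theorem pf_co {H H' : Subgroup G} {X Y : Type} [MulAction G X] [MulAction G Y] (f : X → Y)
    (hf : ∀ h ∈ H, ∀ x, ∃ h' ∈ H', f (h • x) = h' • f x) {a : X →₀ k} (ha : a ∈ co k H X) :
    pf k f a ∈ co k H' Y := by
  refine co_map (pf k f) (fun h hh x => ?_) ha
  obtain ⟨h', hh', e⟩ := hf h hh x
  rw [pf_single, pf_single, e]
  exact co_basic hh' _

/-! ### homology of subgroups -/

variable (k) in
/-- chains of group lists of length `n` -/
abbrev ln (G : Type) (n : ℕ) : Submodule k (List G →₀ k) := sp k {l : List G | l.length = n}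

theorem del_ln {A : Type} {n : ℕ} {a : List A →₀ k} (ha : a ∈ ln k A (n + 1)) :
    del k a ∈ ln k A n := by
  refine del_sp ?_ ha
  intro l hl t _ h2
  simp only [Set.mem_ofPred_eq] at hl ⊢; omega

variable (k) in
/-- cycles mod `H` -/
noncomputable def Cyc (H : Subgroup G) (j : ℕ) : Submodule k (List G →₀ k) :=
  ln k G (j + 1) ⊓ (co k H (List G)).comap (del k)

variable (k) in
/-- boundaries mod `H` -/
noncomputable def Bd (H : Subgroup G) (j : ℕ) : Submodule k (List G →₀ k) :=
  co k H (List G) ⊔ (ln k G (j + 2)).map (del k)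

variable (k) in
def Vanish (H : Subgroup G) (j : ℕ) : Prop := Cyc k H j ≤ Bd k H j

variable (k) in
def Onto (H H' : Subgroup G) (j : ℕ) : Prop :=
  ∀ a ∈ Cyc k H' j, ∃ b ∈ Cyc k H j, a - b ∈ Bd k H' j

theorem Cyc_mono {H H' : Subgroup G} (hle : H ≤ H') (j : ℕ) : Cyc k H j ≤ Cyc k H' j :=
  inf_le_inf le_rfl (Submodule.comap_mono (co_mono hle))

theorem Bd_mono {H H' : Subgroup G} (hle : H ≤ H') (j : ℕ) : Bd k H j ≤ Bd k H' j :=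
  sup_le_sup (co_mono hle) le_rfl

theorem Onto.trans {H H' H'' : Subgroup G} {j : ℕ} (hle : H' ≤ H'') (h1 : Onto k H H' j)
    (h2 : Onto k H' H'' j) : Onto k H H'' j := by
  intro a ha
  obtain ⟨b, hb, e⟩ := h2 a ha
  obtain ⟨c, hc, e'⟩ := h1 b hb
  refine ⟨c, hc, ?_⟩
  have := Submodule.add_mem _ e (Bd_mono hle j e')
  simpa using this

theorem Onto.rfl' {H : Subgroup G} {j : ℕ} : Onto k H H j :=
  fun a ha => ⟨a, ha, by simp⟩

/-- smulling a cycle by a group element -/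
theorem pf_smul_ln {A : Type} [MulAction G A] (g : G) {n : ℕ} {a : List A →₀ k}
    (ha : a ∈ ln k A n) : pf k (g • ·) a ∈ ln k A n := by
  refine pf_sp _ ?_ ha
  intro l hl; simpa using hl

theorem Cyc_conj {H H' : Subgroup G} (g : G) (hg : ∀ h ∈ H, g * h * g⁻¹ ∈ H') {j : ℕ}
    {a : List G →₀ k} (ha : a ∈ Cyc k H j) : pf k (g • ·) a ∈ Cyc k H' j := by
  refine ⟨pf_smul_ln g ha.1, ?_⟩
  rw [SetLike.mem_coe, Submodule.mem_comap, pf_smul_del]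
  refine pf_co (H := H) _ (fun h hh x => ⟨_, hg h hh, ?_⟩) ha.2
  simp [mul_smul]

/-! ### prism -/

variable (k) in
noncomputable def prB {A A' : Type} (f h : A → A') : List A → (List A' →₀ k)
  | [] => 0
  | x :: l => Finsupp.single (f x :: h x :: l.map h) 1 - pf k (List.cons (f x)) (prB f h l)

variable (k) in
noncomputable def pr {A A' : Type} (f h : A → A') : (List A →₀ k) →ₗ[k] (List A' →₀ k) :=
  Finsupp.linearCombination k (prB k f h)

theorem pr_nil {A A' : Type} (f h : A → A') : pr k f h (Finsupp.single [] 1) = 0 := by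
  simp [pr, prB]

theorem pr_cons' {A A' : Type} (f h : A → A') (x : A) (l : List A) :
    pr k f h (Finsupp.single (x :: l) 1) =
      Finsupp.single (f x :: h x :: l.map h) 1
        - pf k (List.cons (f x)) (pr k f h (Finsupp.single l 1)) := by
  simp [pr, prB]

theorem pr_cons {A A' : Type} (f h : A → A') (x : A) (a : List A →₀ k) :
    pr k f h (pf k (List.cons x) a) = pf k (List.cons (f x)) (pf k (List.cons (h x))
      (pf k (List.map h) a)) - pf k (List.cons (f x)) (pr k f h a) := by
  have : (pr k f h ∘ₗ pf k (List.cons x)) = pf k (List.cons (f x)) ∘ₗ pf k (List.cons (h x))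
      ∘ₗ pf k (List.map h) - pf k (List.cons (f x)) ∘ₗ pr k f h := by
    apply lin_ext
    intro l
    simp only [LinearMap.comp_apply, LinearMap.sub_apply, pf_single]
    exact pr_cons' f h x l
  exact LinearMap.congr_fun this a

theorem prism {A A' : Type} (f h : A → A') (a : List A →₀ k) :
    del k (pr k f h a) + pr k f h (del k a) = pf k (List.map h) a - pf k (List.map f) a := by
  have : (del k ∘ₗ pr k f h + pr k f h ∘ₗ del k : (List A →₀ k) →ₗ[k] _)
      = pf k (List.map h) - pf k (List.map f) := by
    apply lin_ext
    intro l
    simp only [LinearMap.comp_apply, LinearMap.sub_apply, LinearMap.add_apply, pf_single]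
    induction l with
    | nil => simp [del_nil, pr_nil]
    | cons x l ih =>
      rw [pr_cons', map_sub, del_cons', del_cons', del_cons, del_cons', map_sub, map_sub, pf_single]
      rw [pr_cons]
      have e : pf k (List.cons (f x)) (del k (pr k f h (Finsupp.single l 1)))
          + pf k (List.cons (f x)) (pr k f h (del k (Finsupp.single l 1)))
          = pf k (List.cons (f x)) (Finsupp.single (l.map h) 1)
            - pf k (List.cons (f x)) (Finsupp.single (l.map f) 1) := by
        rw [← map_add, ih, map_sub]
      rw [pf_single, pf_single] at e
      rw [← del_map h, pf_single]
      simp only [List.map_cons]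
      rw [← sub_eq_zero] at e ⊢
      rw [← e]
      abel
  exact LinearMap.congr_fun this a

theorem pr_ln {A A' : Type} (f h : A → A') {n : ℕ} {a : List A →₀ k} (ha : a ∈ ln k A n) :
    pr k f h a ∈ ln k A' (n + 1) := by
  refine sp_map _ (fun l hl => ?_) ha
  simp only [Set.mem_ofPred_eq] at hl
  subst hl
  clear ha
  induction l with
  | nil => simp [pr_nil]
  | cons x l ih =>
    rw [pr_cons']
    refine Submodule.sub_mem _ (single_mem_sp (by simp) 1) (pf_sp _ ?_ ih)
    intro t ht; simp only [Set.mem_ofPred_eq, List.length_cons] at ht ⊢; omega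

theorem pr_smul {A A' : Type} [MulAction G A] [MulAction G A'] (f h : A → A') (g g' : G)
    (hf : ∀ x, f (g • x) = g' • f x) (hh : ∀ x, h (g • x) = g' • h x) (l : List A) :
    pr k f h (Finsupp.single (g • l) 1) = pf k (g' • ·) (pr k f h (Finsupp.single l 1)) := by
  induction l with
  | nil => simp [pr_nil]
  | cons x l ih =>
    have e : ∀ l : List A, (g • l).map h = g' • l.map h := by
      intro l; simp [smul_list_def, hh]
    rw [smul_list_cons, pr_cons', pr_cons', ih, map_sub, pf_single, pf_pf, pf_pf, e, hf, hh]
    rfl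

/-- maps equivariant along the same assignment of group elements induce homologous maps -/
theorem pr_homologous {H H' : Subgroup G} (f h : G → G) 
    (e : ∀ u ∈ H, ∃ u' ∈ H', (∀ x, f (u * x) = u' * f x) ∧ (∀ x, h (u * x) = u' * h x))
    {j : ℕ} {a : List G →₀ k} (ha : a ∈ Cyc k H j) :
    pf k (List.map h) a - pf k (List.map f) a ∈ Bd k H' j := by
  rw [← prism]
  refine Submodule.add_mem _ ?_ ?_
  · exact Submodule.mem_sup_right ⟨_, pr_ln f h ha.1, rfl⟩
  · refine Submodule.mem_sup_left (co_map (H := H) (pr k f h) (fun u hu x => ?_) ha.2)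
    obtain ⟨u', hu', e1, e2⟩ := e u hu
    rw [pr_smul f h u u' e1 e2]
    exact pf_smul_sub hu' _

theorem pf_map_Cyc {H H' : Subgroup G} (f : G → G)
    (e : ∀ u ∈ H, ∃ u' ∈ H', ∀ x, f (u * x) = u' * f x)
    {j : ℕ} {a : List G →₀ k} (ha : a ∈ Cyc k H j) :
    pf k (List.map f) a ∈ Cyc k H' j := by
  refine ⟨pf_sp _ (fun l hl => by simpa using hl) ha.1, ?_⟩
  rw [SetLike.mem_coe, Submodule.mem_comap, del_map]
  refine pf_co (H := H) _ (fun u hu x => ?_) ha.2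
  obtain ⟨u', hu', e1⟩ := e u hu
  exact ⟨u', hu', by simp [smul_list_def, e1]⟩

theorem pf_map_Bd {H H' : Subgroup G} (f : G → G)
    (e : ∀ u ∈ H, ∃ u' ∈ H', ∀ x, f (u * x) = u' * f x)
    {j : ℕ} {a : List G →₀ k} (ha : a ∈ Bd k H j) :
    pf k (List.map f) a ∈ Bd k H' j := by
  obtain ⟨x, hx, y, ⟨z, hz, rfl⟩, rfl⟩ := Submodule.mem_sup.1 ha
  rw [map_add]
  refine Submodule.add_mem _ (Submodule.mem_sup_left ?_) (Submodule.mem_sup_right ?_)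
  · refine pf_co (H := H) _ (fun u hu x => ?_) hx
    obtain ⟨u', hu', e1⟩ := e u hu
    exact ⟨u', hu', by simp [smul_list_def, e1]⟩
  · exact ⟨_, pf_sp _ (fun l hl => by simpa using hl) hz, del_map f z⟩

/-- an element commuting with `H` acts trivially on homology of `H` -/
theorem comm_smul {H : Subgroup G} (g : G) (hg : ∀ h ∈ H, g * h = h * g) {j : ℕ}
    {a : List G →₀ k} (ha : a ∈ Cyc k H j) : pf k (g • ·) a - a ∈ Bd k H j := by
  have := pr_homologous (H := H) (H' := H) (fun x => x) (fun x => g * x)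
    (fun u hu => ⟨u, hu, fun x => rfl, fun x => by rw [← mul_assoc, hg u hu, mul_assoc]⟩) ha
  have e : List.map (fun x : G => x) = id := by funext l; simp
  rw [e] at this
  simpa [smul_list_def] using this

/-- equivariant map along a homomorphism defined on a subgroup -/
theorem exists_equivariant (H : Subgroup G) (φ : H →* G) :
    ∃ f : G → G, ∀ (u : H) (x : G), f (u * x) = φ u * f x := by
  classical
  let q : G → Quotient (QuotientGroup.rightRel H) := fun x => Quotient.mk'' x
  have hq : ∀ x, (x * (q x).out⁻¹) ∈ H := by
    intro x
    have : (QuotientGroup.rightRel H) (q x).out x := Quotient.mk_out (s := QuotientGroup.rightRel H) x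
    have h2 := (QuotientGroup.rightRel_apply (s := H)).1 this
    exact h2
  have hqu : ∀ (u : H) x, q (u * x) = q x := by
    intro u x
    refine Quotient.sound' ?_
    rw [QuotientGroup.rightRel_apply]
    have : x * (↑u * x)⁻¹ = (u : G)⁻¹ := by group
    rw [this]
    exact H.inv_mem u.2
  refine ⟨fun x => φ ⟨x * (q x).out⁻¹, hq x⟩, ?_⟩
  intro u x
  show φ _ = φ _ * φ _
  rw [← map_mul]
  congr 1
  apply Subtype.ext
  simp only [hqu, Subgroup.coe_mul, mul_assoc]

end Chains

end UEH

namespace UEH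

section Bicomplex

variable {k : Type} [Field k]

theorem lin_ext2 {X Y N : Type} [AddCommGroup N] [Module k N]
    {f g : (X →₀ k) →ₗ[k] (Y →₀ k) →ₗ[k] N}
    (h : ∀ x y, f (Finsupp.single x 1) (Finsupp.single y 1)
      = g (Finsupp.single x 1) (Finsupp.single y 1)) : f = g :=
  lin_ext fun x => lin_ext fun y => h x y

variable (k) in
/-- tensor of chains -/
noncomputable def tn {X Y : Type} : (X →₀ k) →ₗ[k] (Y →₀ k) →ₗ[k] (X × Y →₀ k) :=
  Finsupp.linearCombination k (fun x => pf k (fun y => (x, y)))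

theorem tn_single {X Y : Type} (x : X) (z : Y →₀ k) :
    tn k (Finsupp.single x 1) z = pf k (fun y => (x, y)) z := by
  simp [tn]

theorem tn_single_single {X Y : Type} (x : X) (y : Y) :
    tn k (Finsupp.single x 1) (Finsupp.single y 1) = Finsupp.single (x, y) 1 := by
  rw [tn_single, pf_single]

theorem tn_single_right {X Y : Type} (a : X →₀ k) (y : Y) :
    tn k a (Finsupp.single y 1) = pf k (fun x => (x, y)) a := by
  have : (tn k).flip (Finsupp.single y 1) = pf k (fun x : X => (x, y)) := by
    apply lin_ext
    intro x
    simp [tn_single, Finsupp.mapDomain_single]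
  exact LinearMap.congr_fun this a

variable (k) in
/-- lift a linear map on the left factor -/
noncomputable def liftL {X X' : Type} (Y : Type) (f : (X →₀ k) →ₗ[k] (X' →₀ k)) :
    (X × Y →₀ k) →ₗ[k] (X' × Y →₀ k) :=
  Finsupp.linearCombination k (fun p => tn k (f (Finsupp.single p.1 1)) (Finsupp.single p.2 1))

variable (k) in
/-- lift a linear map on the right factor -/
noncomputable def liftR {Y Y' : Type} (X : Type) (f : (Y →₀ k) →ₗ[k] (Y' →₀ k)) :
    (X × Y →₀ k) →ₗ[k] (X × Y' →₀ k) :=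
  Finsupp.linearCombination k (fun p => tn k (Finsupp.single p.1 1) (f (Finsupp.single p.2 1)))

theorem liftL_tn {X X' Y : Type} (f : (X →₀ k) →ₗ[k] (X' →₀ k)) (a : X →₀ k) (z : Y →₀ k) :
    liftL k Y f (tn k a z) = tn k (f a) z := by
  have : (tn k).compr₂ (liftL k Y f) = (tn k).comp f := by
    apply lin_ext2
    intro x y
    simp [tn_single_single, liftL]
  exact LinearMap.congr_fun₂ this a z

theorem liftR_tn {X Y Y' : Type} (f : (Y →₀ k) →ₗ[k] (Y' →₀ k)) (a : X →₀ k) (z : Y →₀ k) :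
    liftR k X f (tn k a z) = tn k a (f z) := by
  have : (tn k).compr₂ (liftR k X f) = (tn k).compl₂ f := by
    apply lin_ext2
    intro x y
    simp [tn_single_single, liftR]
  exact LinearMap.congr_fun₂ this a z

theorem prod_ext {X Y N : Type} [AddCommGroup N] [Module k N]
    {f g : (X × Y →₀ k) →ₗ[k] N} (h : ∀ a z, f (tn k a z) = g (tn k a z)) : f = g := by
  apply lin_ext
  rintro ⟨x, y⟩
  rw [← tn_single_single]
  exact h _ _

variable {G A : Type} [Group G] [MulAction G A]

variable (k) in
noncomputable abbrev dG (G Y : Type) : (List G × Y →₀ k) →ₗ[k] (List G × Y →₀ k) :=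
  liftL k Y (del k)

variable (k) in
noncomputable abbrev dX (X A : Type) : (X × List A →₀ k) →ₗ[k] (X × List A →₀ k) :=
  liftR k X (del k)

theorem dG_dX (c : List G × List A →₀ k) :
    dG k G (List A) (dX k (List G) A c) = dX k (List G) A (dG k G (List A) c) := by
  have : dG k G (List A) ∘ₗ dX k (List G) A = dX k (List G) A ∘ₗ dG k G (List A) := by
    apply prod_ext
    intro a z
    simp [liftL_tn, liftR_tn]
  exact LinearMap.congr_fun this c

theorem dG_dG {Y : Type} (c : List G × Y →₀ k) : dG k G Y (dG k G Y c) = 0 := by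
  have : dG k G Y ∘ₗ dG k G Y = 0 := by
    apply prod_ext
    intro a z
    simp [liftL_tn, del_del]
  exact LinearMap.congr_fun this c

theorem dX_dX {X : Type} (c : X × List A →₀ k) : dX k X A (dX k X A c) = 0 := by
  have : dX k X A ∘ₗ dX k X A = 0 := by
    apply prod_ext
    intro a z
    simp [liftR_tn, del_del]
  exact LinearMap.congr_fun this c

theorem tn_sp {X Y : Type} {S : Set X} {S' : Set Y} {a : X →₀ k} {z : Y →₀ k}
    (ha : a ∈ sp k S) (hz : z ∈ sp k S') : tn k a z ∈ sp k (S ×ˢ S') := by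
  refine sp_map ((tn k).flip z) (fun x hx => ?_) ha
  rw [LinearMap.flip_apply]
  refine sp_map _ (fun y hy => ?_) hz
  rw [tn_single_single]
  exact single_mem_sp (Set.mk_mem_prod hx hy) 1

theorem pf_prod {X Y X' Y' : Type} (f : X → X') (h : Y → Y') (a : X →₀ k) (z : Y →₀ k) :
    pf k (fun p : X × Y => (f p.1, h p.2)) (tn k a z) = tn k (pf k f a) (pf k h z) := by
  have : (tn k).compr₂ (pf k (fun p : X × Y => (f p.1, h p.2)))
      = ((tn k).comp (pf k f)).compl₂ (pf k h) := by
    apply lin_ext2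
    intro x y
    simp [tn_single_single, Finsupp.mapDomain_single]
  exact LinearMap.congr_fun₂ this a z

theorem smul_tn {X Y : Type} [MulAction G X] [MulAction G Y] (g : G) (a : X →₀ k)
    (z : Y →₀ k) :
    pf k (g • ·) (tn k a z) = tn k (pf k (g • ·) a) (pf k (g • ·) z) :=
  pf_prod (fun x => g • x) (fun y => g • y) a z

theorem dG_smul {Y : Type} [MulAction G Y] (g : G) (c : List G × Y →₀ k) :
    dG k G Y (pf k (g • ·) c) = pf k (g • ·) (dG k G Y c) := by
  have : dG k G Y ∘ₗ pf k (g • ·) = pf k (g • ·) ∘ₗ dG k G Y := by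
    apply prod_ext
    intro a z
    rw [LinearMap.comp_apply, LinearMap.comp_apply, smul_tn, liftL_tn, liftL_tn, smul_tn,
      pf_smul_del]
  exact LinearMap.congr_fun this c

theorem dX_smul {X : Type} [MulAction G X] (g : G) (c : X × List A →₀ k) :
    dX k X A (pf k (g • ·) c) = pf k (g • ·) (dX k X A c) := by
  have : dX k X A ∘ₗ pf k (g • ·) = pf k (g • ·) ∘ₗ dX k X A := by
    apply prod_ext
    intro a z
    rw [LinearMap.comp_apply, LinearMap.comp_apply, smul_tn, liftR_tn, liftR_tn, smul_tn,
      pf_smul_del]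
  exact LinearMap.congr_fun this c

theorem dG_co {H : Subgroup G} {Y : Type} [MulAction G Y] {c : List G × Y →₀ k}
    (hc : c ∈ co k H (List G × Y)) : dG k G Y c ∈ co k H (List G × Y) := by
  refine co_map (dG k G Y) (fun h hh x => ?_) hc
  have := dG_smul (k := k) h (Finsupp.single x 1)
  rw [pf_single] at this
  rw [this]
  exact pf_smul_sub hh _

theorem dX_co {H : Subgroup G} {X : Type} [MulAction G X] {c : X × List A →₀ k}
    (hc : c ∈ co k H (X × List A)) : dX k X A c ∈ co k H (X × List A) := by
  refine co_map (dX k X A) (fun h hh x => ?_) hc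
  have := dX_smul (k := k) h (Finsupp.single x 1)
  rw [pf_single] at this
  rw [this]
  exact pf_smul_sub hh _

/-- component at `y` -/
noncomputable def comp {X Y : Type} (k : Type) [Field k] (y : Y) : (X × Y →₀ k) →ₗ[k] (X →₀ k) := by
  classical
  exact Finsupp.linearCombination k (fun p => if p.2 = y then Finsupp.single p.1 1 else 0)

open Classical in
theorem comp_single {X Y : Type} (y : Y) (p : X × Y) :
    comp k y (Finsupp.single p 1) = if p.2 = y then Finsupp.single p.1 1 else 0 := by
  simp [comp]

theorem comp_dG {Y : Type} (y : Y) (c : List G × Y →₀ k) :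
    comp k y (dG k G Y c) = del k (comp k y c) := by
  classical
  have key : ∀ (z : Y) (b : List G →₀ k), comp k y (tn k b (Finsupp.single z 1))
      = if z = y then b else 0 := by
    intro z b
    by_cases h : z = y
    · have : (comp k y ∘ₗ (tn k).flip (Finsupp.single z 1) : (List G →₀ k) →ₗ[k] _)
        = LinearMap.id := by
        apply lin_ext; intro x
        simp [tn_single_single, comp_single, h]
      simpa [h] using LinearMap.congr_fun this b
    · have : (comp k y ∘ₗ (tn k).flip (Finsupp.single z 1) : (List G →₀ k) →ₗ[k] _)
        = 0 := by
        apply lin_ext; intro x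
        simp [tn_single_single, comp_single, h]
      simpa [h] using LinearMap.congr_fun this b
  have : comp k y ∘ₗ dG k G Y = del k ∘ₗ comp k y := by
    apply lin_ext
    rintro ⟨x, z⟩
    rw [LinearMap.comp_apply, LinearMap.comp_apply, ← tn_single_single, liftL_tn, key, key]
    split_ifs <;> simp
  exact LinearMap.congr_fun this c

/-- a chain is the sum of its components -/
theorem sum_comp {X Y : Type} (c : X × Y →₀ k) [DecidableEq Y] (S : Finset Y)
    (hS : ∀ p ∈ c.support, p.2 ∈ S) :
    c = ∑ y ∈ S, tn k (comp k y c) (Finsupp.single y 1) := by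
  have hc : c ∈ sp k {p : X × Y | p.2 ∈ S} := by
    rw [Finsupp.mem_supported]; intro p hp; exact hS p hp
  have : (LinearMap.id - ∑ y ∈ S, (tn k).flip (Finsupp.single y 1) ∘ₗ comp k y :
      (X × Y →₀ k) →ₗ[k] (X × Y →₀ k)) c
      ∈ (⊥ : Submodule k (X × Y →₀ k)) := by
    refine sp_map _ (fun p hp => ?_) hc
    simp only [LinearMap.sub_apply, LinearMap.id_apply, LinearMap.sum_apply,
      LinearMap.comp_apply, comp_single, LinearMap.flip_apply, Submodule.mem_bot]
    rw [Finset.sum_eq_single p.2]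
    · simp [tn_single_single]
    · intro b _ hb; rw [if_neg (Ne.symm hb)]; simp
    · intro h; exact absurd hp h
  simp only [LinearMap.sub_apply, LinearMap.id_apply, LinearMap.sum_apply,
      LinearMap.comp_apply, LinearMap.flip_apply, Submodule.mem_bot, sub_eq_zero] at this
  exact this

theorem comp_sp {X Y : Type} {S : Set X} {S' : Set Y} (y : Y) {c : X × Y →₀ k}
    (hc : c ∈ sp k (S ×ˢ S')) : comp k y c ∈ sp k S := by
  classical
  refine sp_map _ (fun p hp => ?_) hc
  rw [comp_single]
  split_ifs
  · exact single_mem_sp hp.1 1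
  · exact Submodule.zero_mem _

theorem comp_eq_zero {X Y : Type} {S : Set X} {S' : Set Y} (y : Y) (hy : y ∉ S')
    {c : X × Y →₀ k} (hc : c ∈ sp k (S ×ˢ S')) : comp k y c = 0 := by
  classical
  have : comp k y c ∈ (⊥ : Submodule k (X →₀ k)) := by
    refine sp_map _ (fun p hp => ?_) hc
    rw [comp_single, if_neg]
    · exact Submodule.zero_mem _
    · rintro rfl; exact hy hp.2
  simpa using this

/-- orbit reps -/
theorem orbit_reps (H : Subgroup G) (Y : Type) [MulAction G Y] :
    ∃ (rp : Y → Y) (γ : Y → G), (∀ y, γ y ∈ H) ∧ (∀ y, γ y • rp y = y) ∧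
      ∀ h ∈ H, ∀ y, rp (h • y) = rp y := by
  classical
  let q : Y → Quotient (MulAction.orbitRel H Y) := fun y => Quotient.mk'' y
  have h1 : ∀ y, ∃ g : H, g • (q y).out = y := by
    intro y
    have : (MulAction.orbitRel H Y) (q y).out y := Quotient.mk_out (s := MulAction.orbitRel H Y) y
    have h2 := (MulAction.orbitRel H Y).symm this
    have h4 := MulAction.orbitRel_apply.1 h2
    exact h4
  choose g hg using h1
  refine ⟨fun y => (q y).out, fun y => (g y : G), fun y => (g y).2, fun y => hg y, ?_⟩
  intro h hh y
  have : q (h • y) = q y := by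
    refine Quotient.sound' ?_
    show (MulAction.orbitRel H Y) _ _
    rw [MulAction.orbitRel_apply]
    exact ⟨⟨h, hh⟩, rfl⟩
  simp only [this]

/-- moving each basis vector by an element of H -/
theorem move_co {H : Subgroup G} {X : Type} [MulAction G X] (f : X → X)
    (hf : ∀ x, ∃ h ∈ H, f x = h • x) (c : X →₀ k) : pf k f c - c ∈ co k H X := by
  have := sp_map (S := Set.univ) (P := co k H X) (pf k f - LinearMap.id)
    (fun x _ => by
      simp only [LinearMap.sub_apply, pf_single, LinearMap.id_apply]
      obtain ⟨h, hh, e⟩ := hf x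
      rw [e]
      exact co_basic hh x) (a := c) (by simp [sp])
  simpa using this

/-- F2: cycles in the group direction decompose along orbits -/
theorem F2 (H : Subgroup G) {Y : Type} [MulAction G Y] (T : Set Y)
    (hT : ∀ h ∈ H, ∀ y ∈ T, h • y ∈ T) (j : ℕ) (c : List G × Y →₀ k)
    (hc : c ∈ sp k ({l : List G | l.length = j + 1} ×ˢ T))
    (hd : dG k G Y c ∈ co k H (List G × Y)) :
    ∃ (S : Finset Y) (a : Y → (List G →₀ k)), (∀ y ∈ S, y ∈ T) ∧
      (∀ y, a y ∈ Cyc k (H ⊓ MulAction.stabilizer G y) j) ∧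
      c - ∑ y ∈ S, tn k (a y) (Finsupp.single y 1) ∈ co k H (List G × Y) := by
  classical
  obtain ⟨rp, γ, h1, h2, h3⟩ := orbit_reps H Y
  let E : List G × Y → List G × Y := fun p => ((γ p.2)⁻¹ • p.1, rp p.2)
  have hE : ∀ p, E p = (γ p.2)⁻¹ • p := by
    intro p
    refine Prod.ext rfl ?_
    show rp p.2 = (γ p.2)⁻¹ • p.2
    rw [eq_inv_smul_iff, h2]
  have hrT : ∀ y ∈ T, rp y ∈ T := by
    intro y hy
    have : rp y = (γ y)⁻¹ • y := by rw [eq_inv_smul_iff, h2]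
    rw [this]; exact hT _ (H.inv_mem (h1 y)) y hy
  have hEc : pf k E c ∈ sp k ({l : List G | l.length = j + 1} ×ˢ T) := by
    refine pf_sp _ ?_ hc
    rintro ⟨l, y⟩ ⟨hl, hy⟩
    exact ⟨by simpa [E] using hl, hrT y hy⟩
  have hEd : dG k G Y (pf k E c) = pf k E (dG k G Y c) := by
    have : dG k G Y ∘ₗ pf k E = pf k E ∘ₗ dG k G Y := by
      apply lin_ext
      rintro ⟨l, y⟩
      have e : ∀ b : List G →₀ k, pf k E (tn k b (Finsupp.single y 1))
          = tn k (pf k (fun l => (γ y)⁻¹ • l) b) (Finsupp.single (rp y) 1) := by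
        intro b
        rw [tn_single_right, tn_single_right, pf_pf, pf_pf]
        rfl
      rw [LinearMap.comp_apply, LinearMap.comp_apply, ← tn_single_single, e, liftL_tn, liftL_tn,
        e, pf_smul_del]
    exact LinearMap.congr_fun this c
  refine ⟨(pf k E c).support.image Prod.snd, fun y => comp k y (pf k E c), ?_, ?_, ?_⟩
  · intro y hy
    obtain ⟨p, hp, rfl⟩ := Finset.mem_image.1 hy
    exact ((Finsupp.mem_supported k _).1 hEc hp).2
  · intro y
    refine ⟨comp_sp y hEc, ?_⟩
    rw [SetLike.mem_coe, Submodule.mem_comap, ← comp_dG, hEd]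
    refine co_map (H := H) (comp k y ∘ₗ pf k E) (fun h hh p => ?_) hd
    simp only [LinearMap.comp_apply, pf_single, comp_single]
    have e1 : (E (h • p)).2 = (E p).2 := h3 h hh p.2
    rw [e1]
    by_cases hy : (E p).2 = y
    · rw [if_pos hy, if_pos hy]
      have e2 : (E (h • p)).1 = ((γ (h • p.2))⁻¹ * h * γ p.2) • (E p).1 := by
        show (γ (h • p.2))⁻¹ • (h • p.1) = ((γ (h • p.2))⁻¹ * h * γ p.2) • (γ p.2)⁻¹ • p.1
        simp [mul_smul]
      rw [e2]
      refine co_basic (Subgroup.mem_inf.2 ⟨?_, ?_⟩) _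
      · exact H.mul_mem (H.mul_mem (H.inv_mem (h1 _)) hh) (h1 _)
      · show _ • y = y
        subst hy
        show _ • rp p.2 = rp p.2
        rw [mul_smul, mul_smul, h2, inv_smul_eq_iff]
        have := h2 (h • p.2)
        rw [h3 h hh] at this
        exact this.symm
    · rw [if_neg hy, if_neg hy]; simp
  · rw [← sum_comp (pf k E c)]
    · have := move_co (k := k) (H := H) E (fun p => ⟨_, H.inv_mem (h1 p.2), hE p⟩) c
      have h := Submodule.neg_mem _ this
      simpa using h
    · intro p hp; exact Finset.mem_image_of_mem _ hp

end Bicomplex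

end UEH

namespace UEH

section Elim

variable {k : Type} [Field k] {G A : Type} [Group G] [MulAction G A]

/-- component at `x` on the left factor -/
noncomputable def compL {X Y : Type} (k : Type) [Field k] (x : X) : (X × Y →₀ k) →ₗ[k] (Y →₀ k) :=
  comp k x ∘ₗ pf k Prod.swap

open Classical in
theorem compL_single {X Y : Type} (x : X) (p : X × Y) :
    compL k x (Finsupp.single p 1) = if p.1 = x then Finsupp.single p.2 1 else 0 := by
  rw [compL, LinearMap.comp_apply, pf_single, comp_single]; rfl

open Classical in
theorem compL_tn {X Y : Type} (x w : X) (z : Y →₀ k) :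
    compL k x (tn k (Finsupp.single w 1) z) = if w = x then z else 0 := by
  by_cases h : w = x
  · have : (compL k x ∘ₗ (tn k) (Finsupp.single w 1) : (Y →₀ k) →ₗ[k] _)
      = LinearMap.id := by
      apply lin_ext; intro x
      simp [tn_single_single, compL_single, h]
    simpa [h] using LinearMap.congr_fun this z
  · have : (compL k x ∘ₗ (tn k) (Finsupp.single w 1) : (Y →₀ k) →ₗ[k] _)
      = 0 := by
      apply lin_ext; intro x
      simp [tn_single_single, compL_single, h]
    simpa [h] using LinearMap.congr_fun this z

theorem compL_dX {X : Type} (x : X) (c : X × List A →₀ k) :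
    compL k x (dX k X A c) = del k (compL k x c) := by
  classical
  have : compL k x ∘ₗ dX k X A = del k ∘ₗ compL k x := by
    apply lin_ext
    rintro ⟨w, z⟩
    rw [LinearMap.comp_apply, LinearMap.comp_apply, ← tn_single_single, liftR_tn, compL_tn,
      compL_tn]
    split_ifs <;> simp
  exact LinearMap.congr_fun this c

theorem sum_compL {X Y : Type} (c : X × Y →₀ k) [DecidableEq X] (S : Finset X)
    (hS : ∀ p ∈ c.support, p.1 ∈ S) :
    c = ∑ x ∈ S, tn k (Finsupp.single x 1) (compL k x c) := by
  have hc : c ∈ sp k {p : X × Y | p.1 ∈ S} := by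
    rw [Finsupp.mem_supported]; intro p hp; exact hS p hp
  have : (LinearMap.id - ∑ x ∈ S, (tn k) (Finsupp.single x 1) ∘ₗ compL k x :
      (X × Y →₀ k) →ₗ[k] (X × Y →₀ k)) c
      ∈ (⊥ : Submodule k (X × Y →₀ k)) := by
    refine sp_map _ (fun p hp => ?_) hc
    simp only [LinearMap.sub_apply, LinearMap.id_apply, LinearMap.sum_apply,
      LinearMap.comp_apply, compL_single, Submodule.mem_bot]
    rw [Finset.sum_eq_single p.1]
    · simp [tn_single_single]
    · intro b _ hb; rw [if_neg (Ne.symm hb)]; simp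
    · intro h; exact absurd hp h
  simp only [LinearMap.sub_apply, LinearMap.id_apply, LinearMap.sum_apply,
      LinearMap.comp_apply, Submodule.mem_bot, sub_eq_zero] at this
  exact this

theorem compL_sp {X Y : Type} {S : Set X} {S' : Set Y} (x : X) {c : X × Y →₀ k}
    (hc : c ∈ sp k (S ×ˢ S')) : compL k x c ∈ sp k S' := by
  classical
  refine sp_map _ (fun p hp => ?_) hc
  rw [compL_single]
  split_ifs
  · exact single_mem_sp hp.2 1
  · exact Submodule.zero_mem _

/-- lists of a given length in a set -/
def OkL (Ok : Set (List A)) (p : ℕ) : Set (List A) := {t | t ∈ Ok ∧ t.length = p}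

abbrev Ln (G : Type) (n : ℕ) : Set (List G) := {l : List G | l.length = n}

theorem Xexact (H : Subgroup G) (T T' : Set (List A))
    (hT : ∀ h ∈ H, ∀ t ∈ T, h • t ∈ T)
    (hex : ∀ z ∈ sp k T, del k z = 0 → ∃ y ∈ sp k T', del k y = z)
    (j : ℕ) (c : List G × List A →₀ k) (hc : c ∈ sp k (Ln G (j + 1) ×ˢ T))
    (hd : dX k (List G) A c ∈ co k H (List G × List A)) :
    ∃ y ∈ sp k (Ln G (j + 1) ×ˢ T'), c - dX k (List G) A y ∈ co k H (List G × List A) := by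
  classical
  obtain ⟨rp, γ, h1, h2, h3⟩ := orbit_reps H G
  have hγ : ∀ h ∈ H, ∀ x, γ (h * x) = h * γ x := by
    intro h hh x
    have e1 : γ (h * x) * rp x = h * x := by
      have := h2 (h * x); rw [← smul_eq_mul h x, h3 h hh] at this; exact this
    have e2 : h * γ x * rp x = h * x := by
      have := h2 x; rw [smul_eq_mul] at this; rw [mul_assoc, this]
    exact mul_right_cancel (e1.trans e2.symm)
  let eB : List G × List A → (List G × List A →₀ k) := fun p =>
    match p.1 with
    | [] => 0
    | x :: _ => Finsupp.single ((γ x)⁻¹ • p) 1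
  let e : (List G × List A →₀ k) →ₗ[k] (List G × List A →₀ k) := Finsupp.linearCombination k eB
  have he : ∀ p, e (Finsupp.single p 1) = eB p := by intro p; simp [e]
  have he0 : ∀ z, e (tn k (Finsupp.single [] 1) z) = 0 := by
    intro z
    have : e ∘ₗ tn k (Finsupp.single [] 1) = 0 := by
      apply lin_ext; intro t
      rw [LinearMap.comp_apply, tn_single_single, he]; rfl
    exact LinearMap.congr_fun this z
  have he1 : ∀ x l z, e (tn k (Finsupp.single (x :: l) 1) z)
      = pf k ((γ x)⁻¹ • ·) (tn k (Finsupp.single (x :: l) 1) z) := by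
    intro x l z
    have : e ∘ₗ tn k (Finsupp.single (x :: l) 1)
        = pf k ((γ x)⁻¹ • ·) ∘ₗ tn k (Finsupp.single (x :: l) 1) := by
      apply lin_ext; intro t
      rw [LinearMap.comp_apply, LinearMap.comp_apply, tn_single_single, he, pf_single]
    exact LinearMap.congr_fun this z
  have hcomm : ∀ c, e (dX k (List G) A c) = dX k (List G) A (e c) := by
    intro c
    have : e ∘ₗ dX k (List G) A = dX k (List G) A ∘ₗ e := by
      apply lin_ext
      rintro ⟨l, t⟩
      rw [← tn_single_single, LinearMap.comp_apply, LinearMap.comp_apply, liftR_tn]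
      cases l with
      | nil => rw [he0, he0, map_zero]
      | cons x l => rw [he1, he1, dX_smul, liftR_tn]
    exact LinearMap.congr_fun this c
  have hkill : ∀ c ∈ co k H (List G × List A), e c = 0 := by
    intro c hc
    have : e c ∈ (⊥ : Submodule k (List G × List A →₀ k)) := by
      refine co_map (H := H) e ?_ hc
      rintro h hh ⟨l, t⟩
      rw [Submodule.mem_bot, he, he]
      cases l with
      | nil => exact sub_self _
      | cons x l =>
        show Finsupp.single ((γ (h * x))⁻¹ • (h • (x :: l, t))) 1
          - Finsupp.single ((γ x)⁻¹ • (x :: l, t)) 1 = 0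
        rw [hγ h hh, smul_smul, mul_inv_rev, inv_mul_cancel_right, sub_self]
    simpa using this
  have hec : e c ∈ sp k (Ln G (j + 1) ×ˢ T) := by
    refine sp_map e ?_ hc
    rintro ⟨l, t⟩ ⟨hl, ht⟩
    rw [he]
    cases l with
    | nil => exact Submodule.zero_mem _
    | cons x l =>
      refine single_mem_sp (Set.mk_mem_prod (a := (γ x)⁻¹ • (x :: l)) (b := (γ x)⁻¹ • t) ?_ ?_) 1
      · have : (x :: l).length = j + 1 := hl
        show ((γ x)⁻¹ • (x :: l)).length = j + 1
        rw [smul_list_length, this]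
      · exact hT _ (H.inv_mem (h1 x)) t ht
  have hmv : e c - c ∈ co k H (List G × List A) := by
    refine sp_map (e - LinearMap.id) ?_ hc
    rintro ⟨l, t⟩ ⟨hl, ht⟩
    rw [LinearMap.sub_apply, he]
    cases l with
    | nil => exact absurd hl (by simp)
    | cons x l => exact co_basic (H.inv_mem (h1 x)) _
  have hz : dX k (List G) A (e c) = 0 := by rw [← hcomm, hkill _ hd]
  have hfill : ∀ l, ∃ y ∈ sp k T', del k y = compL k l (e c) := by
    intro l
    refine hex _ (compL_sp l hec) ?_
    rw [← compL_dX, hz, map_zero]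
  choose f hf1 hf2 using hfill
  let S := (e c).support.image Prod.fst
  refine ⟨∑ l ∈ S, tn k (Finsupp.single l 1) (f l), ?_, ?_⟩
  · refine Submodule.sum_mem _ (fun l hl => tn_sp (single_mem_sp ?_ 1) (hf1 l))
    obtain ⟨p, hp, rfl⟩ := Finset.mem_image.1 hl
    exact ((Finsupp.mem_supported k _).1 hec hp).1
  · have : dX k (List G) A (∑ l ∈ S, tn k (Finsupp.single l 1) (f l)) = e c := by
      rw [map_sum]
      simp only [liftR_tn, hf2]
      exact (sum_compL (e c) S (fun p hp => Finset.mem_image_of_mem _ hp)).symm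
    rw [this]
    have h := Submodule.neg_mem _ hmv
    simpa using h

theorem sum_choose {ι N M : Type} [AddCommGroup N] [Module k N] [AddCommGroup M] [Module k M]
    (S : Finset ι) (v : ι → N) (R : Submodule k (N × M))
    (h : ∀ i ∈ S, ∃ x, (v i, x) ∈ R) : ∃ x, (∑ i ∈ S, v i, x) ∈ R := by
  classical
  induction S using Finset.induction_on with
  | empty => exact ⟨0, R.zero_mem⟩
  | insert i S hi ih =>
    obtain ⟨x, hx⟩ := ih (fun i hi => h i (Finset.mem_insert_of_mem hi))
    obtain ⟨y, hy⟩ := h i (Finset.mem_insert_self _ _)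
    refine ⟨y + x, ?_⟩
    rw [Finset.sum_insert hi]
    exact Submodule.add_mem _ hy hx

theorem Elim (H : Subgroup G) (Ok : Set (List A))
    (hsub : ∀ t ∈ Ok, ∀ s, s.Sublist t → s ∈ Ok)
    (hst : ∀ h ∈ H, ∀ t ∈ Ok, h • t ∈ Ok) (hnil : [] ∈ Ok) (d : ℕ)
    (hex : ∀ p ≤ d, ∀ z ∈ sp k (OkL Ok p), del k z = 0 → ∃ y ∈ sp k (OkL Ok (p + 1)),
      del k y = z)
    (hrow0 : ∀ z ∈ sp k (OkL Ok (d + 1)), del k z ∈ co k H (List A) →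
      ∃ y ∈ sp k (OkL Ok (d + 2)), z - del k y ∈ co k H (List A))
    (hZ : ∀ p j, 1 ≤ p → p + j = d → ∀ t ∈ OkL Ok (p + 1),
      ∀ a ∈ Cyc k (H ⊓ MulAction.stabilizer G t) j,
      ∃ x ∈ sp k (Ln G (j + 2) ×ˢ OkL Ok p), dX k (List G) A x ∈ co k H (List G × List A) ∧
        dG k G (List A) x - dX k (List G) A (tn k a (Finsupp.single t 1))
          ∈ co k H (List G × List A))
    (a : List G →₀ k) (ha : a ∈ Cyc k H d) :
    ∃ (S : Finset (List A)) (b : List A → (List G →₀ k)), (∀ t ∈ S, t ∈ OkL Ok 1) ∧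
      (∀ t, b t ∈ Cyc k (H ⊓ MulAction.stabilizer G t) d) ∧
      a - ∑ t ∈ S, b t ∈ co k H (List G) := by
  classical
  have hstL : ∀ p, ∀ h ∈ H, ∀ t ∈ OkL Ok p, h • t ∈ OkL Ok p := by
    rintro p h hh t ⟨h1, h2⟩
    exact ⟨hst h hh t h1, by simpa using h2⟩
  have hdG : ∀ (j : ℕ) (T : Set (List A)) c, c ∈ sp k (Ln G (j + 1) ×ˢ T) →
      dG k G (List A) c ∈ sp k (Ln G j ×ˢ T) := by
    intro j T c hc
    refine sp_map _ ?_ hc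
    rintro ⟨l, t⟩ ⟨hl, ht⟩
    rw [← tn_single_single, liftL_tn]
    exact tn_sp (del_ln (single_mem_sp hl 1)) (single_mem_sp ht 1)
  have hR : ∀ j p, p + j = d → ∀ c ∈ sp k (Ln G (j + 1) ×ˢ OkL Ok (p + 1)),
      dX k (List G) A (dG k G (List A) c) ∈ co k H (List G × List A) →
      ∃ c' ∈ sp k (Ln G (j + 1) ×ˢ OkL Ok (p + 1)),
        dG k G (List A) c' ∈ co k H (List G × List A) ∧
        dX k (List G) A c' - dX k (List G) A c ∈ co k H (List G × List A) := by
    intro j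
    induction j with
    | zero =>
      intro p hp c hc hd
      have hpd : p = d := by omega
      subst hpd
      have hz : dG k G (List A) c = tn k (Finsupp.single [] 1) (pf k Prod.snd c) := by
        rw [← sub_eq_zero]
        have : (dG k G (List A) - tn k (Finsupp.single [] 1) ∘ₗ pf k Prod.snd :
          (List G × List A →₀ k) →ₗ[k] _) c ∈ (⊥ : Submodule k (List G × List A →₀ k)) := by
          refine sp_map _ ?_ hc
          rintro ⟨l, t⟩ ⟨hl, ht⟩
          obtain ⟨x, rfl⟩ := List.length_eq_one_iff.1 (show l.length = 1 from hl)
          rw [LinearMap.sub_apply, LinearMap.comp_apply, pf_single, ← tn_single_single, liftL_tn,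
            del_cons', del_nil]
          simp
        simpa using this
      have hzs : pf k Prod.snd c ∈ sp k (OkL Ok (p + 1)) :=
        pf_sp _ (fun x hx => hx.2) hc
      obtain ⟨y, hy1, hy2⟩ := hrow0 (pf k Prod.snd c) hzs (by
        rw [hz, liftR_tn] at hd
        have := pf_co (H := H) (H' := H) (Prod.snd : List G × List A → List A)
          (fun h hh x => ⟨h, hh, rfl⟩) hd
        rw [tn_single, pf_pf] at this
        have e : (Prod.snd ∘ fun y => (([] : List G), y)) = (id : List A → List A) := rfl
        rw [e] at this
        simpa using this)
      refine ⟨c - dX k (List G) A (tn k (Finsupp.single [1] 1) y), ?_, ?_, ?_⟩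
      · refine Submodule.sub_mem _ hc ?_
        rw [liftR_tn]
        refine tn_sp (single_mem_sp (show [1] ∈ Ln G 1 from rfl) 1) (del_sp ?_ hy1)
        rintro l ⟨h1, h2⟩ t ht1 ht2
        exact ⟨hsub l h1 t ht1, by omega⟩
      · rw [map_sub, hz, liftR_tn, liftL_tn, del_cons', del_nil, map_zero, sub_zero, ← map_sub,
          tn_single]
        exact pf_co (H := H) (H' := H) _ (fun h hh x => ⟨h, hh, rfl⟩) hy2
      · rw [map_sub, dX_dX]; simp
    | succ j ih =>
      intro p hp c hc hd
      obtain ⟨c1, hc1, e1⟩ := Xexact H (OkL Ok (p + 1)) (OkL Ok (p + 2)) (hstL _)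
        (hex (p + 1) (by omega)) j (dG k G (List A) c) (hdG _ _ _ hc) hd
      have e2 : dX k (List G) A (dG k G (List A) c1) ∈ co k H (List G × List A) := by
        rw [← dG_dX]
        have := dG_co (H := H) e1
        rw [map_sub, dG_dG] at this
        simpa using this
      obtain ⟨c2, hc2, f1, f2⟩ := ih (p + 1) (by omega) c1 hc1 e2
      obtain ⟨S, b, g1, g2, g3⟩ := F2 H (OkL Ok (p + 2)) (hstL _) j c2 hc2 f1
      let R : Submodule k ((List G × List A →₀ k) × (List G × List A →₀ k)) :=
        ((co k H (List G × List A)).comap (dG k G (List A) ∘ₗ LinearMap.snd k _ _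
          - dX k (List G) A ∘ₗ LinearMap.fst k _ _)) ⊓
        ((co k H (List G × List A)).comap (dX k (List G) A ∘ₗ LinearMap.snd k _ _)) ⊓
        ((sp k (Ln G (j + 2) ×ˢ OkL Ok (p + 1))).comap (LinearMap.snd k _ _))
      obtain ⟨x, ⟨hx1, hx2⟩, hx3⟩ := sum_choose S
          (fun t => tn k (b t) (Finsupp.single t 1)) R (by
        intro t ht
        obtain ⟨x, a1, a2, a3⟩ := hZ (p + 1) j (by omega) (by omega) t (g1 t ht) (b t) (g2 t)
        exact ⟨x, ⟨a3, a2⟩, a1⟩)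
      replace hx1 : dG k G (List A) x - dX k (List G) A
        (∑ t ∈ S, tn k (b t) (Finsupp.single t 1)) ∈ co k H (List G × List A) := hx1
      replace hx2 : dX k (List G) A x ∈ co k H (List G × List A) := hx2
      replace hx3 : x ∈ sp k (Ln G (j + 2) ×ˢ OkL Ok (p + 1)) := hx3
      refine ⟨c - x, Submodule.sub_mem _ hc hx3, ?_, ?_⟩
      · rw [map_sub]
        have g3' := dX_co g3
        rw [map_sub] at g3'
        have := Submodule.add_mem _ (Submodule.sub_mem _ (Submodule.sub_mem _ e1 f2) hx1) g3'
        convert this using 1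
        abel
      · rw [map_sub, sub_sub_cancel_left]; exact Submodule.neg_mem _ hx2
  obtain ⟨c0, hc0, e0⟩ := Xexact H (OkL Ok 0) (OkL Ok 1) (hstL _) (hex 0 (by omega)) d
    (tn k a (Finsupp.single [] 1))
    (tn_sp ha.1 (single_mem_sp (show ([] : List A) ∈ OkL Ok 0 from ⟨hnil, rfl⟩) 1))
    (by rw [liftR_tn, del_nil]; simp)
  obtain ⟨c1, hc1, f1, f2⟩ := hR d 0 (by omega) c0 hc0 (by
    rw [← dG_dX]
    have := dG_co e0
    rw [map_sub, liftL_tn, tn_single_right] at this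
    have h2 := pf_co (H := H) (H' := H) (fun l : List G => (l, ([] : List A)))
      (fun h hh x => ⟨h, hh, rfl⟩) ha.2
    have := Submodule.sub_mem _ h2 this
    simpa using this)
  obtain ⟨S, b, g1, g2, g3⟩ := F2 H (OkL Ok 1) (hstL _) d c1 hc1 f1
  refine ⟨S, b, g1, g2, ?_⟩
  have h := Submodule.add_mem _ (Submodule.sub_mem _ e0 f2) (dX_co g3)
  rw [map_sub, map_sum] at h
  have e : ∀ t ∈ S, dX k (List G) A (tn k (b t) (Finsupp.single t 1))
      = tn k (b t) (Finsupp.single [] 1) := by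
    intro t ht
    obtain ⟨x, rfl⟩ := List.length_eq_one_iff.1 (g1 t ht).2
    rw [liftR_tn, del_cons', del_nil]; simp
  rw [Finset.sum_congr rfl e] at h
  have h2 : tn k (a - ∑ t ∈ S, b t) (Finsupp.single [] 1) ∈ co k H (List G × List A) := by
    convert h using 1
    rw [map_sub, map_sum, LinearMap.sub_apply, LinearMap.sum_apply]
    abel
  have h3 := pf_co (H := H) (H' := H) (Prod.fst : List G × List A → List G)
          (fun h hh x => ⟨h, hh, rfl⟩) h2
  rw [tn_single_right, pf_pf] at h3
  have e4 : (Prod.fst ∘ fun y => (y, ([] : List A))) = (id : List G → List G) := rfl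
  rw [e4] at h3
  simpa using h3

/-- if `a` bounds in the stabilizer then `hZ` holds for it -/
theorem Zof_Bd (H : Subgroup G) (Ok : Set (List A))
    (hsub : ∀ t ∈ Ok, ∀ s, s.Sublist t → s ∈ Ok) (p j : ℕ) (t : List A)
    (ht : t ∈ OkL Ok (p + 1)) (a : List G →₀ k)
    (ha : a ∈ Bd k (H ⊓ MulAction.stabilizer G t) j) :
      ∃ x ∈ sp k (Ln G (j + 2) ×ˢ OkL Ok p), dX k (List G) A x ∈ co k H (List G × List A) ∧
        dG k G (List A) x - dX k (List G) A (tn k a (Finsupp.single t 1))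
          ∈ co k H (List G × List A) := by
  obtain ⟨i, hi, y, ⟨e, he, rfl⟩, rfl⟩ := Submodule.mem_sup.1 ha
  refine ⟨dX k (List G) A (tn k e (Finsupp.single t 1)), ?_, ?_, ?_⟩
  · rw [liftR_tn]
    refine tn_sp he (del_sp (S := {t}) ?_ (single_mem_sp (Set.mem_singleton t) 1))
    rintro l rfl s hs1 hs2
    exact ⟨hsub l ht.1 s hs1, by have := ht.2; omega⟩
  · rw [dX_dX]; exact Submodule.zero_mem _
  · rw [dG_dX, ← map_sub, liftL_tn]
    refine dX_co ?_
    have e5 : tn k (del k e) (Finsupp.single t 1) - tn k (i + del k e) (Finsupp.single t 1)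
        = - tn k i (Finsupp.single t 1) := by
      rw [map_add, LinearMap.add_apply]; abel
    rw [e5, tn_single_right]
    refine Submodule.neg_mem _ ?_
    refine pf_co (H := H ⊓ MulAction.stabilizer G t) (H' := H) _ (fun h hh x => ?_) hi
    refine ⟨h, hh.1, Prod.ext rfl ?_⟩
    exact (MulAction.mem_stabilizer_iff.1 hh.2).symm

/-- degree zero -/
theorem Vanish_zero (H : Subgroup G) : Vanish k H 0 := by
  intro a ha
  have h0 : del k a = 0 := by
    have e1 : del k a ∈ ln k G 0 := del_ln ha.1
    have e2 := ha.2
    have : (Finsupp.linearCombination k (fun l : List G => if l = [] then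
        (Finsupp.single [] 1 : List G →₀ k) else 0)) (del k a) = del k a := by
      rw [← sub_eq_zero]
      have : (Finsupp.linearCombination k (fun l : List G => if l = [] then
        (Finsupp.single [] 1 : List G →₀ k) else 0) - LinearMap.id :
        (List G →₀ k) →ₗ[k] (List G →₀ k)) (del k a)
        ∈ (⊥ : Submodule k (List G →₀ k)) := by
        refine sp_map _ ?_ e1
        intro l hl
        have : l = [] := List.length_eq_zero_iff.1 hl
        subst this
        simp
      simpa using this
    rw [← this]
    have : (Finsupp.linearCombination k (fun l : List G => if l = [] then
        (Finsupp.single [] 1 : List G →₀ k) else 0)) (del k a)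
        ∈ (⊥ : Submodule k (List G →₀ k)) := by
      refine co_map (H := H) _ ?_ e2
      intro h hh l
      cases l <;> simp
    simpa using this
  refine Submodule.mem_sup_right ⟨pf k (List.cons 1) a, pf_sp _ ?_ ha.1, ?_⟩
  · intro l hl
    show (1 :: l).length = _
    rw [List.length_cons]; have : l.length = 0 + 1 := hl; omega
  · rw [del_cons, h0, map_zero, sub_zero]

end Elim

end UEH

namespace UEH

section Transfer

variable {k : Type} [Field k] {G : Type} [Group G]

theorem Onto_of_index [Finite G] (S H : Subgroup G) (hle : S ≤ H)
    (hidx : ((S.relIndex H : ℕ) : k) ≠ 0) (j : ℕ) : Onto k S H j := by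
  classical
  intro a ha
  let Q := ↥H ⧸ S.subgroupOf H
  haveI : Fintype Q := Fintype.ofFinite _
  have hcard : (Fintype.card Q : k) ≠ 0 := by
    have : Fintype.card Q = S.relIndex H := by
      rw [Subgroup.relIndex, Subgroup.index, Nat.card_eq_fintype_card]
    rw [this]; exact hidx
  let y : Q → G := fun q => ((q.out : H) : G)⁻¹
  have hyH : ∀ q, y q ∈ H := fun q => H.inv_mem (q.out).2
  let T : (List G →₀ k) →ₗ[k] (List G →₀ k) := ∑ q : Q, pf k (y q • ·)
  have hT : ∀ x, T x = ∑ q : Q, pf k (y q • ·) x := by intro x; simp [T]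
  have hTco : ∀ c ∈ co k H (List G), T c ∈ co k S (List G) := by
    intro c hc
    refine co_map (H := H) T ?_ hc
    intro h hh l
    rw [hT, hT]
    simp only [pf_single]
    rw [← Equiv.sum_comp (MulAction.toPerm (⟨h, hh⟩⁻¹ : H) : Equiv.Perm Q)
      (fun q => Finsupp.single (y q • l) (1 : k)), ← Finset.sum_sub_distrib]
    refine Submodule.sum_mem _ (fun q _ => ?_)
    show Finsupp.single (y q • h • l) 1 - Finsupp.single (y ((⟨h, hh⟩⁻¹ : H) • q) • l) (1 : k) ∈ _
    have e : y q * h * (y ((⟨h, hh⟩⁻¹ : H) • q))⁻¹ ∈ S := by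
      have h1 : (((⟨h, hh⟩⁻¹ : H) • q).out : Q) = (((⟨h, hh⟩⁻¹ : H) * q.out : H) : Q) := by
        rw [QuotientGroup.out_eq']
        conv_lhs => rw [← QuotientGroup.out_eq' q]
        rfl
      have h2 := QuotientGroup.eq.1 h1.symm
      rw [Subgroup.mem_subgroupOf] at h2
      convert h2 using 1
      simp [y]
    have e2 : y q • h • l = (y q * h * (y ((⟨h, hh⟩⁻¹ : H) • q))⁻¹) •
        (y ((⟨h, hh⟩⁻¹ : H) • q) • l) := by
      rw [smul_smul, smul_smul]; simp
    rw [e2]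
    exact co_basic e _
  refine ⟨(Fintype.card Q : k)⁻¹ • T a, ⟨?_, ?_⟩, ?_⟩
  · refine Submodule.smul_mem _ _ ?_
    rw [hT]
    exact Submodule.sum_mem _ (fun q _ => pf_smul_ln _ ha.1)
  · rw [SetLike.mem_coe, Submodule.mem_comap, map_smul]
    refine Submodule.smul_mem _ _ ?_
    have : del k (T a) = T (del k a) := by
      rw [hT, hT, map_sum]
      exact Finset.sum_congr rfl (fun q _ => pf_smul_del _ _)
    rw [this]
    exact hTco _ ha.2
  · refine Submodule.mem_sup_left ?_
    have : a - (Fintype.card Q : k)⁻¹ • T a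
        = -((Fintype.card Q : k)⁻¹ • ∑ q : Q, (pf k (y q • ·) a - a)) := by
      rw [Finset.sum_sub_distrib, ← hT, smul_sub, Finset.sum_const, Finset.card_univ,
        ← Nat.cast_smul_eq_nsmul k, smul_smul, inv_mul_cancel₀ hcard, one_smul]
      abel
    rw [this]
    refine Submodule.neg_mem _ (Submodule.smul_mem _ _ (Submodule.sum_mem _ (fun q _ => ?_)))
    exact pf_smul_sub (hyH q) a

/-- first homology vanishes for groups generated by elements of order invertible in `k` -/
theorem Vanish_one (H : Subgroup G) (S : Set G) (hS : H = Subgroup.closure S)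
    (hord : ∀ s ∈ S, ∃ m : ℕ, s ^ m = 1 ∧ (m : k) ≠ 0) : Vanish k H 1 := by
  classical
  have hgen : S ⊆ H := by rw [hS]; exact Subgroup.subset_closure
  obtain ⟨rp, γ, h1, h2, h3⟩ := orbit_reps H G
  let φ : G → G → (List G →₀ k) ⧸ Bd k H 1 := fun x y =>
    (Bd k H 1).mkQ (Finsupp.single [x, y] 1)
  have hadd : ∀ x y z, φ x z = φ x y + φ y z := by
    intro x y z
    have : del k (Finsupp.single [x, y, z] (1 : k)) ∈ Bd k H 1 :=
      Submodule.mem_sup_right ⟨_, single_mem_sp (show [x, y, z] ∈ Ln G 3 from rfl) 1, rfl⟩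
    rw [← Submodule.Quotient.mk_eq_zero, ← Submodule.mkQ_apply] at this
    simp only [del_cons', del_nil, map_sub, pf_single, map_zero, sub_zero] at this
    have e : φ y z - (φ x z - φ x y) = 0 := this
    rw [sub_eq_zero] at e
    rw [e]; abel
  have hinv : ∀ h ∈ H, ∀ x y, φ (h * x) (h * y) = φ x y := by
    intro h hh x y
    rw [← sub_eq_zero]
    show (Bd k H 1).mkQ _ - (Bd k H 1).mkQ _ = 0
    rw [← map_sub, Submodule.mkQ_apply, Submodule.Quotient.mk_eq_zero]
    exact Submodule.mem_sup_left (co_basic hh [x, y])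
  have hself : ∀ x, φ x x = 0 := by
    intro x
    have := hadd x x x
    simpa using this
  have hmul : ∀ g ∈ H, ∀ h, φ 1 (g * h) = φ 1 g + φ 1 h := by
    intro g hg h
    rw [hadd 1 g (g * h)]
    have := hinv g hg 1 h
    rw [mul_one] at this
    rw [this]
  have hzero : ∀ g ∈ H, φ 1 g = 0 := by
    intro g hg
    have hg' := hg
    rw [hS] at hg'
    induction hg' using Subgroup.closure_induction with
    | mem s hs =>
      obtain ⟨m, hm, hmk⟩ := hord s hs
      have : ∀ i : ℕ, φ 1 (s ^ i) = (i : k) • φ 1 s := by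
        intro i
        induction i with
        | zero => simp [hself]
        | succ i ih =>
          rw [pow_succ, hmul _ (H.pow_mem (hgen hs) i), ih]
          push_cast
          rw [add_smul, one_smul]
      have e := this m
      rw [hm, hself] at e
      exact (smul_eq_zero.1 e.symm).resolve_left hmk
    | one => exact hself 1
    | mul x y hx hy ihx ihy =>
      rw [← hS] at hx hy
      rw [hmul x hx, ihx hx, ihy hy, add_zero]
    | inv x hx ih =>
      rw [← hS] at hx
      have := hmul x hx x⁻¹
      rw [mul_inv_cancel, hself, ih hx, zero_add] at this
      exact this.symm
  have horb : ∀ h ∈ H, ∀ x, φ x (h * x) = 0 := by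
    intro h hh x
    have e := hinv h hh 1 x
    rw [mul_one] at e
    rw [hadd x 1 (h * x), hadd 1 h (h * x), hzero h hh, e, zero_add, ← hadd, hself]
  have hrp : ∀ x y, φ x y = φ 1 (rp y) - φ 1 (rp x) := by
    intro x y
    have hx : φ (rp x) x = 0 := by
      have := horb _ (h1 x) (rp x); rw [← smul_eq_mul, h2] at this; exact this
    have hy : φ (rp y) y = 0 := by
      have := horb _ (h1 y) (rp y); rw [← smul_eq_mul, h2] at this; exact this
    have e1 := hadd 1 (rp y) y
    have e2 := hadd 1 (rp x) x
    have e3 := hadd 1 x y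
    rw [hy, add_zero] at e1
    rw [hx, add_zero] at e2
    rw [e1, e2] at e3
    rw [e3]; abel
  let KB : List G → (List G →₀ k) ⧸ Bd k H 1 := fun l =>
    match l with
    | [x] => φ 1 (rp x)
    | _ => 0
  let K := Finsupp.linearCombination k KB
  intro a ha
  rw [← Submodule.Quotient.mk_eq_zero, ← Submodule.mkQ_apply]
  have e1 : (Bd k H 1).mkQ a = K (del k a) := by
    rw [← sub_eq_zero]
    have : ((Bd k H 1).mkQ - K ∘ₗ del k) a ∈ (⊥ : Submodule k ((List G →₀ k) ⧸ Bd k H 1)) := by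
      refine sp_map _ ?_ ha.1
      intro l hl
      obtain ⟨x, y, rfl⟩ := List.length_eq_two.1 (show l.length = 2 from hl)
      rw [LinearMap.sub_apply, LinearMap.comp_apply]
      simp only [del_cons', del_nil, map_sub, pf_single, map_zero, sub_zero]
      have : φ x y - (φ 1 (rp y) - φ 1 (rp x)) = 0 := by rw [hrp, sub_self]
      have e7 : K (Finsupp.single [y] 1) = φ 1 (rp y) := by simp [K, KB]
      have e8 : K (Finsupp.single [x] 1) = φ 1 (rp x) := by simp [K, KB]
      rw [e7, e8]
      exact this
    simpa using this
  rw [e1]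
  have : K (del k a) ∈ (⊥ : Submodule k ((List G →₀ k) ⧸ Bd k H 1)) := by
    refine co_map (H := H) K ?_ ha.2
    intro h hh l
    have : KB (h • l) = KB l := by
      rcases l with _ | ⟨x, _ | ⟨y, l⟩⟩
      · rfl
      · show φ 1 (rp (h • x)) = φ 1 (rp x)
        rw [h3 h hh]
      · rfl
    simp [K, this]
  simpa using this

end Transfer

section Final

open GroupHomologyBar

variable {k : Type} [Field k] {G : Type} [Group G]

theorem del_ofFn {A : Type} (n : ℕ) (f : Fin (n + 1) → A) :
    del k (Finsupp.single (List.ofFn f) (1 : k)) =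
      ∑ i : Fin (n + 1), ((-1 : ℤ) ^ (i : ℕ)) •
        Finsupp.single (List.ofFn (fun j => f (i.succAbove j))) (1 : k) := by
  induction n with
  | zero => simp [List.ofFn_succ, del_cons', del_nil]
  | succ n ih =>
    rw [List.ofFn_succ, del_cons', ih, map_sum, Fin.sum_univ_succ (n := n + 1)]
    simp only [Fin.val_zero, pow_zero, one_smul, Fin.zero_succAbove, sub_eq_add_neg]
    congr 1
    rw [← Finset.sum_neg_distrib]
    refine Finset.sum_congr rfl (fun i _ => ?_)
    rw [map_zsmul, pf_single, Fin.val_succ, pow_succ]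
    rw [mul_neg_one, neg_smul]
    congr 3
    rw [List.ofFn_succ]
    congr 1
    simp only [Fin.succ_succAbove_succ]

theorem homology_subsingleton (n : ℕ) (hV : Vanish k (⊤ : Subgroup G) (n + 1)) :
    Subsingleton (Homology G k (n + 1)) := by
  classical
  let α : ∀ m, (Fin m → G) → List G := fun m g => List.ofFn (Fin.partialProd g)
  have hα : ∀ m (x : (Fin (m + 1) → G) →₀ k),
      del k (pf k (α (m + 1)) x) - pf k (α m) (d G k m x) ∈ co k (⊤ : Subgroup G) (List G) := by
    intro m x
    induction x using Finsupp.induction_linear with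
    | zero => simp
    | add x y hx hy =>
      have := Submodule.add_mem _ hx hy
      convert this using 1
      simp only [map_add]; abel
    | single g c =>
      have e1 : (Finsupp.single g c : (Fin (m + 1) → G) →₀ k) = c • Finsupp.single g 1 := by simp
      have e2 : d G k m (Finsupp.single g c) = c • d G k m (Finsupp.single g 1) := by
        rw [d_single, d_single, smul_add, Finset.smul_sum]
        congr 1
        · simp
        · refine Finset.sum_congr rfl (fun j _ => ?_)
          rw [smul_comm]; simp
      rw [e2, e1, map_smul, map_smul, map_smul, ← smul_sub]
      refine Submodule.smul_mem _ _ ?_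
      rw [pf_single, del_ofFn, d_single, Fin.sum_univ_succ, map_add, map_sum, pf_single]
      simp only [map_zsmul, pf_single]
      have e3 : ∀ i : Fin (m + 1), List.ofFn (fun j => Fin.partialProd g (i.succ.succAbove j))
          = α m (Fin.contractNth i (· * ·) g) := by
        intro i
        show _ = List.ofFn _
        rw [Fin.partialProd_contractNth]
        rfl
      simp only [e3, Fin.val_succ]
      rw [add_sub_add_right_eq_sub]
      have e4 : (List.ofFn (fun j => Fin.partialProd g ((0 : Fin (m + 2)).succAbove j)))
          = g 0 • α m (Fin.tail g) := by
        simp only [Fin.zero_succAbove, Fin.partialProd_succ', smul_list_def, α, List.map_ofFn]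
        rfl
      rw [e4]
      simpa using co_basic (k := k) (Subgroup.mem_top (g 0)) (α m (Fin.tail g))
  let β : List G → ((Fin (n + 1) → G) →₀ k) := fun l =>
    if l.length = n + 2 then
      Finsupp.single (fun i : Fin (n + 1) => (l.getD i 1)⁻¹ * l.getD (i + 1) 1) 1 else 0
  let B := Finsupp.linearCombination k β
  have hB1 : ∀ c ∈ co k (⊤ : Subgroup G) (List G), B c = 0 := by
    intro c hc
    have : B c ∈ (⊥ : Submodule k ((Fin (n + 1) → G) →₀ k)) := by
      refine co_map (H := ⊤) B ?_ hc
      intro h _ l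
      have : β (h • l) = β l := by
        simp only [β, smul_list_length]
        by_cases hl : l.length = n + 2
        · rw [if_pos hl, if_pos hl]
          congr 1
          funext i
          have h1 : (i : ℕ) < l.length := by omega
          have h2 : (i : ℕ) + 1 < l.length := by omega
          simp [smul_list_def, List.getD_eq_getElem?_getD, h1, h2, mul_assoc]
        · rw [if_neg hl, if_neg hl]
      simp [B, this]
    simpa using this
  have hB2 : ∀ x, B (pf k (α (n + 1)) x) = x := by
    intro x
    have : B ∘ₗ pf k (α (n + 1)) = LinearMap.id := by
      apply lin_ext
      intro g
      rw [LinearMap.comp_apply, pf_single]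
      simp only [B, Finsupp.linearCombination_single, one_smul, β, α, List.length_ofFn, if_true,
        LinearMap.id_apply]
      congr 1
      funext i
      have h1 : (i : ℕ) < n + 2 := by omega
      have h2 : (i : ℕ) + 1 < n + 2 := by omega
      have := Fin.partialProd_right_inv g i
      simp only [List.getD_eq_getElem?_getD, List.getElem?_ofFn, h1, h2, dif_pos, Option.getD_some]
      exact this
    exact LinearMap.congr_fun this x
  constructor
  intro x y
  suffices h : ∀ x : Homology G k (n + 1), x = 0 by rw [h x, h y]
  intro x
  obtain ⟨⟨x, hx⟩, rfl⟩ := Submodule.Quotient.mk_surjective _ x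
  rw [Submodule.Quotient.mk_eq_zero]
  show x ∈ LinearMap.range (d G k (n + 1))
  have hx' : d G k n x = 0 := hx
  have hC : pf k (α (n + 1)) x ∈ Cyc k (⊤ : Subgroup G) (n + 1) := by
    refine ⟨?_, ?_⟩
    · refine pf_sp (S := Set.univ) _ ?_ (by simp [sp])
      intro g _
      show (List.ofFn _).length = _
      simp
    · have := hα n x
      rw [hx', map_zero, sub_zero] at this
      exact this
  obtain ⟨i, hi, _, ⟨e, he, rfl⟩, hsum⟩ := Submodule.mem_sup.1 (hV hC)
  have hlift : ∀ e ∈ ln k G (n + 1 + 2), ∃ e', e - pf k (α (n + 2)) e' ∈ co k (⊤ : Subgroup G) (List G) := by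
    intro e he
    let γ : List G → (Fin (n + 2) → G) := fun l i => (l.getD i 1)⁻¹ * l.getD (i + 1) 1
    refine ⟨pf k γ e, ?_⟩
    refine sp_map (LinearMap.id - pf k (α (n + 2)) ∘ₗ pf k γ) ?_ he
    intro l hl
    simp only [LinearMap.sub_apply, LinearMap.comp_apply, LinearMap.id_apply, pf_single]
    have hl' : l.length = n + 3 := hl
    have e1 : l = (l.getD 0 1) • α (n + 2) (γ l) := by
      let f : Fin (n + 3) → G := fun i => l.getD i 1
      have hf : l = List.ofFn f := by
        apply List.ext_getElem
        · simp [hl']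
        · intro i h1 h2
          rw [List.getElem_ofFn]
          simp [f, List.getD_eq_getElem?_getD, h1]
      have := Fin.partialProd_left_inv f
      conv_lhs => rw [hf, ← this]
      rw [smul_list_def, List.map_ofFn]
      rfl
    have := co_basic (k := k) (Subgroup.mem_top (l.getD 0 1)) (α (n + 2) (γ l))
    rw [← e1] at this
    exact this
  obtain ⟨e', he'⟩ := hlift e he
  refine ⟨e', ?_⟩
  have h1 := del_co he'
  rw [map_sub] at h1
  have h2 := hα (n + 1) e'
  have h3 : pf k (α (n + 1)) x - pf k (α (n + 1)) (d G k (n + 1) e') ∈ co k (⊤ : Subgroup G) (List G) := by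
    have := Submodule.add_mem _ (Submodule.add_mem _ hi h1) h2
    convert this using 1
    rw [← hsum]; abel
  have h4 := hB1 _ h3
  rw [map_sub, hB2, hB2, sub_eq_zero] at h4
  exact h4.symm

end Final

end UEH

namespace UEH

section Herm

open Module

variable {F : Type} [Field F] {σ : F →+* F}

/-- field facts -/
structure HF (σ : F →+* F) : Prop where
  invol : ∀ x, σ (σ x) = x
  norm_surj : ∀ a, σ a = a → ∃ x, x * σ x = a
  trace_surj : ∀ a, σ a = a → ∃ x, x + σ x = a
  unit : ∃ ζ : F, ζ * σ ζ = 1 ∧ ζ ≠ 1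
  three : ∀ a b : F, ∃ c, σ c = c ∧ c ≠ a ∧ c ≠ b

variable {V : Type} [AddCommGroup V] [Module F V]

/-- Hermitian -/
structure Herm (B : V →ₛₗ[σ] V →ₗ[F] F) : Prop where
  hf : HF σ
  symm : ∀ v w, B w v = σ (B v w)

variable (B : V →ₛₗ[σ] V →ₗ[F] F)

def perp (D : Submodule F V) : Submodule F V where
  carrier := {v | ∀ d ∈ D, B d v = 0}
  add_mem' := by
    intro a b ha hb d hd
    rw [map_add, ha d hd, hb d hd, add_zero]
  zero_mem' := by intro d hd; rw [map_zero]
  smul_mem' := by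
    intro c a ha d hd
    rw [map_smul, ha d hd, smul_zero]

def rad (D : Submodule F V) : Submodule F V := D ⊓ perp B D

noncomputable def kap (D : Submodule F V) : ℕ := finrank F D + finrank F (rad B D)

variable {B}

theorem mem_perp {D : Submodule F V} {v : V} : v ∈ perp B D ↔ ∀ d ∈ D, B d v = 0 := Iff.rfl

theorem mem_rad {D : Submodule F V} {v : V} : v ∈ rad B D ↔ v ∈ D ∧ ∀ d ∈ D, B d v = 0 := Iff.rfl

theorem Herm.zero_comm (hB : Herm B) {v w : V} (h : B v w = 0) : B w v = 0 := by
  rw [hB.symm, h, map_zero]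

theorem Herm.mem_perp' (hB : Herm B) {D : Submodule F V} {v : V} :
    v ∈ perp B D ↔ ∀ d ∈ D, B v d = 0 :=
  ⟨fun h d hd => hB.zero_comm (h d hd), fun h d hd => hB.zero_comm (h d hd)⟩

theorem perp_anti {D E : Submodule F V} (h : D ≤ E) : perp B E ≤ perp B D :=
  fun v hv d hd => hv d (h hd)

theorem Herm.fix (hB : Herm B) (v : V) : σ (B v v) = B v v := (hB.symm v v).symm

theorem smulB (c : F) (v w : V) : B (c • v) w = σ c * B v w := by
  rw [LinearMap.map_smulₛₗ]; rfl

theorem addB (v v' w : V) : B (v + v') w = B v w + B v' w := by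
  rw [map_add]; rfl

theorem subB (v v' w : V) : B (v - v') w = B v w - B v' w := by
  rw [map_sub]; rfl

theorem Bsmul (c : F) (v w : V) : B v (c • w) = c * B v w := by
  rw [map_smul]; rfl

theorem mem_perp_span {v w : V} : v ∈ perp B (F ∙ w) ↔ B w v = 0 := by
  constructor
  · intro h; exact h w (Submodule.mem_span_singleton_self w)
  · intro h d hd
    obtain ⟨c, rfl⟩ := Submodule.mem_span_singleton.1 hd
    rw [smulB, h, mul_zero]

theorem perp_sup {D E : Submodule F V} : perp B (D ⊔ E) = perp B D ⊓ perp B E := by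
  apply le_antisymm
  · exact le_inf (perp_anti le_sup_left) (perp_anti le_sup_right)
  · rintro v ⟨h1, h2⟩ d hd
    obtain ⟨a, ha, b, hb, rfl⟩ := Submodule.mem_sup.1 hd
    rw [addB, h1 a ha, h2 b hb, add_zero]

/-- representability of functionals on `D` vanishing on the radical -/
theorem Herm.rep (hB : Herm B) [FiniteDimensional F V] (D : Submodule F V) (φ : V →ₗ[F] F)
    (hφ : ∀ r ∈ rad B D, φ r = 0) : ∃ p ∈ D, ∀ d ∈ D, B p d = φ d := by
  let W : Submodule F (Dual F D) :=
    { carrier := {ψ | ∃ p ∈ D, ∀ d : D, ψ d = B p d}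
      add_mem' := by
        rintro a b ⟨p, hp, h1⟩ ⟨p', hp', h2⟩
        exact ⟨p + p', D.add_mem hp hp', fun d => by rw [addB, LinearMap.add_apply, h1, h2]⟩
      zero_mem' := ⟨0, D.zero_mem, fun d => by simp⟩
      smul_mem' := by
        rintro c a ⟨p, hp, h1⟩
        exact ⟨σ c • p, D.smul_mem _ hp, fun d => by
          rw [smulB, LinearMap.smul_apply, h1, hB.hf.invol, smul_eq_mul]⟩ }
  have h1 : φ.comp D.subtype ∈ W.dualCoannihilator.dualAnnihilator := by
    rw [Submodule.mem_dualAnnihilator]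
    intro d hd
    rw [Submodule.mem_dualCoannihilator] at hd
    refine hφ d ⟨d.2, ?_⟩
    intro e he
    exact hd ((B e).comp D.subtype) ⟨e, he, fun d => rfl⟩
  rw [Subspace.dualCoannihilator_dualAnnihilator_eq] at h1
  obtain ⟨p, hp, h2⟩ := h1
  exact ⟨p, hp, fun d hd => (h2 ⟨d, hd⟩).symm⟩

def Nondeg (B : V →ₛₗ[σ] V →ₗ[F] F) : Prop := ∀ v, (∀ w, B w v = 0) → v = 0

theorem Herm.rep_top (hB : Herm B) (hn : Nondeg B) [FiniteDimensional F V] (φ : V →ₗ[F] F) :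
    ∃ p, ∀ d, B p d = φ d := by
  obtain ⟨p, _, hp⟩ := hB.rep ⊤ φ (by
    intro r hr
    have := hn r (fun w => hr.2 w trivial)
    rw [this, map_zero])
  exact ⟨p, fun d => hp d trivial⟩

theorem Herm.finrank_perp (hB : Herm B) (hn : Nondeg B) [FiniteDimensional F V]
    (D : Submodule F V) : finrank F D + finrank F (perp B D) = finrank F V := by
  let b := finBasis F D
  let L : V →ₗ[F] (Fin (finrank F D) → F) := LinearMap.pi (fun i => B (b i : V))
  have hker : LinearMap.ker L = perp B D := by
    ext v
    rw [LinearMap.mem_ker, mem_perp]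
    constructor
    · intro h d hd
      have := b.sum_repr ⟨d, hd⟩
      have h2 : d = ∑ i, b.repr ⟨d, hd⟩ i • (b i : V) := by
        have := congrArg Subtype.val this
        rw [AddSubmonoidClass.coe_finset_sum] at this
        exact this.symm
      rw [h2, map_sum, LinearMap.sum_apply]
      refine Finset.sum_eq_zero (fun i _ => ?_)
      rw [smulB]
      have := congrFun h i
      have h3 : B (b i : V) v = 0 := this
      rw [h3, mul_zero]
    · intro h
      funext i
      exact h _ (b i).2
  have hran : LinearMap.range L = ⊤ := by
    by_contra hne
    obtain ⟨f, hf0, hf⟩ := Submodule.exists_le_ker_of_lt_top _ (lt_top_iff_ne_top.2 hne)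
    have hfc : ∀ x, f x = ∑ i, x i * f (Pi.single i 1) := by
      intro x
      conv_lhs => rw [LinearMap.pi_apply_eq_sum_univ f x]
      refine Finset.sum_congr rfl (fun i _ => ?_)
      rw [smul_eq_mul]
      congr 2
      funext j
      simp [Pi.single_apply, eq_comm]
    have hz : ∑ i, σ (f (Pi.single i 1)) • (b i : V) = 0 := by
      apply hn
      intro w
      apply hB.zero_comm
      rw [map_sum, LinearMap.sum_apply]
      have : f (L w) = 0 := hf ⟨w, rfl⟩
      rw [hfc] at this
      rw [← this]
      refine Finset.sum_congr rfl (fun i _ => ?_)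
      rw [smulB, hB.hf.invol, mul_comm]; rfl
    have hz' : ∑ i, σ (f (Pi.single i 1)) • b i = 0 := by
      apply Subtype.ext
      simpa using hz
    have hli := Fintype.linearIndependent_iff.1 b.linearIndependent _ hz'
    apply hf0
    ext i
    have := congrArg σ (hli i)
    rw [hB.hf.invol, map_zero] at this
    simpa using this
  have := LinearMap.finrank_range_add_finrank_ker L
  rw [hker, hran, finrank_top, finrank_fin_fun] at this
  exact this

theorem Herm.le_perp_perp (hB : Herm B) (D : Submodule F V) : D ≤ perp B (perp B D) :=
  fun v hv d hd => hB.zero_comm (hd v hv)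

theorem Herm.perp_perp (hB : Herm B) (hn : Nondeg B) [FiniteDimensional F V]
    (D : Submodule F V) : perp B (perp B D) = D := by
  symm
  apply Submodule.eq_of_le_of_finrank_eq (hB.le_perp_perp D)
  have h1 := hB.finrank_perp hn D
  have h2 := hB.finrank_perp hn (perp B D)
  omega

theorem Herm.kap_le (hB : Herm B) (hn : Nondeg B) [FiniteDimensional F V]
    (D : Submodule F V) : kap B D ≤ finrank F V := by
  have h1 := hB.finrank_perp hn D
  have h2 : finrank F (rad B D) ≤ finrank F (perp B D) := Submodule.finrank_mono inf_le_right
  unfold kap; omega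

/-- cutting by a functional -/
theorem finrank_le_inf_ker [FiniteDimensional F V] (X : Submodule F V) (φ : V →ₗ[F] F) :
    finrank F X ≤ finrank F ↥(X ⊓ LinearMap.ker φ) + 1 := by
  have h1 := Submodule.finrank_sup_add_finrank_inf_eq X (LinearMap.ker φ)
  have h2 := LinearMap.finrank_range_add_finrank_ker φ
  have h3 : finrank F (LinearMap.range φ) ≤ 1 := by
    have := Submodule.finrank_le (LinearMap.range φ)
    simpa using this
  have h4 := Submodule.finrank_le (X ⊔ LinearMap.ker φ)
  omega

theorem finrank_sup_span [FiniteDimensional F V] {D : Submodule F V} {v : V} (hv : v ∉ D) :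
    finrank F ↥(D ⊔ F ∙ v) = finrank F D + 1 := by
  have h1 := Submodule.finrank_sup_add_finrank_inf_eq D (F ∙ v)
  have h0 : v ≠ 0 := by rintro rfl; exact hv D.zero_mem
  have h2 : finrank F (F ∙ v) = 1 := finrank_span_singleton h0
  have h3 : D ⊓ (F ∙ v) = ⊥ := by
    rw [eq_bot_iff]
    rintro x ⟨hx1, hx2⟩
    obtain ⟨c, rfl⟩ := Submodule.mem_span_singleton.1 hx2
    by_cases hc : c = 0
    · simp [hc]
    · exfalso; apply hv
      have := D.smul_mem c⁻¹ hx1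
      rwa [smul_smul, inv_mul_cancel₀ hc, one_smul] at this
  rw [h3, finrank_bot, h2] at h1
  omega

theorem finrank_sup_span_le [FiniteDimensional F V] (D : Submodule F V) (v : V) :
    finrank F ↥(D ⊔ F ∙ v) ≤ finrank F D + 1 := by
  by_cases hv : v ∈ D
  · rw [sup_eq_left.2 ((Submodule.span_singleton_le_iff_mem v D).2 hv)]; omega
  · rw [finrank_sup_span hv]

theorem mem_sup_span {D : Submodule F V} {v x : V} :
    x ∈ D ⊔ F ∙ v ↔ ∃ d ∈ D, ∃ c : F, x = d + c • v := by
  rw [Submodule.mem_sup]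
  constructor
  · rintro ⟨d, hd, y, hy, rfl⟩
    obtain ⟨c, rfl⟩ := Submodule.mem_span_singleton.1 hy
    exact ⟨d, hd, c, rfl⟩
  · rintro ⟨d, hd, c, rfl⟩
    exact ⟨d, hd, c • v, Submodule.smul_mem _ _ (Submodule.mem_span_singleton_self v), rfl⟩

/-- L1 and monotonicity, one step -/
theorem Herm.kap_step (hB : Herm B) [FiniteDimensional F V] (D : Submodule F V) (v : V) :
    kap B D ≤ kap B (D ⊔ F ∙ v) ∧ kap B (D ⊔ F ∙ v) ≤ kap B D + 2 := by
  by_cases hv : v ∈ D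
  · rw [sup_eq_left.2 ((Submodule.span_singleton_le_iff_mem v D).2 hv)]; omega
  have h0 := finrank_sup_span hv
  unfold kap
  constructor
  · have h1 := finrank_le_inf_ker (rad B D) (B v)
    have h2 : rad B D ⊓ LinearMap.ker (B v) ≤ rad B (D ⊔ F ∙ v) := by
      rintro x ⟨hx1, hx2⟩
      refine ⟨Submodule.mem_sup_left hx1.1, ?_⟩
      rw [SetLike.mem_coe, perp_sup]
      exact ⟨hx1.2, mem_perp_span.2 hx2⟩
    have h3 := Submodule.finrank_mono h2
    omega
  · obtain ⟨φ, hφ1, hφ2⟩ := Submodule.exists_le_ker_of_notMem hv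
    have h1 := finrank_le_inf_ker (rad B (D ⊔ F ∙ v)) φ
    have h2 : rad B (D ⊔ F ∙ v) ⊓ LinearMap.ker φ ≤ rad B D := by
      rintro x ⟨hx1, hx2⟩
      refine ⟨?_, perp_anti le_sup_left hx1.2⟩
      obtain ⟨d, hd, c, rfl⟩ := mem_sup_span.1 hx1.1
      have e : φ (d + c • v) = 0 := hx2
      rw [map_add, map_smul, show φ d = 0 from hφ2 hd, zero_add, smul_eq_mul] at e
      have : c = 0 := (mul_eq_zero.1 e).resolve_right hφ1
      simpa [this] using hd
    have h3 := Submodule.finrank_mono h2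
    omega

theorem exists_mem_not {D E : Submodule F V} (h : D < E) : ∃ v ∈ E, v ∉ D :=
  SetLike.exists_of_lt h

/-- induction between two subspaces, adding one vector at a time -/
theorem sub_induct [FiniteDimensional F V] (E : Submodule F V) (P : Submodule F V → Prop)
    (hE : P E) (hstep : ∀ D, D < E → (∀ v ∈ E, v ∉ D → P (D ⊔ F ∙ v)) → P D) :
    ∀ D, D ≤ E → P D := by
  intro D hD
  induction hk : finrank F E - finrank F D using Nat.strong_induction_on generalizing D with
  | _ m ih =>
    rcases hD.lt_or_eq with h | h
    · refine hstep D h (fun v hv hvD => ?_)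
      have h1 := finrank_sup_span hvD
      have h2 : D ⊔ F ∙ v ≤ E := sup_le hD ((Submodule.span_singleton_le_iff_mem v E).2 hv)
      have h3 := Submodule.finrank_mono h2
      exact ih _ (by omega) _ h2 rfl
    · rw [h]; exact hE

theorem Herm.kap_mono (hB : Herm B) [FiniteDimensional F V] {D E : Submodule F V} (h : D ≤ E) :
    kap B D ≤ kap B E := by
  refine sub_induct E (fun D => kap B D ≤ kap B E) le_rfl ?_ D h
  intro D hD ih
  obtain ⟨v, hv, hvD⟩ := exists_mem_not hD
  exact (hB.kap_step D v).1.trans (ih v hv hvD)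

/-- L2 -/
theorem Herm.rad_pair (hB : Herm B) {D : Submodule F V} {v r : V} (hr : r ∈ rad B D)
    (hrv : B r v ≠ 0) : rad B (D ⊔ F ∙ v) ≤ rad B D ⊓ LinearMap.ker (B v) := by
  rintro x ⟨hx1, hx2⟩
  obtain ⟨d, hd, c, rfl⟩ := mem_sup_span.1 hx1
  have h1 : B r (d + c • v) = 0 := hx2 r (Submodule.mem_sup_left hr.1)
  rw [map_add, hB.zero_comm (hr.2 d hd), zero_add, Bsmul] at h1
  have : c = 0 := (mul_eq_zero.1 h1).resolve_right hrv
  subst this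
  rw [zero_smul, add_zero] at hx2 ⊢
  exact ⟨⟨hd, perp_anti le_sup_left hx2⟩,
    hx2 v (Submodule.mem_sup_right (Submodule.mem_span_singleton_self v))⟩

theorem Herm.rad_pair_lt (hB : Herm B) {D : Submodule F V} {v r : V} (hr : r ∈ rad B D)
    (hrv : B r v ≠ 0) : rad B (D ⊔ F ∙ v) < rad B D := by
  refine lt_of_le_of_ne ((hB.rad_pair hr hrv).trans inf_le_left) ?_
  intro h
  rw [← h] at hr
  exact hrv (hB.zero_comm (hB.rad_pair (h ▸ hr) hrv hr).2)

theorem notMem_of_pair (hB : Herm B) {D : Submodule F V} {v r : V} (hr : r ∈ rad B D)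
    (hrv : B r v ≠ 0) : v ∉ D := fun h => hrv (hB.zero_comm (hr.2 v h))

theorem Herm.kap_pair (hB : Herm B) [FiniteDimensional F V] {D : Submodule F V} {v r : V}
    (hr : r ∈ rad B D) (hrv : B r v ≠ 0) : kap B (D ⊔ F ∙ v) = kap B D := by
  apply le_antisymm _ (hB.kap_step D v).1
  have h1 := finrank_sup_span (notMem_of_pair hB hr hrv)
  have h2 := Submodule.finrank_lt_finrank_of_lt (hB.rad_pair_lt hr hrv)
  unfold kap; omega

/-- L3 -/
theorem Herm.rad_L3 (hB : Herm B) {D : Submodule F V} {v p : V} (hp : p ∈ D)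
    (hpv : ∀ d ∈ D, B p d = B v d) (hne : B v v ≠ B p p) :
    rad B (D ⊔ F ∙ v) ≤ rad B D := by
  rintro x ⟨hx1, hx2⟩
  obtain ⟨d, hd, c, rfl⟩ := mem_sup_span.1 hx1
  have hpv' : ∀ d ∈ D, B d p = B d v := fun d hd => by rw [hB.symm p d, hB.symm v d, hpv d hd]
  have h1 : B p (d + c • v) = 0 := hx2 p (Submodule.mem_sup_left hp)
  have h2 : B v (d + c • v) = 0 :=
    hx2 v (Submodule.mem_sup_right (Submodule.mem_span_singleton_self v))
  rw [map_add, Bsmul] at h1 h2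
  rw [← hpv' p hp] at h1
  rw [← hpv d hd] at h2
  have h3 : c * (B v v - B p p) = 0 := by linear_combination h2 - h1
  have : c = 0 := (mul_eq_zero.1 h3).resolve_right (sub_ne_zero.2 hne)
  subst this
  rw [zero_smul, add_zero] at hx2 ⊢
  exact ⟨hd, perp_anti le_sup_left hx2⟩

theorem Herm.kap_L3 (hB : Herm B) [FiniteDimensional F V] {D : Submodule F V} {v p : V}
    (hp : p ∈ D) (hpv : ∀ d ∈ D, B p d = B v d) (hne : B v v ≠ B p p) :
    kap B (D ⊔ F ∙ v) ≤ kap B D + 1 := by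
  have h1 := finrank_sup_span_le D v
  have h2 := Submodule.finrank_mono (hB.rad_L3 hp hpv hne)
  unfold kap; omega

/-- adding an orthogonal vector -/
theorem Herm.kap_perp_aniso (hB : Herm B) [FiniteDimensional F V] {D : Submodule F V} {x : V}
    (hx : x ∈ perp B D) (hne : B x x ≠ 0) : kap B (D ⊔ F ∙ x) = kap B D + 1 := by
  have hxD : x ∉ D := fun h => hne (hx x h)
  have h1 := finrank_sup_span hxD
  have h2 : rad B (D ⊔ F ∙ x) = rad B D := by
    apply le_antisymm
    · refine hB.rad_L3 (p := 0) D.zero_mem (fun d hd => ?_) (by simpa using hne)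
      rw [hB.mem_perp'.1 hx d hd]; simp
    · rintro r ⟨hr1, hr2⟩
      refine ⟨Submodule.mem_sup_left hr1, ?_⟩
      rw [SetLike.mem_coe, perp_sup]
      exact ⟨hr2, mem_perp_span.2 (hB.mem_perp'.1 hx r hr1)⟩
  unfold kap; rw [h2]; omega

theorem Herm.kap_perp_iso (hB : Herm B) [FiniteDimensional F V] {D : Submodule F V} {x : V}
    (hx : x ∈ perp B D) (h0 : B x x = 0) (hxD : x ∉ D) : kap B (D ⊔ F ∙ x) = kap B D + 2 := by
  have h1 := finrank_sup_span hxD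
  have h2 : rad B D ⊔ F ∙ x ≤ rad B (D ⊔ F ∙ x) := by
    refine sup_le ?_ ?_
    · rintro r ⟨hr1, hr2⟩
      refine ⟨Submodule.mem_sup_left hr1, ?_⟩
      rw [SetLike.mem_coe, perp_sup]
      exact ⟨hr2, mem_perp_span.2 (hB.mem_perp'.1 hx r hr1)⟩
    · rw [Submodule.span_singleton_le_iff_mem]
      refine ⟨Submodule.mem_sup_right (Submodule.mem_span_singleton_self x), ?_⟩
      rw [SetLike.mem_coe, perp_sup]
      exact ⟨hx, mem_perp_span.2 h0⟩
  have h3 := Submodule.finrank_mono h2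
  have h4 : finrank F ↥(rad B D ⊔ F ∙ x) = finrank F (rad B D) + 1 :=
    finrank_sup_span (fun h => hxD h.1)
  have h5 := (hB.kap_step D x).2
  unfold kap at *; omega

/-- polarization: a totally isotropic (norm zero) subspace is totally null -/
theorem Herm.polar (hB : Herm B) {P : Submodule F V} (h : ∀ x ∈ P, B x x = 0) :
    ∀ x ∈ P, ∀ y ∈ P, B x y = 0 := by
  intro x hx y hy
  have key : ∀ c : F, σ c * B y x + c * B x y = 0 := by
    intro c
    have := h _ (P.add_mem hx (P.smul_mem c hy))
    simp only [map_add, LinearMap.add_apply, smulB, Bsmul, h x hx, h y hy] at this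
    linear_combination this
  by_contra hne
  obtain ⟨t, ht⟩ := hB.hf.trace_surj 1 (map_one σ)
  have := key (t / B x y)
  rw [hB.symm x y, ← map_mul, div_mul_cancel₀ _ hne, add_comm, ht] at this
  exact one_ne_zero this

/-- room 1: nonisotropic vectors in the perp, of any norm -/
theorem Herm.exists_norm (hB : Herm B) (hn : Nondeg B) [FiniteDimensional F V]
    (D : Submodule F V) (hk : kap B D < finrank F V) (a : F) (ha : σ a = a) :
    ∃ y ∈ perp B D, B y y = a := by
  have h1 : ∃ y ∈ perp B D, B y y ≠ 0 := by
    by_contra hcon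
    push Not at hcon
    have h2 : perp B D ≤ rad B D := by
      intro x hx
      refine ⟨?_, hx⟩
      rw [SetLike.mem_coe, ← hB.perp_perp hn D]
      intro d hd
      exact hB.polar hcon d hd x hx
    have h3 := Submodule.finrank_mono h2
    have h4 := hB.finrank_perp hn D
    unfold kap at hk; omega
  obtain ⟨y, hy, hne⟩ := h1
  obtain ⟨c, hc⟩ := hB.hf.norm_surj (a / B y y) (by rw [map_div₀, ha, hB.fix])
  refine ⟨c • y, Submodule.smul_mem _ c hy, ?_⟩
  rw [smulB, Bsmul, ← mul_assoc, mul_comm (σ c), hc, div_mul_cancel₀ _ hne]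

/-- room 2: an isotropic vector in the perp outside `D` -/
theorem Herm.exists_iso (hB : Herm B) (hn : Nondeg B) [FiniteDimensional F V]
    (D : Submodule F V) (hk : kap B D + 2 ≤ finrank F V) :
    ∃ y ∈ perp B D, B y y = 0 ∧ y ∉ D := by
  obtain ⟨u, hu, hu1⟩ := hB.exists_norm hn D (by omega) 1 (map_one σ)
  have hune : B u u ≠ 0 := by rw [hu1]; exact one_ne_zero
  have hk2 := hB.kap_perp_aniso hu hune
  obtain ⟨w, hw, hw1⟩ := hB.exists_norm hn (D ⊔ F ∙ u) (by omega) (-1) (by simp)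
  rw [perp_sup] at hw
  have huw : B u w = 0 := mem_perp_span.1 hw.2
  refine ⟨u + w, Submodule.add_mem _ hu hw.1, ?_, ?_⟩
  · rw [addB, map_add, map_add, hu1, hw1, huw, hB.zero_comm huw]; ring
  · intro h
    have h2 : B u (u + w) = 0 := hB.zero_comm (hu _ h)
    rw [map_add, hu1, huw, add_zero] at h2
    exact one_ne_zero h2

end Herm

end UEH

namespace UEH

section EET

open Module

variable {F : Type} [Field F] {σ : F →+* F}
variable {E : Type} [AddCommGroup E] [Module F E]
variable {V : Type} [AddCommGroup V] [Module F V]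

def IsoOn (BE : E →ₛₗ[σ] E →ₗ[F] F) (B : V →ₛₗ[σ] V →ₗ[F] F) (M : Submodule F E)
    (f : E →ₗ[F] V) : Prop :=
  (∀ x ∈ M, ∀ y ∈ M, B (f x) (f y) = BE x y) ∧ ∀ x ∈ M, f x = 0 → x = 0

variable {BE : E →ₛₗ[σ] E →ₗ[F] F} {B : V →ₛₗ[σ] V →ₗ[F] F}

theorem IsoOn.mono {M N : Submodule F E} {f : E →ₗ[F] V} (h : IsoOn BE B M f) (hN : N ≤ M) :
    IsoOn BE B N f :=
  ⟨fun x hx y hy => h.1 x (hN hx) y (hN hy), fun x hx => h.2 x (hN hx)⟩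

theorem finrank_map_on {M : Submodule F E} {f : E →ₗ[F] V} (h : ∀ x ∈ M, f x = 0 → x = 0) :
    finrank F (M.map f) = finrank F M := by
  have hinj : Function.Injective (f.domRestrict M) := by
    rw [← LinearMap.ker_eq_bot, LinearMap.ker_eq_bot']
    intro m hm
    exact Subtype.ext (h m m.2 hm)
  rw [← LinearMap.range_domRestrict]
  exact LinearMap.finrank_range_of_inj hinj

theorem IsoOn.rad_map {M : Submodule F E} {f : E →ₗ[F] V} (h : IsoOn BE B M f) :
    rad B (M.map f) = (rad BE M).map f := by
  ext v
  constructor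
  · rintro ⟨⟨x, hx, rfl⟩, h2⟩
    refine ⟨x, ⟨hx, fun d hd => ?_⟩, rfl⟩
    rw [← h.1 d hd x hx]
    exact h2 _ ⟨d, hd, rfl⟩
  · rintro ⟨x, ⟨hx, h2⟩, rfl⟩
    refine ⟨⟨x, hx, rfl⟩, ?_⟩
    rintro _ ⟨d, hd, rfl⟩
    rw [h.1 d hd x hx]
    exact h2 d hd

theorem IsoOn.kap_map {M : Submodule F E} {f : E →ₗ[F] V} (h : IsoOn BE B M f) :
    kap B (M.map f) = kap BE M := by
  unfold kap
  rw [h.rad_map, finrank_map_on h.2, finrank_map_on (M := rad BE M) (fun x hx => h.2 x hx.1)]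

theorem IsoOn.functional {M : Submodule F E} {f : E →ₗ[F] V} (h : IsoOn BE B M f)
    (ψ : E →ₗ[F] F) : ∃ φ : V →ₗ[F] F, ∀ d ∈ M, φ (f d) = ψ d := by
  have hinj : LinearMap.ker (f.domRestrict M) = ⊥ := by
    rw [LinearMap.ker_eq_bot']
    intro m hm
    exact Subtype.ext (h.2 m m.2 hm)
  obtain ⟨g, hg⟩ := LinearMap.exists_leftInverse_of_injective _ hinj
  refine ⟨(ψ.comp M.subtype).comp g, fun d hd => ?_⟩
  have := LinearMap.congr_fun hg ⟨d, hd⟩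
  have h2 : g (f d) = ⟨d, hd⟩ := this
  show ψ (g (f d) : E) = ψ d
  rw [h2]

theorem IsoOn.extend (hBE : Herm BE) (hB : Herm B) {D : Submodule F E} {f : E →ₗ[F] V}
    (h : IsoOn BE B D f) {v : E} (hv : v ∉ D) {w : V}
    (h1 : ∀ d ∈ D, B (f d) w = BE d v) (h2 : B w w = BE v v) (h3 : w ∉ D.map f) :
    ∃ f' : E →ₗ[F] V, (∀ d ∈ D, f' d = f d) ∧ f' v = w ∧ IsoOn BE B (D ⊔ F ∙ v) f' := by
  obtain ⟨φ, hφ, hφD⟩ := Submodule.exists_le_ker_of_notMem hv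
  have e1 : ∀ d ∈ D, (f + ((φ v)⁻¹ • φ).smulRight (w - f v)) d = f d := by
    intro d hd
    have : φ d = 0 := hφD hd
    simp [this]
  have e2 : (f + ((φ v)⁻¹ • φ).smulRight (w - f v)) v = w := by
    simp [hφ]
  refine ⟨_, e1, e2, ?_, ?_⟩
  · intro x hx y hy
    obtain ⟨d, hd, c, rfl⟩ := mem_sup_span.1 hx
    obtain ⟨d', hd', c', rfl⟩ := mem_sup_span.1 hy
    rw [map_add, map_smul, map_add _ d', map_smul _ c', e1 d hd, e1 d' hd', e2]
    have h4 : B w (f d') = BE v d' := by rw [hB.symm, h1 d' hd', ← hBE.symm]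
    simp only [map_add, LinearMap.add_apply, smulB, Bsmul, h.1 d hd d' hd', h1 d hd, h2, h4]
  · intro x hx h0
    obtain ⟨d, hd, c, rfl⟩ := mem_sup_span.1 hx
    rw [map_add, map_smul, e1 d hd, e2] at h0
    by_cases hc : c = 0
    · subst hc
      rw [zero_smul, add_zero] at h0 ⊢
      exact h.2 d hd h0
    · exfalso
      apply h3
      refine ⟨(-c⁻¹) • d, D.smul_mem _ hd, ?_⟩
      have h5 : f d = - (c • w) := eq_neg_of_add_eq_zero_left h0
      rw [map_smul, h5, smul_neg, neg_smul, neg_neg, smul_smul, inv_mul_cancel₀ hc, one_smul]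

/-- adding a vector pairing with the radical : no room needed -/
theorem IsoOn.extend_pair (hBE : Herm BE) (hB : Herm B) (hn : Nondeg B) [FiniteDimensional F V]
    {D : Submodule F E} {f : E →ₗ[F] V}
    (h : IsoOn BE B D f) {v r : E} (hr : r ∈ rad BE D) (hrv : BE r v ≠ 0) :
    ∃ f' : E →ₗ[F] V, (∀ d ∈ D, f' d = f d) ∧ IsoOn BE B (D ⊔ F ∙ v) f' := by
  have hv := notMem_of_pair hBE hr hrv
  obtain ⟨φ, hφ⟩ := h.functional (BE v)
  obtain ⟨w0, hw0⟩ := hB.rep_top hn φ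
  have hw0' : ∀ d ∈ D, B w0 (f d) = BE v d := fun d hd => by rw [hw0, hφ d hd]
  have hvr : BE v r ≠ 0 := by
    intro h0; exact hrv (hBE.zero_comm h0)
  obtain ⟨t, ht⟩ := hB.hf.trace_surj (BE v v - B w0 w0) (by rw [map_sub, hBE.fix, hB.fix])
  have hw1 : ∀ d ∈ D, B (f d) w0 = BE d v := fun d hd => by
    rw [hB.symm, hw0' d hd, ← hBE.symm]
  have key : ∀ d ∈ D, B (f d) (w0 + (t / BE v r) • f r) = BE d v := by
    intro d hd
    rw [map_add, Bsmul, h.1 d hd r hr.1, hr.2 d hd, mul_zero, add_zero, hw1 d hd]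
  obtain ⟨f', a1, a2, a3⟩ := h.extend hBE hB hv (w := w0 + (t / BE v r) • f r) key
    (by
      have e1 : B (f r) (w0 + (t / BE v r) • f r) = BE r v := key r hr.1
      rw [addB, smulB, e1, map_add, Bsmul, hw0' r hr.1, hBE.symm v r, ← map_mul,
        div_mul_cancel₀ _ hvr]
      linear_combination ht)
    (by
      rintro ⟨d, hd, hd2⟩
      have := key r hr.1
      rw [← hd2, h.1 r hr.1 d hd, hBE.zero_comm (hr.2 d hd)] at this
      exact hrv this.symm)
  exact ⟨f', a1, a3⟩

theorem EET (hBE : Herm BE) (hB : Herm B) (hn : Nondeg B) [FiniteDimensional F E]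
    [FiniteDimensional F V] {M : Submodule F E} (hk : kap BE M ≤ finrank F V) :
    ∀ D, D ≤ M → ∀ f : E →ₗ[F] V, IsoOn BE B D f →
      ∃ f' : E →ₗ[F] V, (∀ d ∈ D, f' d = f d) ∧ IsoOn BE B M f' := by
  refine sub_induct M _ (fun f hf => ⟨f, fun _ _ => rfl, hf⟩) ?_
  intro D hD ih f hf
  obtain ⟨v, hvM, hv⟩ := exists_mem_not hD
  suffices ∃ f' : E →ₗ[F] V, (∀ d ∈ D, f' d = f d) ∧ IsoOn BE B (D ⊔ F ∙ v) f' by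
    obtain ⟨f', h1, h2⟩ := this
    obtain ⟨f'', h3, h4⟩ := ih v hvM hv f' h2
    exact ⟨f'', fun d hd => by rw [h3 d (Submodule.mem_sup_left hd), h1 d hd], h4⟩
  by_cases hA : ∃ r ∈ rad BE D, BE r v ≠ 0
  · obtain ⟨r, hr, hrv⟩ := hA
    exact hf.extend_pair hBE hB hn hr hrv
  · push Not at hA
    obtain ⟨v0, hv0, hv0d⟩ := hBE.rep D (BE v) (fun r hr => hBE.zero_comm (hA r hr))
    have hx : v - v0 ∈ perp BE D := by
      rw [hBE.mem_perp']
      intro d hd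
      rw [subB, hv0d d hd, sub_self]
    have hxD : v - v0 ∉ D := fun h => hv (by simpa using D.add_mem h hv0)
    have hle : D ⊔ F ∙ (v - v0) ≤ M := by
      refine sup_le hD.le ?_
      rw [Submodule.span_singleton_le_iff_mem]
      exact M.sub_mem hvM (hD.le hv0)
    have hk2 := hBE.kap_mono hle
    have hmap := hf.kap_map
    have hv0' : ∀ d ∈ D, BE d v0 = BE d v := fun d hd => by
      rw [hBE.symm v0, hv0d d hd, ← hBE.symm]
    obtain ⟨y, hy1, hy2, hy3⟩ : ∃ y ∈ perp B (D.map f), B y y = BE (v - v0) (v - v0) ∧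
        y ∉ D.map f := by
      by_cases h0 : BE (v - v0) (v - v0) = 0
      · have := hBE.kap_perp_iso hx h0 hxD
        obtain ⟨y, hy1, hy2, hy3⟩ := hB.exists_iso hn (D.map f) (by omega)
        exact ⟨y, hy1, by rw [hy2, h0], hy3⟩
      · have := hBE.kap_perp_aniso hx h0
        obtain ⟨y, hy1, hy2⟩ := hB.exists_norm hn (D.map f) (by omega) _ (hBE.fix (v - v0))
        refine ⟨y, hy1, hy2, fun h => h0 ?_⟩
        rw [← hy2]; exact hy1 y h
    obtain ⟨f', a1, a2, a3⟩ := hf.extend hBE hB hv (w := f v0 + y)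
      (by
        intro d hd
        rw [map_add, hf.1 d hd v0 hv0, hy1 _ ⟨d, hd, rfl⟩, add_zero, hv0' d hd])
      (by
        have e1 : B (f v0) y = 0 := hy1 _ ⟨v0, hv0, rfl⟩
        have e2 : B y (f v0) = 0 := hB.zero_comm e1
        have e3 : BE v0 (v - v0) = 0 := hx v0 hv0
        have e4 : BE (v - v0) v0 = 0 := hBE.zero_comm e3
        have e5 : BE v v = BE v0 v0 + BE (v - v0) (v - v0) := by
          have : v = v0 + (v - v0) := by abel
          conv_lhs => rw [this]
          rw [addB, map_add, map_add, e3, e4]; ring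
        rw [addB, map_add, map_add, e1, e2, hf.1 v0 hv0 v0 hv0, hy2, e5]; ring)
      (by
        intro h
        apply hy3
        have := (D.map f).sub_mem h ⟨v0, hv0, rfl⟩
        simpa using this)
    exact ⟨f', a1, a3⟩

/-! ### the unitary group -/

abbrev UU (B : V →ₛₗ[σ] V →ₗ[F] F) := ↥(bilinIsoms F (fun v w => B v w))

instance [Finite V] : Finite (V ≃ₗ[F] V) :=
  Finite.of_injective (fun g : V ≃ₗ[F] V => (g : V → V)) DFunLike.coe_injective

theorem UU.iso (g : UU B) (v w : V) : B (g • v) (g • w) = B v w := g.2 v w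

theorem UU.iso' (g : UU B) (v w : V) : B (g • v) w = B v (g⁻¹ • w) := by
  rw [← UU.iso g⁻¹ (g • v) w, inv_smul_smul]

theorem UU.smul_add (g : UU B) (v w : V) : g • (v + w) = g • v + g • w := map_add g.1 v w
theorem UU.smul_sub (g : UU B) (v w : V) : g • (v - w) = g • v - g • w := map_sub g.1 v w
theorem UU.smul_smul (g : UU B) (c : F) (v : V) : g • (c • v) = c • g • v := map_smul g.1 c v

def Gam (B : V →ₛₗ[σ] V →ₗ[F] F) (D : Submodule F V) : Subgroup (UU B) where
  carrier := {g | ∀ d ∈ D, g • d = d}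
  one_mem' := fun d _ => one_smul _ d
  mul_mem' := by
    intro a b ha hb d hd
    rw [mul_smul, hb d hd, ha d hd]
  inv_mem' := by
    intro a ha d hd
    rw [inv_smul_eq_iff, ha d hd]

theorem mem_Gam {D : Submodule F V} {g : UU B} : g ∈ Gam B D ↔ ∀ d ∈ D, g • d = d := Iff.rfl

theorem Gam_anti {D E : Submodule F V} (h : D ≤ E) : Gam B E ≤ Gam B D :=
  fun g hg d hd => hg d (h hd)

theorem Gam_mem_sup_span {D : Submodule F V} {v : V} {g : UU B} :
    g ∈ Gam B (D ⊔ F ∙ v) ↔ g ∈ Gam B D ∧ g • v = v := by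
  constructor
  · intro h
    exact ⟨Gam_anti le_sup_left h, h v (Submodule.mem_sup_right (Submodule.mem_span_singleton_self v))⟩
  · rintro ⟨h1, h2⟩ x hx
    obtain ⟨d, hd, c, rfl⟩ := mem_sup_span.1 hx
    rw [UU.smul_add, UU.smul_smul, h1 d hd, h2]

/-- Witt's theorem -/
theorem witt (hB : Herm B) (hn : Nondeg B) [FiniteDimensional F V] {D : Submodule F V}
    {f : V →ₗ[F] V} (hf : IsoOn B B D f) : ∃ g : UU B, ∀ d ∈ D, g • d = f d := by
  obtain ⟨f', h1, h2⟩ := EET hB hB hn (M := ⊤) (hB.kap_le hn ⊤) D le_top f hf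
  have hinj : Function.Injective f' := by
    rw [← LinearMap.ker_eq_bot, LinearMap.ker_eq_bot']
    intro m hm
    exact h2.2 m trivial hm
  refine ⟨⟨LinearEquiv.ofInjectiveEndo f' hinj, fun v w => h2.1 v trivial w trivial⟩, ?_⟩
  intro d hd
  exact h1 d hd

/-! ### lists of vectors -/

def Dt (D : Submodule F V) (t : List V) : Submodule F V := D ⊔ Submodule.span F {x | x ∈ t}

theorem Dt_nil (D : Submodule F V) : Dt D [] = D := by
  unfold Dt
  have : {x : V | x ∈ ([] : List V)} = ∅ := by ext; simp
  rw [this, Submodule.span_empty, sup_bot_eq]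

theorem Dt_cons (D : Submodule F V) (x : V) (t : List V) : Dt D (x :: t) = Dt D t ⊔ F ∙ x := by
  unfold Dt
  have : {y : V | y ∈ x :: t} = {x} ∪ {y | y ∈ t} := by ext; simp
  rw [this, Submodule.span_union, sup_assoc, sup_comm (F ∙ x)]

theorem Dt_cons' (D : Submodule F V) (x : V) (t : List V) : Dt D (x :: t) = Dt (D ⊔ F ∙ x) t := by
  rw [Dt_cons]; unfold Dt
  rw [sup_assoc, sup_assoc, sup_comm (F ∙ x)]

theorem le_Dt (D : Submodule F V) (t : List V) : D ≤ Dt D t := le_sup_left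

theorem mem_Dt {D : Submodule F V} {t : List V} {x : V} (h : x ∈ t) : x ∈ Dt D t :=
  Submodule.mem_sup_right (Submodule.subset_span h)

theorem Dt_le {D E : Submodule F V} {t : List V} (h : D ≤ E) (h2 : ∀ x ∈ t, x ∈ E) : Dt D t ≤ E :=
  sup_le h (Submodule.span_le.2 h2)

theorem Dt_mono {D E : Submodule F V} {s t : List V} (h : D ≤ E) (h2 : ∀ x ∈ s, x ∈ t) :
    Dt D s ≤ Dt E t := Dt_le (h.trans (le_Dt E t)) (fun x hx => mem_Dt (h2 x hx))

theorem smul_list_eq_self {g : UU B} {t : List V} : g • t = t ↔ ∀ x ∈ t, g • x = x := by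
  induction t with
  | nil => simp [smul_list_nil]
  | cons x t ih => rw [smul_list_cons, List.cons_eq_cons, ih]; simp

theorem Gam_stab (D : Submodule F V) (t : List V) :
    Gam B D ⊓ MulAction.stabilizer (UU B) t = Gam B (Dt D t) := by
  ext g
  rw [Subgroup.mem_inf, MulAction.mem_stabilizer_iff, smul_list_eq_self]
  constructor
  · rintro ⟨h1, h2⟩
    induction t with
    | nil => rwa [Dt_nil]
    | cons x t ih =>
      rw [Dt_cons, Gam_mem_sup_span]
      exact ⟨ih (fun y hy => h2 y (List.mem_cons_of_mem _ hy)), h2 x List.mem_cons_self⟩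
  · intro h
    exact ⟨Gam_anti (le_Dt D t) h, fun x hx => h x (mem_Dt hx)⟩

/-- linear independence mod `D` -/
def Ind (D : Submodule F V) : List V → Prop
  | [] => True
  | x :: t => x ∉ Dt D t ∧ Ind D t

theorem Ind.sublist {D : Submodule F V} {s t : List V} (hs : s.Sublist t) (h : Ind D t) : Ind D s := by
  induction hs with
  | slnil => exact h
  | cons a h1 ih => exact ih h.2
  | cons_cons a h1 ih =>
    exact ⟨fun hm => h.1 (Dt_mono le_rfl (fun x hx => h1.subset hx) hm), ih h.2⟩

theorem Ind.finrank {D : Submodule F V} [FiniteDimensional F V] {t : List V} (h : Ind D t) :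
    finrank F (Dt D t) = finrank F D + t.length := by
  induction t with
  | nil => rw [Dt_nil]; rfl
  | cons x t ih => rw [Dt_cons, finrank_sup_span h.1, ih h.2, List.length_cons]; omega

theorem finrank_Dt_le {D : Submodule F V} [FiniteDimensional F V] (t : List V) :
    finrank F (Dt D t) ≤ finrank F D + t.length := by
  induction t with
  | nil => rw [Dt_nil]; simp
  | cons x t ih =>
    have := finrank_sup_span_le (Dt D t) x
    rw [Dt_cons, List.length_cons]; omega

theorem Ind_iff_finrank {D : Submodule F V} [FiniteDimensional F V] {t : List V} :
    Ind D t ↔ finrank F (Dt D t) = finrank F D + t.length := by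
  refine ⟨Ind.finrank, ?_⟩
  induction t with
  | nil => intro _; trivial
  | cons x t ih =>
    intro h
    rw [Dt_cons, List.length_cons] at h
    have h1 := finrank_sup_span_le (Dt D t) x
    have h2 := finrank_Dt_le (D := D) t
    refine ⟨fun hx => ?_, ih (by omega)⟩
    rw [sup_eq_left.2 ((Submodule.span_singleton_le_iff_mem x _).2 hx)] at h
    omega

theorem Dt_smul {D : Submodule F V} {t : List V} (f : E →ₗ[F] V) {D' : Submodule F E} {t' : List E}
    (hD : D = D'.map f) (ht : t = t'.map f) : Dt D t = (Dt D' t').map f := by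
  subst hD ht
  unfold Dt
  rw [Submodule.map_sup, Submodule.map_span]
  congr 2
  ext x; simp

/-- Gram data of a list -/
def gram (B : V →ₛₗ[σ] V →ₗ[F] F) : List V → List (List F)
  | [] => []
  | x :: l => ((x :: l).map (B x)) :: gram B l

theorem gram_map {t : List E} {f : E →ₗ[F] V} (h : ∀ x ∈ t, ∀ y ∈ t, B (f x) (f y) = BE x y) :
    gram B (t.map f) = gram BE t := by
  induction t with
  | nil => rfl
  | cons x t ih =>
    show ((x :: t).map f).map (B (f x)) :: gram B (t.map f) = ((x :: t).map (BE x)) :: gram BE t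
    rw [ih (fun x hx y hy => h x (List.mem_cons_of_mem _ hx) y (List.mem_cons_of_mem _ hy))]
    congr 1
    rw [List.map_map]
    refine List.map_congr_left (fun y hy => ?_)
    exact h x List.mem_cons_self y hy

theorem gram_length (t : List V) : (gram B t).length = t.length := by
  induction t with
  | nil => rfl
  | cons x t ih => simp [gram, ih]

/-- two independent lists with same Gram data and same pairing with `D` -/
theorem iso_lists (hB : Herm B) {D : Submodule F V} :
    ∀ {t t' : List V} , Ind D t → Ind D t' → gram B t = gram B t' →
      (∀ x ∈ t, ∀ x' ∈ t', ∀ d ∈ D, B d x = B d x') →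
      ∃ f : V →ₗ[F] V, (∀ d ∈ D, f d = d) ∧ t.map f = t' ∧ IsoOn B B (Dt D t) f := by
  intro t
  induction t with
  | nil =>
    intro t' _ _ hg _
    have : t' = [] := by
      have := congrArg List.length hg
      rw [gram_length, gram_length] at this
      exact List.length_eq_zero_iff.1 this.symm
    subst this
    refine ⟨LinearMap.id, fun _ _ => rfl, rfl, fun _ _ _ _ => rfl, fun x _ h => h⟩
  | cons x t ih =>
    intro t' h1 h2 hg hp
    cases t' with
    | nil => simp [gram] at hg
    | cons x' t' =>
      have hg' := List.cons_eq_cons.1 hg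
      obtain ⟨f, f1, f2, f3⟩ := ih h1.2 h2.2 hg'.2
        (fun x hx x' hx' => hp x (List.mem_cons_of_mem _ hx) x' (List.mem_cons_of_mem _ hx'))
      have hg1 := hg'.1
      rw [List.map_cons, List.map_cons, List.cons_eq_cons] at hg1
      have hmapD : D.map f = D := by
        ext y
        constructor
        · rintro ⟨d, hd, rfl⟩; rw [f1 d hd]; exact hd
        · intro hy; exact ⟨y, hy, f1 y hy⟩
      have hDt : (Dt D t).map f = Dt D t' := (Dt_smul f hmapD.symm f2.symm).symm
      have hpair : ∀ d ∈ Dt D t, B (f d) x' = B d x := by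
        have hy : ∀ y ∈ t, B (f y) x' = B y x := by
          intro y hy
          have h5 := hg1.2
          rw [← f2, List.map_map] at h5
          have h6 := List.map_inj_left.1 h5 y hy
          rw [hB.symm x', hB.symm x, h6]; rfl
        intro d hd
        obtain ⟨d, hdD, y, hy2, rfl⟩ := Submodule.mem_sup.1 hd
        clear hd
        rw [map_add, addB, addB, f1 d hdD, hp x List.mem_cons_self x' List.mem_cons_self d hdD]
        congr 1
        induction hy2 using Submodule.span_induction with
        | mem y h => exact hy y h
        | zero => simp
        | add a b _ _ ha hb => rw [map_add, addB, addB, ha, hb]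
        | smul c a _ ha => rw [map_smul, smulB, smulB, ha]
      obtain ⟨f', a1, a2, a3⟩ := f3.extend hB hB h1.1 (w := x') hpair hg1.1.symm
        (by rw [hDt]; exact h2.1)
      refine ⟨f', fun d hd => by rw [a1 d (le_Dt D t hd), f1 d hd], ?_, by rwa [Dt_cons]⟩
      rw [List.map_cons, a2, ← f2]
      congr 1
      exact List.map_congr_left (fun y hy => a1 y (mem_Dt hy))

theorem witt_lists (hB : Herm B) (hn : Nondeg B) [FiniteDimensional F V] {D : Submodule F V}
    {t t' : List V} (h1 : Ind D t) (h2 : Ind D t') (hg : gram B t = gram B t')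
    (hp : ∀ x ∈ t, ∀ x' ∈ t', ∀ d ∈ D, B d x = B d x') :
    ∃ g ∈ Gam B D, g • t = t' := by
  obtain ⟨f, f1, f2, f3⟩ := iso_lists hB h1 h2 hg hp
  obtain ⟨g, hg⟩ := witt hB hn f3
  refine ⟨g, fun d hd => by rw [hg d (le_Dt D t hd), f1 d hd], ?_⟩
  rw [← f2]
  exact List.map_congr_left (fun y hy => hg y (mem_Dt hy))

end EET

end UEH

namespace UEH

section Refl

open Module

variable {F : Type} [Field F] {σ : F →+* F}
variable {V : Type} [AddCommGroup V] [Module F V]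
variable {B : V →ₛₗ[σ] V →ₗ[F] F}

def Refl (B : V →ₛₗ[σ] V →ₗ[F] F) (D : Submodule F V) : Set (UU B) :=
  {g | ∃ w ∈ perp B D, B w w ≠ 0 ∧ ∃ c : F, c * σ c = 1 ∧
    ∀ x, g • x = x + ((c - 1) / B w w * B w x) • w}

theorem Herm.exists_refl (hB : Herm B) (hn : Nondeg B) [FiniteDimensional F V] {w : V}
    (hw : B w w ≠ 0) {c : F} (hc : c * σ c = 1) :
    ∃ g : UU B, ∀ x, g • x = x + ((c - 1) / B w w * B w x) • w := by
  let f : V →ₗ[F] V := LinearMap.id + (((c - 1) / B w w) • B w).smulRight w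
  have hf : ∀ x, f x = x + ((c - 1) / B w w * B w x) • w := fun x => rfl
  have hiso : ∀ x y, B (f x) (f y) = B x y := by
    intro x y
    rw [hf, hf]
    simp only [map_add, LinearMap.add_apply, smulB, Bsmul, map_mul, map_div₀, map_sub, map_one,
      hB.fix w]
    rw [hB.symm w x]
    field_simp
    linear_combination (B w y * σ (B w x)) * hc
  obtain ⟨g, hg⟩ := witt hB hn (D := ⊤) (f := f) ⟨fun x _ y _ => hiso x y, fun x _ h0 => by
    apply hn x
    intro y
    apply hB.zero_comm
    rw [← hiso, h0, map_zero, LinearMap.zero_apply]⟩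
  exact ⟨g, fun x => by rw [hg x trivial, hf]⟩

theorem Refl_Gam (hB : Herm B) {D : Submodule F V} {g : UU B} (hg : g ∈ Refl B D) : g ∈ Gam B D := by
  obtain ⟨w, hw, h0, c, hc, h⟩ := hg
  intro d hd
  rw [h, hB.mem_perp'.1 hw d hd, mul_zero, zero_smul, add_zero]

theorem Refl_pow {D : Submodule F V} {g : UU B} (hg : g ∈ Refl B D) {m : ℕ}
    (hm : ∀ c : F, c * σ c = 1 → c ^ m = 1) : g ^ m = 1 := by
  obtain ⟨w, hw, h0, c, hc, h⟩ := hg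
  have key : ∀ j : ℕ, ∀ x, (g ^ j) • x = x + ((c ^ j - 1) / B w w * B w x) • w := by
    intro j
    induction j with
    | zero => intro x; simp
    | succ j ih =>
      intro x
      rw [pow_succ', mul_smul, ih, h, map_add, Bsmul, add_assoc, ← add_smul]
      congr 2
      field_simp
      ring
  have : ∀ x : V, (g ^ m) • x = x := by
    intro x
    rw [key, hm c hc]; simp
  apply Subtype.ext
  apply LinearEquiv.ext
  intro x
  exact this x

def Mv (B : V →ₛₗ[σ] V →ₗ[F] F) (D : Submodule F V) (v u : V) : Prop :=
  ∃ h ∈ Subgroup.closure (Refl B D), h • v = u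

theorem Mv.trans {D : Submodule F V} {u v w : V} (h1 : Mv B D u v) (h2 : Mv B D v w) : Mv B D u w := by
  obtain ⟨g, hg, rfl⟩ := h1
  obtain ⟨h, hh, rfl⟩ := h2
  exact ⟨h * g, mul_mem hh hg, mul_smul _ _ _⟩

theorem Mv.symm {D : Submodule F V} {u v : V} (h1 : Mv B D u v) : Mv B D v u := by
  obtain ⟨g, hg, rfl⟩ := h1
  exact ⟨g⁻¹, inv_mem hg, inv_smul_smul _ _⟩

theorem Mv.one (hB : Herm B) (hn : Nondeg B) [FiniteDimensional F V] {D : Submodule F V} {u v : V}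
    (huv : B u u = B v v) (hw : u - v ∈ perp B D) (hN : B (u - v) (u - v) ≠ 0) : Mv B D v u := by
  have e1 : B (u - v) v = B u v - B v v := subB _ _ _
  have e2 : B (u - v) (u - v) = -(B u v - B v v) - σ (B u v - B v v) := by
    rw [subB, map_sub, map_sub, map_sub, hB.fix, ← hB.symm, huv]; ring
  have hb : B u v - B v v ≠ 0 := by
    intro h; rw [e2, h, map_zero] at hN; simp at hN
  have hsb : σ (B u v - B v v) ≠ 0 := by
    intro h; rw [map_eq_zero] at h; exact hb h
  set β := B u v - B v v with hβ
  obtain ⟨g, hg⟩ := hB.exists_refl hn hN (c := -σ β / β) (by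
    rw [map_div₀, map_neg, hB.hf.invol]; field_simp)
  refine ⟨g, Subgroup.subset_closure ⟨_, hw, hN, _, ?_, hg⟩, ?_⟩
  · rw [map_div₀, map_neg, hB.hf.invol]; field_simp
  · rw [hg v, e1]
    have : (-σ β / β - 1) / (B (u - v)) (u - v) * β = 1 := by
      rw [e2] at hN ⊢
      field_simp
      ring
    rw [this, one_smul]; abel

theorem Mv.scale (hB : Herm B) (hn : Nondeg B) [FiniteDimensional F V] {D : Submodule F V} {u : V}
    (hu : u ∈ perp B D) (hN : B u u ≠ 0) {c : F} (hc : c * σ c = 1) : Mv B D u (c • u) := by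
  obtain ⟨g, hg⟩ := hB.exists_refl hn hN hc
  refine ⟨g, Subgroup.subset_closure ⟨_, hu, hN, _, hc, hg⟩, ?_⟩
  rw [hg u, div_mul_cancel₀ _ hN, sub_smul, one_smul]; abel

theorem Refl_anti {D E : Submodule F V} (h : D ≤ E) : Refl B E ⊆ Refl B D := by
  rintro g ⟨w, hw, h2⟩
  exact ⟨w, perp_anti h hw, h2⟩

theorem Gam_diff_perp {D : Submodule F V} {g : UU B} (hg : g ∈ Gam B D) (v : V) :
    g • v - v ∈ perp B D := by
  intro d hd
  rw [map_sub, sub_eq_zero]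
  conv_lhs => rw [← hg d hd]
  exact UU.iso g d v

theorem step_case (hB : Herm B) (hn : Nondeg B) [FiniteDimensional F V] {D : Submodule F V}
    {g : UU B} (hg : g ∈ Gam B D) {v : V} (ih : Gam B (D ⊔ F ∙ v) ≤ Subgroup.closure (Refl B (D ⊔ F ∙ v)))
    (hm : Mv B D v (g • v)) : g ∈ Subgroup.closure (Refl B D) := by
  obtain ⟨h, hh, h2⟩ := hm
  have hhG : h ∈ Gam B D := (Subgroup.closure_le _).2 (fun x hx => Refl_Gam hB hx) hh
  have h3 : h⁻¹ * g ∈ Gam B (D ⊔ F ∙ v) := by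
    rw [Gam_mem_sup_span]
    refine ⟨mul_mem (inv_mem hhG) hg, ?_⟩
    rw [mul_smul, ← h2, inv_smul_smul]
  have h4 := Subgroup.closure_mono (Refl_anti (B := B) (le_sup_left : D ≤ D ⊔ F ∙ v)) (ih h3)
  have := mul_mem hh h4
  rwa [mul_inv_cancel_left] at this

theorem deg_move (hB : Herm B) (hn : Nondeg B) [FiniteDimensional F V] {D : Submodule F V}
    (hk : kap B D < finrank F V) {g : UU B} (hg : g ∈ Gam B D) {r v : V} (hr : r ∈ rad B D)
    (hrv : B r v ≠ 0) : Mv B D v (g • v) := by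
  have ha := Gam_diff_perp hg v
  have huv : B (g • v) (g • v) = B v v := UU.iso g v v
  by_cases hN : B (g • v - v) (g • v - v) = 0
  swap
  · exact Mv.one hB hn huv ha hN
  obtain ⟨x, hx, hx1⟩ := hB.exists_norm hn D hk 1 (map_one σ)
  set a := g • v - v with hadef
  have hvr : B v r ≠ 0 := fun h => hrv (hB.zero_comm h)
  obtain ⟨l, hl, hl0, hl2⟩ : ∃ l : F, σ l = l ∧ l ≠ 0 ∧ l * (B a x + σ (B a x)) ≠ l * l := by
    by_cases h1 : B a x + σ (B a x) = 1
    · obtain ⟨l, h2, h3, h4⟩ := hB.hf.three 0 1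
      refine ⟨l, h2, h3, fun h5 => ?_⟩
      rw [h1] at h5
      exact h4 (mul_left_cancel₀ h3 h5).symm
    · exact ⟨1, map_one σ, one_ne_zero, by simpa using h1⟩
  obtain ⟨s, hs⟩ := hB.hf.trace_surj (- (l * l) - l * (B v x + σ (B v x))) (by
    simp only [map_sub, map_neg, map_mul, map_add, hl, hB.hf.invol]; ring)
  set b := l • x + (s / B v r) • r with hb
  have xr : B x r = 0 := hB.zero_comm (hx r hr.1)
  have rx : B r x = 0 := hx r hr.1
  have rr : B r r = 0 := hr.2 r hr.1
  have hbb : B b b = l * l := by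
    rw [hb]; simp only [map_add, LinearMap.add_apply, smulB, Bsmul, hx1, xr, rx, rr, hl]; ring
  have hbp : b ∈ perp B D := by
    refine (perp B D).add_mem ((perp B D).smul_mem _ hx) ((perp B D).smul_mem _ hr.2)
  have har : B a r = 0 := hB.zero_comm (ha r hr.1)
  have hvb : B v b = l * B v x + s := by
    rw [hb, map_add, Bsmul, Bsmul, div_mul_cancel₀ _ hvr]
  have hab : B a b = l * B a x := by
    rw [hb, map_add, Bsmul, Bsmul, har]; ring
  have hv' : B (v + b) (v + b) = B v v := by
    simp only [map_add, LinearMap.add_apply]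
    rw [hbb, hB.symm v b, hvb, map_add, map_mul, hl]
    linear_combination hs
  refine Mv.trans (v := v + b) (Mv.one hB hn hv' (by simpa using hbp) ?_) (Mv.one hB hn ?_ ?_ ?_)
  · rw [add_sub_cancel_left, hbb]; exact mul_ne_zero hl0 hl0
  · rw [huv, hv']
  · have : g • v - (v + b) = a - b := by rw [hadef]; abel
    rw [this]; exact (perp B D).sub_mem ha hbp
  · have : g • v - (v + b) = a - b := by rw [hadef]; abel
    rw [this]
    simp only [map_sub, LinearMap.sub_apply]
    rw [hN, hbb, hB.symm a b, hab, map_mul, hl]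
    intro h
    apply hl2
    linear_combination -h

theorem nondeg_move (hB : Herm B) (hn : Nondeg B) [FiniteDimensional F V] {D : Submodule F V}
    (hk : kap B D + 1 < finrank F V) {u v : V} (hv : v ∈ perp B D) (hu : u ∈ perp B D)
    (hv1 : B v v = 1) (hu1 : B u u = 1) : Mv B D v u := by
  have hd : u - v ∈ perp B D := (perp B D).sub_mem hu hv
  have huv : B u u = B v v := by rw [hu1, hv1]
  have hv0 : B v v ≠ 0 := by rw [hv1]; exact one_ne_zero
  have hu0 : B u u ≠ 0 := by rw [hu1]; exact one_ne_zero
  by_cases hN : B (u - v) (u - v) = 0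
  swap
  · exact Mv.one hB hn huv hd hN
  by_cases h2 : (2 : F) = 0
  · have hexp : ∀ x y : V, B (x - y) (x - y) = B x x + B y y - (B x y + σ (B x y)) := by
      intro x y
      simp only [map_sub, LinearMap.sub_apply]
      rw [hB.symm x y]; ring
    rw [hexp, hu1, hv1] at hN
    obtain ⟨ζ, hζ, hζ1⟩ := hB.hf.unit
    have hζ0 : ζ ≠ 0 := by rintro rfl; simp at hζ
    have htr : ζ + σ ζ ≠ 0 := by
      intro h
      have h3 : ζ * ζ = 1 := by
        have : σ ζ = ζ := by linear_combination h - ζ * h2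
        rw [this] at hζ; exact hζ
      have h4 : (ζ - 1) * (ζ - 1) = 0 := by linear_combination h3 + (1 - ζ) * h2
      exact hζ1 (sub_eq_zero.1 (mul_self_eq_zero.1 h4))
    have hsn : σ ζ * ζ = 1 := by rw [mul_comm]; exact hζ
    have hfix : σ (B u v) = B u v := by
      linear_combination -hN + (1 - B u v) * h2
    by_cases hb : B u v = 0
    · -- orthogonal
      have hb' : B v u = 0 := hB.zero_comm hb
      obtain ⟨a, ha, ha0, ha1⟩ := hB.hf.three 0 1
      have hz : B ((ζ * a) • u + (ζ * (1 - a)) • v) ((ζ * a) • u + (ζ * (1 - a)) • v) = 1 := by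
        simp only [map_add, LinearMap.add_apply, smulB, Bsmul, hb, hb', hu1, hv1, map_mul, map_sub,
          map_one, ha]
        linear_combination (a * a + (1 - a) * (1 - a)) * hζ + (a * a - a) * h2
      have hzp : (ζ * a) • u + (ζ * (1 - a)) • v ∈ perp B D :=
        (perp B D).add_mem ((perp B D).smul_mem _ hu) ((perp B D).smul_mem _ hv)
      have hzu : B u ((ζ * a) • u + (ζ * (1 - a)) • v) = ζ * a := by
        rw [map_add, Bsmul, Bsmul, hu1, hb]; ring
      have hzv : B v ((ζ * a) • u + (ζ * (1 - a)) • v) = ζ * (1 - a) := by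
        rw [map_add, Bsmul, Bsmul, hv1, hb']; ring
      set z := (ζ * a) • u + (ζ * (1 - a)) • v with hzdef
      refine Mv.trans (v := z) (Mv.symm (Mv.one hB hn (by rw [hz, hv1]) ((perp B D).sub_mem hv hzp) ?_))
        (Mv.one hB hn (by rw [hz, hu1]) ((perp B D).sub_mem hu hzp) ?_)
      · rw [hexp, hz, hv1, hzv, map_mul, map_sub, map_one, ha]
        intro h
        have : (ζ + σ ζ) * (1 - a) = 0 := by linear_combination -h + h2
        rcases mul_eq_zero.1 this with h | h
        · exact htr h
        · exact ha1 (sub_eq_zero.1 h).symm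
      · rw [hexp, hz, hu1, hzu, map_mul, ha]
        intro h
        have : (ζ + σ ζ) * a = 0 := by linear_combination -h + h2
        rcases mul_eq_zero.1 this with h | h
        · exact htr h
        · exact ha0 h
    · refine Mv.trans (v := ζ • u) (Mv.one hB hn ?_ ?_ ?_) (Mv.symm (Mv.scale hB hn hu hu0 hζ))
      · rw [smulB, Bsmul, hu1, hv1]; linear_combination hζ
      · exact (perp B D).sub_mem ((perp B D).smul_mem _ hu) hv
      · rw [hexp, smulB, Bsmul, hu1, hv1, smulB, map_mul, hB.hf.invol, hfix]
        intro h
        have : (ζ + σ ζ) * B u v = 0 := by linear_combination -h + hζ + h2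
        exact (mul_ne_zero htr hb) this
  · have hk2 := hB.kap_perp_aniso hv hv0
    obtain ⟨e, he, he1⟩ := hB.exists_norm hn (D ⊔ F ∙ v) (by omega) 1 (map_one σ)
    rw [perp_sup] at he
    have hve : B v e = 0 := mem_perp_span.1 he.2
    have hexp : ∀ x y : V, B (x - y) (x - y) = B x x + B y y - (B x y + σ (B x y)) := by
      intro x y
      simp only [map_sub, LinearMap.sub_apply]
      rw [hB.symm x y]; ring
    obtain ⟨e', he', he1', hve', hue'⟩ : ∃ e ∈ perp B D, B e e = 1 ∧ B v e = 0 ∧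
        B u e + σ (B u e) ≠ 2 := by
      by_cases h : B u e + σ (B u e) = 2
      · refine ⟨-e, (perp B D).neg_mem he.1, by simp [he1], by simp [hve], fun h3 => ?_⟩
        rw [map_neg, map_neg] at h3
        have : (2 : F) * 2 = 0 := by linear_combination -h - h3
        exact h2 (mul_self_eq_zero.1 this)
      · exact ⟨e, he.1, he1, hve, h⟩
    refine Mv.trans (v := e') (Mv.symm (Mv.one hB hn (by rw [he1', hv1]) ((perp B D).sub_mem hv he') ?_))
        (Mv.one hB hn (by rw [he1', hu1]) ((perp B D).sub_mem hu he') ?_)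
    · rw [hexp, hv1, he1', hve', map_zero]
      intro h; apply h2; linear_combination h
    · rw [hexp, hu1, he1']
      intro h; apply hue'; linear_combination -h

theorem exists_pair (hB : Herm B) (hn : Nondeg B) {r : V} (hr : r ≠ 0) : ∃ v, B r v ≠ 0 := by
  by_contra h
  push Not at h
  exact hr (hn r (fun w => hB.zero_comm (h w)))

theorem Gam_gen (hB : Herm B) (hn : Nondeg B) [FiniteDimensional F V] (D : Submodule F V)
    (hk : kap B D < finrank F V) : Gam B D = Subgroup.closure (Refl B D) := by
  apply le_antisymm _ ((Subgroup.closure_le _).2 (fun x hx => Refl_Gam hB hx))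
  revert hk
  refine sub_induct ⊤ (fun D => kap B D < finrank F V → Gam B D ≤ Subgroup.closure (Refl B D))
    ?_ ?_ D le_top
  · intro h
    have : finrank F V ≤ kap B (⊤ : Submodule F V) := by
      unfold kap; rw [finrank_top]; omega
    omega
  · intro D hD ih hk g hg
    by_cases hdeg : rad B D = ⊥
    · obtain ⟨v, hv, hv1⟩ := hB.exists_norm hn D hk 1 (map_one σ)
      have hv0 : B v v ≠ 0 := by rw [hv1]; exact one_ne_zero
      have hvD : v ∉ D := fun h => hv0 (hv v h)
      have hgv : g • v ∈ perp B D := by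
        have := (perp B D).add_mem (Gam_diff_perp hg v) hv
        simpa using this
      by_cases hc : kap B D + 1 < finrank F V
      · refine step_case hB hn hg (v := v) (ih v trivial hvD ?_) ?_
        · rw [hB.kap_perp_aniso hv hv0]; exact hc
        · exact nondeg_move hB hn hc hv hgv hv1 (by rw [UU.iso, hv1])
      · have htop : D ⊔ F ∙ v = ⊤ := by
          apply Submodule.eq_top_of_finrank_eq
          have h1 := finrank_sup_span hvD
          have h2 : kap B D = finrank F D := by unfold kap; rw [hdeg]; simp
          have h3 := Submodule.finrank_le (D ⊔ F ∙ v)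
          omega
        obtain ⟨d, hd, c, hgc⟩ := mem_sup_span.1 (show g • v ∈ D ⊔ F ∙ v by rw [htop]; trivial)
        have hd0 : d = 0 := by
          have : d ∈ rad B D := by
            refine ⟨hd, ?_⟩
            have := (perp B D).sub_mem hgv ((perp B D).smul_mem c hv)
            rwa [hgc, add_sub_cancel_right] at this
          rw [hdeg] at this; exact (Submodule.mem_bot F).1 this
        rw [hd0, zero_add] at hgc
        have hc1 : c * σ c = 1 := by
          have := UU.iso g v v
          rw [hgc, smulB, Bsmul, hv1] at this
          linear_combination this
        refine Subgroup.subset_closure ⟨v, hv, hv0, c, hc1, fun x => ?_⟩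
        obtain ⟨d, hd, a, rfl⟩ := mem_sup_span.1 (show x ∈ D ⊔ F ∙ v by rw [htop]; trivial)
        rw [UU.smul_add, UU.smul_smul, hg d hd, hgc, map_add, Bsmul, hv1,
          hB.mem_perp'.1 hv d hd, add_assoc, smul_smul, ← add_smul]
        congr 2; ring
    · obtain ⟨r, hr, hr0⟩ := Submodule.exists_mem_ne_zero_of_ne_bot hdeg
      obtain ⟨v, hrv⟩ := exists_pair hB hn hr0
      refine step_case hB hn hg (v := v) (ih v trivial (notMem_of_pair hB hr hrv) ?_) ?_
      · rw [hB.kap_pair hr hrv]; exact hk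
      · exact deg_move hB hn hk hg hr hrv

/-- V_1' -/
theorem V_one (k : Type) [Field k] (hB : Herm B) (hn : Nondeg B) [FiniteDimensional F V]
    {m : ℕ} (hm0 : (m : k) ≠ 0) (hm : ∀ c : F, c * σ c = 1 → c ^ m = 1)
    (D : Submodule F V) (hk : kap B D < finrank F V) : Vanish k (Gam B D) 1 :=
  Vanish_one (Gam B D) (Refl B D) (Gam_gen hB hn D hk) (fun s hs => ⟨m, Refl_pow hs hm, hm0⟩)

end Refl

end UEH

namespace UEH

section Peel

variable {k : Type} [Field k]

theorem del_append {A : Type} (h g : List A) :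
    del k (Finsupp.single (h ++ g) 1) = pf k (· ++ g) (del k (Finsupp.single h 1)) +
      ((-1) ^ h.length : k) • pf k (h ++ ·) (del k (Finsupp.single g 1)) := by
  induction h with
  | nil =>
    have : (([] : List A) ++ ·) = id := by funext x; rfl
    rw [del_nil, map_zero, zero_add, List.nil_append, this, List.length_nil, pow_zero, one_smul]
    show _ = Finsupp.mapDomain id _
    rw [Finsupp.mapDomain_id]
  | cons x h ih =>
    rw [List.cons_append, del_cons', ih, del_cons', map_add, map_sub, pf_single, map_smul, pf_pf,
      pf_pf, pf_pf, List.length_cons, pow_succ]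
    have e1 : (List.cons x ∘ fun y => y ++ g) = ((fun y => y ++ g) ∘ List.cons x) := rfl
    have e2 : (List.cons x ∘ fun y => h ++ y) = (fun y => (x :: h) ++ y) := rfl
    rw [e1, e2, mul_neg_one, neg_smul]
    abel

theorem peel {A : Type} (π : A → Bool) (Z Z' : Set (List A)) (p : ℕ)
    (hlen : ∀ l ∈ Z, l.length = p)
    (hZ : ∀ l ∈ Z', ∀ t, t.Sublist l → t.length + 1 = l.length → t ∈ Z)
    (hfill : ∀ h g, h ++ g ∈ Z → (∀ x ∈ h, π x = true) → (∃ x ∈ g, π x = false) →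
      ∀ w ∈ sp k {h : List A | (∀ x ∈ h, π x = true) ∧ h ++ g ∈ Z}, del k w = 0 →
      ∃ y ∈ sp k {h : List A | (∀ x ∈ h, π x = true) ∧ h ++ g ∈ Z'}, del k y = w)
    (hbase : ∀ z ∈ sp k {l | l ∈ Z ∧ ∀ x ∈ l, π x = true}, del k z = 0 →
      ∃ y ∈ sp k Z', del k y = z) :
    ∀ z ∈ sp k Z, del k z = 0 → ∃ y ∈ sp k Z', del k y = z := by
  classical
  let out : List A → ℕ := fun l => l.countP (fun x => !π x)
  let key : List A → ℕ := fun l => out l * (p + 1) + (l.dropWhile π).length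
  have hsplit : ∀ l : List A, l.takeWhile π ++ l.dropWhile π = l := fun l => List.takeWhile_append_dropWhile
  have htw : ∀ l : List A, ∀ x ∈ l.takeWhile π, π x = true := fun l x hx => List.mem_takeWhile_imp hx
  have houtpos : ∀ h : List A, (∀ x ∈ h, π x = true) → out h = 0 := by
    intro h hh
    show h.countP _ = 0
    rw [List.countP_eq_zero]
    intro a ha; simp [hh a ha]
  have hout : ∀ h g : List A, (∀ x ∈ h, π x = true) → out (h ++ g) = out g := by
    intro h g hh
    show (h ++ g).countP _ = _
    rw [List.countP_append]
    have := houtpos h hh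
    show out h + out g = out g
    omega
  have hdw : ∀ h g : List A, (∀ x ∈ h, π x = true) → (h ++ g).dropWhile π = g.dropWhile π :=
    fun h g hh => List.dropWhile_append_of_pos hh
  have hdwlen : ∀ g : List A, (g.dropWhile π).length ≤ g.length :=
    fun g => (List.dropWhile_sublist π).length_le
  have hout2 : ∀ l : List A, out (l.dropWhile π) = out l := by
    intro l
    conv_rhs => rw [← hsplit l]
    rw [hout _ _ (htw l)]
  have hdd : ∀ l : List A, (l.dropWhile π).dropWhile π = l.dropWhile π := by
    intro l
    conv_rhs => rw [← hsplit l]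
    rw [hdw _ _ (htw l)]
  have key_lt : ∀ h g g' : List A, (∀ x ∈ h, π x = true) → g'.Sublist g → g'.length + 1 = g.length →
      key (h ++ g') + 1 ≤ out g * (p + 1) + g.length := by
    intro h g g' hh hs hl
    show out (h ++ g') * (p + 1) + ((h ++ g').dropWhile π).length + 1 ≤ _
    rw [hout _ _ hh, hdw _ _ hh]
    have h1 : out g' ≤ out g := List.Sublist.countP_le hs
    have h2 := hdwlen g'
    have h3 := Nat.mul_le_mul_right (p + 1) h1
    omega
  suffices H : ∀ K, ∀ z ∈ sp k {l | l ∈ Z ∧ key l ≤ K}, del k z = 0 → ∃ y ∈ sp k Z', del k y = z by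
    intro z hz h0
    refine H (p * (p + 1) + p) z (Finsupp.supported_mono ?_ hz) h0
    intro l hl
    refine ⟨hl, ?_⟩
    have h1 : out l ≤ l.length := List.countP_le_length
    have h2 := hdwlen l
    have h3 := hlen l hl
    rw [h3] at h1 h2
    have h4 := Nat.mul_le_mul_right (p + 1) h1
    show out l * (p + 1) + (l.dropWhile π).length ≤ _
    omega
  intro K
  induction K with
  | zero =>
    intro z hz h0
    refine hbase z (Finsupp.supported_mono ?_ hz) h0
    rintro l ⟨h1, h2⟩
    refine ⟨h1, ?_⟩
    have h3 : (l.dropWhile π).length = 0 := by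
      have : out l * (p + 1) + (l.dropWhile π).length ≤ 0 := h2
      omega
    have h4 := hsplit l
    rw [List.length_eq_zero_iff.1 h3, List.append_nil] at h4
    intro x hx
    rw [← h4] at hx
    exact htw l x hx
  | succ K ih =>
    intro z hz h0
    let S : Finset (List A) := (z.support.filter (fun l => key l = K + 1)).image (List.dropWhile π)
    let P : List A → (List A →₀ k) →ₗ[k] (List A →₀ k) := fun g =>
      Finsupp.linearCombination k (fun l => if l.dropWhile π = g then
        Finsupp.single (l.takeWhile π) (1 : k) else 0)
    have hP : ∀ g l, P g (Finsupp.single l 1) = if l.dropWhile π = g then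
        Finsupp.single (l.takeWhile π) (1 : k) else 0 := by
      intro g l; simp [P]
    have hzZ : ∀ l ∈ z.support, l ∈ Z ∧ key l ≤ K + 1 := fun l hl => hz hl
    have hS : ∀ g ∈ S, ∃ l ∈ z.support, key l = K + 1 ∧ l.dropWhile π = g := by
      intro g hg
      obtain ⟨l, hl, rfl⟩ := Finset.mem_image.1 hg
      rw [Finset.mem_filter] at hl
      exact ⟨l, hl.1, hl.2, rfl⟩
    have hkg : ∀ g ∈ S, out g * (p + 1) + g.length = K + 1 ∧ g.dropWhile π = g ∧
        (g.takeWhile π = []) := by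
      intro g hg
      obtain ⟨l, hl, h1, rfl⟩ := hS g hg
      refine ⟨by rw [hout2]; exact h1, hdd l, ?_⟩
      have := hsplit (l.dropWhile π)
      rw [hdd] at this
      exact List.append_left_eq_self.1 this
    have hfillS : ∀ g ∈ S, ∃ y ∈ sp k {h : List A | (∀ x ∈ h, π x = true) ∧ h ++ g ∈ Z'},
        del k y = P g z := by
      intro g hg
      obtain ⟨l, hl, h1, h2⟩ := hS g hg
      obtain ⟨hk1, hk2, hk3⟩ := hkg g hg
      have hl2 : l.takeWhile π ++ g = l := by rw [← h2]; exact hsplit l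
      refine hfill (l.takeWhile π) g (by rw [hl2]; exact (hzZ l hl).1) (htw l) ?_ (P g z) ?_ ?_
      · by_contra hcon
        push Not at hcon
        have hall : ∀ x ∈ g, π x = true := fun x hx => by simpa using hcon x hx
        have h5 : out g = 0 := houtpos g hall
        have h6 : g.dropWhile π = [] := by
          have := hdw g [] hall
          simpa using this
        rw [hk2] at h6
        rw [h5, h6] at hk1
        simp at hk1
      · refine sp_map (P g) ?_ hz
        rintro l ⟨hl, _⟩
        rw [hP]
        split_ifs with h
        · refine single_mem_sp ?_ 1
          refine ⟨htw l, ?_⟩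
          rw [← h, hsplit]; exact hl
        · exact Submodule.zero_mem _
      · have hcomm : (del k ∘ₗ P g - P g ∘ₗ del k : (List A →₀ k) →ₗ[k] (List A →₀ k)) z ∈
            (⊥ : Submodule k (List A →₀ k)) := by
          refine sp_map _ ?_ hz
          rintro l ⟨hl, hkl⟩
          rw [Submodule.mem_bot, LinearMap.sub_apply, LinearMap.comp_apply, LinearMap.comp_apply, hP]
          conv_lhs => rw [← hsplit l, del_append]
          rw [hdw _ _ (htw l), hdd, map_add, map_smul]
          have hzero : P g (pf k (l.takeWhile π ++ ·) (del k (Finsupp.single (l.dropWhile π) 1))) = 0 := by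
            have : P g (pf k (l.takeWhile π ++ ·) (del k (Finsupp.single (l.dropWhile π) 1))) ∈
                (⊥ : Submodule k (List A →₀ k)) := by
              refine sp_map (P g ∘ₗ pf k (l.takeWhile π ++ ·)) ?_ (del_single_sp (l.dropWhile π))
              rintro g' ⟨hg1, hg2⟩
              rw [Submodule.mem_bot, LinearMap.comp_apply, pf_single, hP, if_neg]
              intro hh
              have e1 := key_lt _ _ _ (htw l) hg1 hg2
              have e2 : key (l.takeWhile π ++ g') = K + 1 := by
                show out _ * (p + 1) + _ = _
                rw [hh, ← hout2, hh, hk1]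
              rw [e2, hout2] at e1
              have : out l * (p + 1) + (l.dropWhile π).length ≤ K + 1 := hkl
              omega
            exact (Submodule.mem_bot k).1 this
          rw [hzero, smul_zero, add_zero]
          have htt : (l.takeWhile π ++ l.dropWhile π).takeWhile π = l.takeWhile π := by rw [hsplit]
          rw [htt]
          have hcalc : ∀ w ∈ sp k {t : List A | t.Sublist (l.takeWhile π) ∧
              t.length + 1 = (l.takeWhile π).length}, P g (pf k (· ++ l.dropWhile π) w) =
              if l.dropWhile π = g then w else 0 := by
            intro w hw
            have : (P g ∘ₗ pf k (· ++ l.dropWhile π) -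
                (if l.dropWhile π = g then LinearMap.id else 0) :
                (List A →₀ k) →ₗ[k] (List A →₀ k)) w ∈ (⊥ : Submodule k (List A →₀ k)) := by
              refine sp_map _ ?_ hw
              rintro t ⟨ht1, ht2⟩
              have htp : ∀ x ∈ t, π x = true := fun x hx => htw l x (ht1.subset hx)
              rw [Submodule.mem_bot, LinearMap.sub_apply, LinearMap.comp_apply, pf_single, hP,
                hdw _ _ htp, hdd]
              split_ifs with h
              · have : (t ++ l.dropWhile π).takeWhile π = t := by
                  rw [List.takeWhile_append_of_pos htp, h, hk3, List.append_nil]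
                rw [this]; simp
              · simp
            rw [Submodule.mem_bot, LinearMap.sub_apply, sub_eq_zero] at this
            rw [← LinearMap.comp_apply, this]
            split_ifs <;> simp
          rw [hcalc _ (del_single_sp _)]
          split_ifs <;> simp
        rw [Submodule.mem_bot, LinearMap.sub_apply, LinearMap.comp_apply, LinearMap.comp_apply, h0,
          map_zero, sub_zero] at hcomm
        exact hcomm
    choose! y hy1 hy2 using hfillS
    let Y : List A →₀ k := ∑ g ∈ S, pf k (· ++ g) (y g)
    have hYZ : Y ∈ sp k Z' := by
      refine Submodule.sum_mem _ (fun g hg => ?_)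
      exact pf_sp _ (fun h hh => hh.2) (hy1 g hg)
    have hmain : z - del k Y ∈ sp k {l | l ∈ Z ∧ key l ≤ K} := by
      have e1 : z - ∑ g ∈ S, pf k (· ++ g) (P g z) ∈ sp k {l | l ∈ Z ∧ key l ≤ K} := by
        have hz2 : z ∈ sp k (↑z.support : Set (List A)) := Finsupp.mem_supported_support k z
        have := sp_map (P := sp k {l | l ∈ Z ∧ key l ≤ K})
          (LinearMap.id - ∑ g ∈ S, pf k (· ++ g) ∘ₗ P g : (List A →₀ k) →ₗ[k] (List A →₀ k)) ?_ hz2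
        · simpa [LinearMap.sum_apply] using this
        · intro l hl
          have hl' : l ∈ z.support := hl
          rw [LinearMap.sub_apply, LinearMap.id_apply, LinearMap.sum_apply]
          have e2 : ∀ g ∈ S, (pf k (· ++ g) ∘ₗ P g) (Finsupp.single l 1) =
              if l.dropWhile π = g then Finsupp.single l (1 : k) else 0 := by
            intro g hg
            rw [LinearMap.comp_apply, hP]
            split_ifs with h
            · rw [pf_single, ← h, hsplit]
            · rw [map_zero]
          rw [Finset.sum_congr rfl e2, Finset.sum_ite_eq]
          split_ifs with h
          · rw [sub_self]; exact Submodule.zero_mem _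
          · rw [sub_zero]
            refine single_mem_sp ?_ 1
            refine ⟨(hzZ l hl').1, ?_⟩
            have h5 := (hzZ l hl').2
            by_contra h6
            apply h
            refine Finset.mem_image.2 ⟨l, Finset.mem_filter.2 ⟨hl', ?_⟩, rfl⟩
            omega
      have e3 : del k Y - ∑ g ∈ S, pf k (· ++ g) (P g z) ∈ sp k {l | l ∈ Z ∧ key l ≤ K} := by
        show del k (∑ g ∈ S, pf k (· ++ g) (y g)) - _ ∈ _
        rw [map_sum, ← Finset.sum_sub_distrib]
        refine Submodule.sum_mem _ (fun g hg => ?_)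
        rw [← hy2 g hg]
        refine sp_map (del k ∘ₗ pf k (· ++ g) - pf k (· ++ g) ∘ₗ del k :
          (List A →₀ k) →ₗ[k] (List A →₀ k)) ?_ (hy1 g hg)
        rintro h ⟨hh1, hh2⟩
        rw [LinearMap.sub_apply, LinearMap.comp_apply, LinearMap.comp_apply, pf_single, del_append,
          add_sub_cancel_left]
        refine Submodule.smul_mem _ _ ?_
        refine pf_sp _ ?_ (del_single_sp g)
        rintro g' ⟨hg1, hg2⟩
        refine ⟨hZ _ hh2 _ (List.Sublist.append_left hg1 h) (by simp; omega), ?_⟩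
        have := key_lt h g g' hh1 hg1 hg2
        have := (hkg g hg).1
        omega
      have := Submodule.sub_mem _ e1 e3
      rwa [sub_sub_sub_cancel_right] at this
    obtain ⟨y', hy', hy''⟩ := ih _ hmain (by rw [map_sub, h0, del_del, sub_zero])
    refine ⟨Y + y', Submodule.add_mem _ hYZ hy', ?_⟩
    rw [map_add, hy'']; abel

end Peel

section Acyc

open Module

variable {k : Type} [Field k]
variable {F : Type} [Field F]
variable {V : Type} [AddCommGroup V] [Module F V]

theorem Dt_append (D : Submodule F V) (h g : List V) : Dt D (h ++ g) = Dt (Dt D g) h := by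
  induction h with
  | nil => rw [Dt_nil]; rfl
  | cons x h ih => rw [List.cons_append, Dt_cons, Dt_cons, ih]

theorem Ind_append {D : Submodule F V} {h g : List V} :
    Ind D (h ++ g) ↔ Ind (Dt D g) h ∧ Ind D g := by
  induction h with
  | nil => simp [Ind]
  | cons x h ih =>
    rw [List.cons_append]
    show (x ∉ Dt D (h ++ g) ∧ Ind D (h ++ g)) ↔ (x ∉ Dt (Dt D g) h ∧ Ind (Dt D g) h) ∧ Ind D g
    rw [ih, Dt_append]; tauto

theorem inf_Dt {T W : Submodule F V} {g : List V} (hg : ∀ x ∈ g, x ∈ T) :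
    T ⊓ Dt W g = Dt (T ⊓ W) g := by
  have : Submodule.span F {x | x ∈ g} ≤ T := Submodule.span_le.2 hg
  unfold Dt
  rw [inf_comm, sup_comm, sup_inf_assoc_of_le _ this, inf_comm W, sup_comm]

def OkT (X : Set V) (T W : Submodule F V) (p : ℕ) : Set (List V) :=
  {l | (∀ x ∈ l, x ∈ X ∧ x ∈ T) ∧ Ind W l ∧ l.length = p}

theorem acyc [FiniteDimensional F V] (X : Set V) (r : V) (T0 : Submodule F V)
    (hX : ∀ T H : Submodule F V, T ≤ T0 → H < T → r ∈ H → (∃ x ∈ X, x ∈ H) → ∃ b ∈ X, b ∈ T ∧ b ∉ H) :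
    ∀ n, ∀ T : Submodule F V, finrank F T = n → T ≤ T0 → r ∈ T → (∃ x ∈ X, x ∈ T) →
      ∀ W : Submodule F V, r ∈ W → ∀ p, finrank F ↥(T ⊓ W) + p + 1 ≤ finrank F T →
      ∀ z ∈ sp k (OkT X T W p), del k z = 0 → ∃ y ∈ sp k (OkT X T W (p + 1)), del k y = z := by
  intro n
  induction n using Nat.strong_induction_on with
  | _ n ih =>
    intro T hTn hT0 hrT hXT W hrW p hp
    obtain ⟨x, hxX, hxT⟩ := hXT
    rcases Nat.eq_zero_or_pos p with hp0 | hp1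
    · subst hp0
      intro z hz _
      have hb : ∃ b ∈ X, b ∈ T ∧ b ∉ W := by
        by_cases hxW : x ∈ W
        · have hlt : T ⊓ W < T := by
            refine lt_of_le_of_ne inf_le_left (fun h => ?_)
            rw [h] at hp; omega
          obtain ⟨b, h1, h2, h3⟩ := hX T (T ⊓ W) hT0 hlt ⟨hrT, hrW⟩ ⟨x, hxX, hxT, hxW⟩
          exact ⟨b, h1, h2, fun h => h3 ⟨h2, h⟩⟩
        · exact ⟨x, hxX, hxT, hxW⟩
      obtain ⟨b, h1, h2, h3⟩ := hb
      refine ⟨pf k (List.cons b) z, pf_sp _ ?_ hz, ?_⟩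
      · rintro l ⟨_, _, hl⟩
        rw [List.length_eq_zero_iff.1 hl]
        refine ⟨by simpa using ⟨h1, h2⟩, ⟨?_, trivial⟩, rfl⟩
        rw [Dt_nil]; exact h3
      · have hdz : del k z = 0 := by
          have : del k z ∈ (⊥ : Submodule k (List V →₀ k)) := by
            refine sp_map (del k) ?_ hz
            rintro l ⟨_, _, hl⟩
            rw [List.length_eq_zero_iff.1 hl, del_nil]
            exact Submodule.zero_mem _
          exact (Submodule.mem_bot k).1 this
        rw [del_cons, hdz, map_zero, sub_zero]
    · -- hyperplane
      have hlt : (T ⊓ W) ⊔ F ∙ x < T := by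
        refine lt_of_le_of_ne (sup_le inf_le_left ((Submodule.span_singleton_le_iff_mem x T).2 hxT))
          (fun h => ?_)
        have := finrank_sup_span_le (T ⊓ W) x
        rw [h] at this; omega
      obtain ⟨v, hvT, hvS⟩ := exists_mem_not hlt
      obtain ⟨φ, hφ, hφS⟩ := Submodule.exists_le_ker_of_notMem hvS
      have hHT : T ⊓ LinearMap.ker φ < T :=
        lt_of_le_of_ne inf_le_left (fun h => hφ (by
          have : v ∈ T ⊓ LinearMap.ker φ := by rw [h]; exact hvT
          exact this.2))
      have hfr := finrank_le_inf_ker T φ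
      have hSH : (T ⊓ W) ⊔ F ∙ x ≤ T ⊓ LinearMap.ker φ := le_inf hlt.le hφS
      have hTWH : T ⊓ W ≤ T ⊓ LinearMap.ker φ := le_sup_left.trans hSH
      have hxH : x ∈ T ⊓ LinearMap.ker φ :=
        hSH (Submodule.mem_sup_right (Submodule.mem_span_singleton_self x))
      generalize T ⊓ LinearMap.ker φ = H at hHT hfr hSH hTWH hxH
      have hrH : r ∈ H := hTWH ⟨hrT, hrW⟩
      have hfl := Submodule.finrank_lt_finrank_of_lt hHT
      classical
      refine peel (fun v => decide (v ∈ H)) (OkT X T W p) (OkT X T W (p + 1)) p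
        (fun l hl => hl.2.2) ?_ ?_ ?_
      · rintro l ⟨h1, h2, h3⟩ t ht ht2
        exact ⟨fun x hx => h1 x (ht.subset hx), h2.sublist ht, by omega⟩
      · intro h g hhg hh hg w hw hw0
        obtain ⟨q, hqg, hqH⟩ := hg
        have hqH' : q ∉ H := by simpa using hqH
        have hgT : ∀ x ∈ g, x ∈ T := fun x hx => (hhg.1 x (List.mem_append_right _ hx)).2
        have hlen : h.length + g.length = p := by rw [← List.length_append]; exact hhg.2.2
        have hgInd := (Ind_append.1 hhg.2.1).2
        have hdim : finrank F ↥(H ⊓ Dt W g) + h.length + 1 ≤ finrank F H := by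
          have h1 : H ⊓ Dt W g < T ⊓ Dt W g := by
            refine lt_of_le_of_ne (inf_le_inf_right _ hHT.le) (fun heq => hqH' ?_)
            have : q ∈ H ⊓ Dt W g := by rw [heq]; exact ⟨hgT q hqg, mem_Dt hqg⟩
            exact this.1
          have h2 := Submodule.finrank_lt_finrank_of_lt h1
          rw [inf_Dt hgT] at h2
          have h3 := finrank_Dt_le (D := T ⊓ W) g
          omega
        obtain ⟨y, hy, hy2⟩ := ih (finrank F H) (by omega) H rfl (hHT.le.trans hT0) hrH
          ⟨x, hxX, hxH⟩ (Dt W g) (le_Dt _ _ hrW) h.length hdim w (by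
            refine Finsupp.supported_mono ?_ hw
            rintro h' ⟨a1, a2⟩
            refine ⟨fun x hx => ⟨(a2.1 x (List.mem_append_left _ hx)).1, by simpa using a1 x hx⟩,
              (Ind_append.1 a2.2.1).1, ?_⟩
            have := a2.2.2
            rw [List.length_append] at this
            omega) hw0
        refine ⟨y, Finsupp.supported_mono ?_ hy, hy2⟩
        rintro h' ⟨a1, a2, a3⟩
        refine ⟨fun x hx => by simpa using (a1 x hx).2, ?_, Ind_append.2 ⟨a2, hgInd⟩, ?_⟩
        · intro x hx
          rcases List.mem_append.1 hx with hx | hx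
          · exact ⟨(a1 x hx).1, hHT.le (a1 x hx).2⟩
          · exact hhg.1 x (List.mem_append_right _ hx)
        · rw [List.length_append]; omega
      · intro z hz hz0
        obtain ⟨b, hbX, hbT, hbH⟩ := hX T H hT0 hHT hrH ⟨x, hxX, hxH⟩
        refine ⟨pf k (List.cons b) z, pf_sp _ ?_ hz, by rw [del_cons, hz0, map_zero, sub_zero]⟩
        rintro l ⟨⟨a1, a2, a3⟩, a4⟩
        refine ⟨?_, ⟨fun hb => hbH ?_, a2⟩, by simp [a3]⟩
        · intro x hx
          rcases List.mem_cons.1 hx with rfl | hx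
          · exact ⟨hbX, hbT⟩
          · exact a1 x hx
        · have h1 : b ∈ T ⊓ Dt W l := ⟨hbT, hb⟩
          rw [inf_Dt (fun x hx => (a1 x hx).2)] at h1
          exact Dt_le hTWH (fun x hx => by simpa using a4 x hx) h1

end Acyc

end UEH

namespace UEH

section Gen

open Module

variable {F : Type} [Field F] {σ : F →+* F}
variable {V : Type} [AddCommGroup V] [Module F V]
variable {B : V →ₛₗ[σ] V →ₗ[F] F}

theorem Dt_congr (D : Submodule F V) {s t : List V} (h : ∀ x, x ∈ s ↔ x ∈ t) : Dt D s = Dt D t :=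
  le_antisymm (Dt_mono le_rfl (fun x hx => (h x).1 hx)) (Dt_mono le_rfl (fun x hx => (h x).2 hx))

theorem Dt_perm (D : Submodule F V) {s t : List V} (h : s.Perm t) : Dt D s = Dt D t :=
  Dt_congr D (fun x => h.mem_iff)

theorem Ind.perm [FiniteDimensional F V] {D : Submodule F V} {s t : List V} (h : s.Perm t)
    (hs : Ind D s) : Ind D t := by
  rw [Ind_iff_finrank] at hs ⊢
  rw [← Dt_perm D h, hs, h.length_eq]

theorem facet_perm {A : Type} {s t : List A} (h : s.Sublist t) (hl : s.length + 1 = t.length) :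
    ∃ v, (v :: s).Perm t := by
  induction h with
  | slnil => simp at hl
  | cons a h ih =>
    refine ⟨a, ?_⟩
    rw [h.eq_of_length (by simpa using hl)]
  | cons_cons a h ih =>
    obtain ⟨v, hv⟩ := ih (by simpa using hl)
    exact ⟨v, (List.Perm.swap _ _ _).trans (hv.cons a)⟩

theorem perm_mem {A : Type} {v : A} {s t : List A} (h : (v :: s).Perm t) : v ∈ t :=
  h.subset List.mem_cons_self

theorem Ind.notMem [FiniteDimensional F V] {D : Submodule F V} {t : List V} (h : Ind D t)
    {v : V} {s : List V} (hp : (v :: s).Perm t) : v ∉ Dt D s := (h.perm hp.symm).1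

theorem Ind.functional {D : Submodule F V} {L : List V} (h : Ind D L) (val : V → F) :
    ∃ φ : V →ₗ[F] F, (∀ d ∈ D, φ d = 0) ∧ ∀ x ∈ L, φ x = val x := by
  induction L with
  | nil => exact ⟨0, fun _ _ => rfl, by simp⟩
  | cons x L ih =>
    obtain ⟨φ, h1, h2⟩ := ih h.2
    obtain ⟨ψ, hψ, hψD⟩ := Submodule.exists_le_ker_of_notMem h.1
    have hz : ∀ y ∈ Dt D L, ψ y = 0 := fun y hy => hψD hy
    refine ⟨φ + ((val x - φ x) / ψ x) • ψ, ?_, ?_⟩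
    · intro d hd
      simp [h1 d hd, hz d (le_Dt _ _ hd)]
    · intro y hy
      rcases List.mem_cons.1 hy with rfl | hy
      · simp [hψ]
      · simp [h2 y hy, hz y (mem_Dt hy)]

theorem Ind_of_functional {D : Submodule F V} {A : Type} {L : List A} (hL : L.Nodup) (n : A → V)
    (ψ : A → V →ₗ[F] F) (h0 : ∀ a ∈ L, ∀ d ∈ D, ψ a d = 0)
    (h1 : ∀ a ∈ L, ∀ b ∈ L, a ≠ b → ψ a (n b) = 0) (h2 : ∀ a ∈ L, ψ a (n a) ≠ 0) :
    Ind D (L.map n) := by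
  induction L with
  | nil => trivial
  | cons a L ih =>
    rw [List.nodup_cons] at hL
    refine ⟨fun hm => ?_, ih hL.2 (fun x hx => h0 x (List.mem_cons_of_mem _ hx))
      (fun x hx y hy => h1 x (List.mem_cons_of_mem _ hx) y (List.mem_cons_of_mem _ hy))
      (fun x hx => h2 x (List.mem_cons_of_mem _ hx))⟩
    have : Dt D (L.map n) ≤ LinearMap.ker (ψ a) := by
      refine Dt_le (fun d hd => h0 a List.mem_cons_self d hd) ?_
      intro x hx
      obtain ⟨b, hb, rfl⟩ := List.mem_map.1 hx
      exact h1 a List.mem_cons_self b (List.mem_cons_of_mem _ hb) (fun hab => hL.1 (hab ▸ hb))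
    exact h2 a List.mem_cons_self (this hm)

theorem Ind.nodup {D : Submodule F V} {t : List V} (h : Ind D t) : t.Nodup := by
  induction t with
  | nil => exact List.nodup_nil
  | cons x t ih => exact List.nodup_cons.2 ⟨fun hx => h.1 (mem_Dt hx), ih h.2⟩

/-- realize a functional by an isotropic vector -/
theorem Herm.real (hB : Herm B) (hn : Nondeg B) [FiniteDimensional F V] {M : Submodule F V}
    {y : V} (hy : y ∈ rad B M) (f : V →ₗ[F] F) (hf : f y ≠ 0) :
    ∃ u, (∀ m ∈ M, B u m = f m) ∧ B u u = 0 := by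
  obtain ⟨u, hu⟩ := hB.rep_top hn f
  obtain ⟨s, hs⟩ := hB.hf.trace_surj (- B u u) (by rw [map_neg, hB.fix])
  have hy' : ∀ m ∈ M, B y m = 0 := fun m hm => hB.zero_comm (hy.2 m hm)
  refine ⟨u + (s / f y) • y, fun m hm => ?_, ?_⟩
  · rw [addB, smulB, hy' m hm, mul_zero, add_zero, hu]
  · have h1 : B y u = σ (f y) := by rw [hB.symm u y, hu]
    have h3 : σ (f y) ≠ 0 := fun h => hf (by rwa [map_eq_zero] at h)
    simp only [map_add, LinearMap.add_apply, smulB, Bsmul, hy' y hy.1, h1, hu y, map_div₀]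
    rw [div_mul_cancel₀ _ hf, div_mul_cancel₀ _ h3]
    linear_combination hs

/-- avoiding a few subsets -/
theorem avoid {A : Type} [Finite A] [Nonempty A] {ι : Type} (S : List ι) (L : ι → Set A) (N : ℕ)
    (hc : ∀ i ∈ S, (L i).ncard * N ≤ Nat.card A) (hS : S.length < N) :
    ∃ a : A, ∀ i ∈ S, a ∉ L i := by
  classical
  by_contra hcon
  push Not at hcon
  have h1 : ∀ S' : List ι, (∀ i ∈ S', i ∈ S) →
      Set.ncard {a : A | ∃ i ∈ S', a ∈ L i} * N ≤ S'.length * Nat.card A := by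
    intro S'
    induction S' with
    | nil => intro _; simp
    | cons i S' ih =>
      intro hh
      have e1 : {a : A | ∃ j ∈ i :: S', a ∈ L j} = L i ∪ {a : A | ∃ j ∈ S', a ∈ L j} := by
        ext a; simp
      have e3 := ih (fun j hj => hh j (List.mem_cons_of_mem _ hj))
      have e4 := Set.ncard_union_le (L i) {a : A | ∃ j ∈ S', a ∈ L j}
      have e5 := hc i (hh i List.mem_cons_self)
      rw [e1, List.length_cons]
      calc _ ≤ ((L i).ncard + {a : A | ∃ j ∈ S', a ∈ L j}.ncard) * N :=
            Nat.mul_le_mul_right _ e4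
        _ ≤ _ := by rw [add_mul, add_mul, one_mul]; omega
  have h2 := h1 S (fun _ h => h)
  have h3 : {a : A | ∃ i ∈ S, a ∈ L i} = Set.univ := by
    ext a; simpa using hcon a
  rw [h3, Set.ncard_univ, mul_comm] at h2
  have h4 : 0 < Nat.card A := Nat.card_pos
  have := Nat.le_of_mul_le_mul_right h2 h4
  omega

theorem gen_count (P e Q : ℕ) (he : 2 ≤ e) (hP : P ≤ e + 2) (hQ : 9 ≤ Q) : P + 1 < Q ^ (e - 1) := by
  have h1 : 9 ^ (e - 1) ≤ Q ^ (e - 1) := Nat.pow_le_pow_left hQ _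
  obtain ⟨m, rfl⟩ : ∃ m, e = m + 2 := ⟨e - 2, by omega⟩
  have h2 : ∀ m : ℕ, m + 5 < 9 ^ (m + 1) := by
    intro m
    induction m with
    | zero => norm_num
    | succ m ih => rw [pow_succ]; omega
  have := h2 m
  simp only [Nat.add_sub_cancel, show m + 2 - 1 = m + 1 by omega] at *
  omega

theorem finrank_facet [FiniteDimensional F V] {D Y : Submodule F V} {v : V} {s t : List V}
    (hp : (v :: s).Perm t) (hY : Y ≤ Dt D t) :
    finrank F Y ≤ finrank F ↥(Y ⊓ Dt D s) + 1 := by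
  have h1 := Submodule.finrank_sup_add_finrank_inf_eq Y (Dt D s)
  have h2 := finrank_sup_span_le (Dt D s) v
  rw [← Dt_cons, Dt_perm D hp] at h2
  have h3 : Y ⊔ Dt D s ≤ Dt D t := sup_le hY (Dt_mono le_rfl (fun x hx =>
    hp.subset (List.mem_cons_of_mem _ hx)))
  have h4 := Submodule.finrank_mono h3
  omega

theorem rad_Dt_inf (hB : Herm B) [FiniteDimensional F V] {D : Submodule F V} {r x0 : V}
    (hr : r ∈ rad B D) (hrx : B r x0 = 1) {t : List V} (ht0 : t ≠ [])
    (hX : ∀ v ∈ t, ∀ d ∈ D, B d v = B d x0) :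
    finrank F ↥(rad B (Dt D t) ⊓ D) + 1 ≤ finrank F (rad B D) := by
  obtain ⟨v, hv⟩ := List.exists_mem_of_ne_nil t ht0
  have : rad B (Dt D t) ⊓ D < rad B D := by
    refine lt_of_le_of_ne ?_ ?_
    · rintro x ⟨h1, h2⟩
      exact ⟨h2, perp_anti (le_Dt D t) h1.2⟩
    · intro h
      rw [← h] at hr
      have h1 := hr.1.2 v (mem_Dt hv)
      have h2 := hX v hv r hr.2
      rw [hB.zero_comm h1, hrx] at h2
      exact zero_ne_one h2
  have := Submodule.finrank_lt_finrank_of_lt this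
  omega

theorem fr_ann [FiniteDimensional F V] (D : Submodule F V) : finrank F D + finrank F D.dualAnnihilator = finrank F V :=
    Subspace.finrank_add_finrank_dualAnnihilator_eq D
theorem card_sub [FiniteDimensional F V] [Finite F] (D : Submodule F (Dual F V)) :
    Nat.card D = Nat.card F ^ finrank F D := Module.natCard_eq_pow_finrank (K := F) (V := D)

theorem avoid_dim [FiniteDimensional F V] [Finite F] (D Y W : Submodule F V) (e : ℕ)
    (he : finrank F ↥(Y ⊓ D) + e ≤ finrank F Y) (he1 : 1 ≤ e) (hDW : D ≤ W)
    (h1 : finrank F Y ≤ finrank F ↥(Y ⊓ W) + 1) :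
    Nat.card (D ⊔ (Y ⊓ W)).dualAnnihilator * Nat.card F ^ (e - 1) ≤ Nat.card D.dualAnnihilator := by
  have h4 := fr_ann (D ⊔ (Y ⊓ W))
  have h5 := fr_ann D
  have h6 := Submodule.finrank_sup_add_finrank_inf_eq D (Y ⊓ W)
  have h7 : D ⊓ (Y ⊓ W) = Y ⊓ D := by
    apply le_antisymm
    · exact fun x hx => ⟨hx.2.1, hx.1⟩
    · exact fun x hx => ⟨hx.2, hx.1, hDW hx.2⟩
  rw [h7] at h6
  rw [card_sub, card_sub, ← pow_add]
  exact Nat.pow_le_pow_right Nat.card_pos (by omega)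

theorem avoid_dual [FiniteDimensional F V] [Finite F] (D Y : Submodule F V) (S : List (List V))
    (e : ℕ) (he : finrank F ↥(Y ⊓ D) + e ≤ finrank F Y) (he1 : 1 ≤ e)
    (hS : ∀ s ∈ S, finrank F Y ≤ finrank F ↥(Y ⊓ Dt D s) + 1) (hlen : S.length < Nat.card F ^ (e - 1)) :
    ∃ a : V →ₗ[F] F, (∀ d ∈ D, a d = 0) ∧ ∀ s ∈ S, ∃ y ∈ Y, y ∈ Dt D s ∧ a y ≠ 0 := by
  haveI : Finite (Dual F V) := Module.finite_of_finite F
  haveI : Finite D.dualAnnihilator := Subtype.finite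
  obtain ⟨a, ha⟩ := avoid (A := ↥D.dualAnnihilator) S
    (fun s => {a | a.1 ∈ (D ⊔ (Y ⊓ Dt D s)).dualAnnihilator})
    (Nat.card F ^ (e - 1)) (fun s hs => by
      refine le_trans (Nat.mul_le_mul_right _ ?_)
        (avoid_dim D Y (Dt D s) e he he1 (le_Dt _ _) (hS s hs))
      rw [← Nat.card_coe_set_eq]
      exact Nat.card_le_card_of_injective
        (fun a : {a : ↥D.dualAnnihilator | a.1 ∈ (D ⊔ (Y ⊓ Dt D s)).dualAnnihilator} =>
          (⟨a.1.1, a.2⟩ : ↥(D ⊔ (Y ⊓ Dt D s)).dualAnnihilator))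
        (fun a b h => Subtype.ext (Subtype.ext (congrArg (fun z => z.1) h)))) hlen
  have haD : ∀ d ∈ D, a.1 d = 0 := fun d hd => (Submodule.mem_dualAnnihilator _).1 a.2 d hd
  refine ⟨a.1, haD, ?_⟩
  intro s hs
  by_contra hcon
  push Not at hcon
  apply ha s hs
  show a.1 ∈ (D ⊔ (Y ⊓ Dt D s)).dualAnnihilator
  rw [Submodule.mem_dualAnnihilator]
  intro w hw
  obtain ⟨d, hd, y, hy, rfl⟩ := Submodule.mem_sup.1 hw
  rw [map_add, haD d hd, hcon y hy.1 hy.2, add_zero]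

theorem Gen1 (hB : Herm B) (hn : Nondeg B) [FiniteDimensional F V] [Finite F]
    (hQ : 9 ≤ Nat.card F) {D : Submodule F V} {x0 : V} {t : List V}
    (ht : Ind D t) (hX : ∀ v ∈ t, ∀ d ∈ D, B d v = B d x0) (P : ℕ) (hlen : t.length = P + 1)
    (he : finrank F ↥(rad B (Dt D t) ⊓ D) + 2 ≤ finrank F (rad B (Dt D t)))
    (he2 : finrank F ↥(rad B (Dt D t) ⊓ D) + P ≤ finrank F (rad B (Dt D t)) + 2) :
    ∃ u, (∀ d ∈ D, B d u = B d x0) ∧ B u u = 0 ∧ (∃ y ∈ rad B (Dt D t), B y u ≠ 0) ∧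
      ∀ v s, (v :: s).Perm t → kap B (Dt D (u :: s)) ≤ kap B (Dt D s) := by
  obtain ⟨Y, hYdef⟩ : ∃ Y, Y = rad B (Dt D t) := ⟨_, rfl⟩
  rw [← hYdef] at he he2 ⊢
  have hYt : ∀ y ∈ Y, y ∈ Dt D t ∧ ∀ m ∈ Dt D t, B m y = 0 := by
    intro y hy; rw [hYdef] at hy; exact hy
  obtain ⟨S, hSdef⟩ : ∃ S, S = t.sublistsLen P := ⟨_, rfl⟩
  have hS : ∀ s ∈ S, ∃ v, (v :: s).Perm t := by
    intro s hs
    rw [hSdef] at hs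
    obtain ⟨h1, h2⟩ := List.mem_sublistsLen.1 hs
    exact facet_perm h1 (by omega)
  obtain ⟨a, haD, hfac⟩ := avoid_dual D Y S (finrank F Y - finrank F ↥(Y ⊓ D)) (by omega) (by omega)
    (fun s hs => by
      obtain ⟨v, hv⟩ := hS s hs
      exact finrank_facet hv (fun y hy => (hYt y hy).1))
    (by
      have : S.length = P + 1 := by
        rw [hSdef, List.length_sublistsLen, hlen, Nat.choose_succ_self_right]
      rw [this]
      exact gen_count P _ _ (by omega) (by omega) hQ)
  have ht0 : t ≠ [] := by rintro rfl; simp at hlen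
  obtain ⟨v0, hv0⟩ := List.exists_mem_of_ne_nil t ht0
  obtain ⟨f, hfdef⟩ : ∃ f : V →ₗ[F] F, ∀ x, f x = B v0 x + a x := ⟨B v0 + a, fun _ => rfl⟩
  have hfY : ∀ y ∈ Y, f y = a y := by
    intro y hy
    rw [hfdef, (hYt y hy).2 v0 (mem_Dt hv0), zero_add]
  -- some facet
  have hS0 : t.tail ∈ S := hSdef ▸ List.mem_sublistsLen.2 ⟨List.tail_sublist t, by simp [hlen]⟩
  obtain ⟨y0, hy0, _, hay0⟩ := hfac _ hS0
  obtain ⟨u, hu, huu⟩ := hB.real hn (hYdef ▸ hy0) f (by rw [hfY y0 hy0]; exact hay0)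
  have hyu : ∀ y ∈ Y, a y ≠ 0 → B y u ≠ 0 := by
    intro y hy h h2
    have := hB.zero_comm h2
    rw [hu y (hYt y hy).1, hfY y hy] at this
    exact h this
  refine ⟨u, ?_, huu, ⟨y0, hy0, hyu y0 hy0 hay0⟩, ?_⟩
  · intro d hd
    rw [hB.symm u d, hu d (le_Dt D t hd)]
    rw [hfdef, haD d hd, add_zero, ← hB.symm, hX v0 hv0 d hd]
  · intro v s hp
    have hs : ∃ s' ∈ S, Dt D s' = Dt D s := by
      have hv := perm_mem hp
      classical
      have h1 : (v :: t.erase v).Perm t := (List.perm_cons_erase hv).symm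
      refine ⟨t.erase v, hSdef ▸ List.mem_sublistsLen.2 ⟨List.erase_sublist, ?_⟩, ?_⟩
      · have := h1.length_eq; simp at this; omega
      · exact Dt_perm D ((h1.trans hp.symm).cons_inv)
    obtain ⟨s', hs', hss⟩ := hs
    obtain ⟨y, hy, hys, hay⟩ := hfac s' hs'
    rw [hss] at hys
    rw [Dt_cons]
    refine (hB.kap_pair (r := y) ⟨hys, ?_⟩ (hyu y hy hay)).le
    have hle : Dt D s ≤ Dt D t := Dt_mono le_rfl (fun x hx => hp.subset (List.mem_cons_of_mem _ hx))
    exact perp_anti hle (hYt y hy).2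

end Gen

end UEH

namespace UEH

section Gen2

open Module

variable {F : Type} [Field F] {σ : F →+* F}
variable {V : Type} [AddCommGroup V] [Module F V]
variable {B : V →ₛₗ[σ] V →ₗ[F] F}

theorem exists_functional {D : Submodule F V} {y : V} (hy : y ∉ D) (c : F) :
    ∃ h : V →ₗ[F] F, (∀ d ∈ D, h d = 0) ∧ h y = c := by
  have : Ind D [y] := ⟨by simpa [Dt_nil] using hy, trivial⟩
  obtain ⟨h, h1, h2⟩ := this.functional (fun _ => c)
  exact ⟨h, h1, h2 y (by simp)⟩

/-- the coordinate functional characterizes the facet -/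
theorem coord_mem {D : Submodule F V} {v : V} {s t : List V}
    (hp : (v :: s).Perm t) (c : V →ₗ[F] F) (hc : ∀ d ∈ Dt D s, c d = 0) (hv : c v = 1) {y : V}
    (hy : y ∈ Dt D t) (h0 : c y = 0) : y ∈ Dt D s := by
  rw [← Dt_perm D hp, Dt_cons] at hy
  obtain ⟨d, hd, a, rfl⟩ := mem_sup_span.1 hy
  rw [map_add, hc d hd, map_smul, hv, zero_add, smul_eq_mul, mul_one] at h0
  rw [h0, zero_smul, add_zero]; exact hd

/-- radical of a facet missing `y` -/
theorem rad_facet (hB : Herm B) [FiniteDimensional F V] {D : Submodule F V}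
    {v y : V} {s t : List V} (hp : (v :: s).Perm t) (hy : y ∈ rad B (Dt D t)) (hys : y ∉ Dt D s)
    (hY : ∀ x ∈ rad B (Dt D t), ∃ d ∈ D, ∃ c : F, x = d + c • y) :
    rad B (Dt D s) ≤ rad B (Dt D t) ⊓ D := by
  have hle : Dt D s ≤ Dt D t := Dt_mono le_rfl (fun x hx => hp.subset (List.mem_cons_of_mem _ hx))
  have hM : Dt D t = Dt D s ⊔ F ∙ y := by
    refine (Submodule.eq_of_le_of_finrank_le (sup_le hle ?_) ?_).symm
    · exact (Submodule.span_singleton_le_iff_mem _ _).2 hy.1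
    · rw [finrank_sup_span hys, ← Dt_perm D hp, Dt_cons]
      exact finrank_sup_span_le _ _
  rintro x ⟨hx1, hx2⟩
  have hx : x ∈ rad B (Dt D t) := by
    refine ⟨hle hx1, ?_⟩
    intro m hm
    rw [hM] at hm
    obtain ⟨d, hd, c, rfl⟩ := mem_sup_span.1 hm
    rw [addB, smulB, hx2 d hd, hB.zero_comm (hy.2 x (hle hx1)), mul_zero, add_zero]
  refine ⟨hx, ?_⟩
  obtain ⟨d, hd, c, rfl⟩ := hY x hx
  by_cases hc : c = 0
  · rw [hc, zero_smul, add_zero]; exact hd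
  · exfalso
    apply hys
    have : c • y ∈ Dt D s := by
      have := (Dt D s).sub_mem hx1 (le_Dt D s hd)
      simpa using this
    simpa [smul_smul, inv_mul_cancel₀ hc] using (Dt D s).smul_mem c⁻¹ this

theorem Gen2 (hB : Herm B) (hn : Nondeg B) [FiniteDimensional F V]
    {D : Submodule F V} {x0 r : V} {t : List V} (hr : r ∈ rad B D) (hrx : B r x0 = 1)
    (ht : Ind D t) (hX : ∀ v ∈ t, ∀ d ∈ D, B d v = B d x0) (P : ℕ) (hlen : t.length = P + 1)
    (he : finrank F (rad B (Dt D t)) = finrank F ↥(rad B (Dt D t) ⊓ D) + 1) :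
    ∃ u, (∀ d ∈ D, B d u = B d x0) ∧ B u u = 0 ∧ (∃ y ∈ rad B (Dt D t), B y u ≠ 0) ∧
      ∀ v s, (v :: s).Perm t → kap B (Dt D (u :: s)) ≤ kap B (Dt D s) ∨
        kap B (Dt D (u :: s)) ≤ kap B D + P := by
  classical
  have ht0 : t ≠ [] := by rintro rfl; simp at hlen
  obtain ⟨v0, hv0⟩ := List.exists_mem_of_ne_nil t ht0
  have hlt : rad B (Dt D t) ⊓ D < rad B (Dt D t) := by
    refine lt_of_le_of_ne inf_le_left (fun h => ?_)
    rw [h] at he; omega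
  obtain ⟨y, hy, hy'⟩ := exists_mem_not hlt
  have hyD : y ∉ D := fun h => hy' ⟨hy, h⟩
  have hY : ∀ x ∈ rad B (Dt D t), ∃ d ∈ D, ∃ c : F, x = d + c • y := by
    intro x hx
    have : (rad B (Dt D t) ⊓ D) ⊔ F ∙ y = rad B (Dt D t) := by
      refine Submodule.eq_of_le_of_finrank_le (sup_le inf_le_left ?_) ?_
      · exact (Submodule.span_singleton_le_iff_mem _ _).2 hy
      · rw [finrank_sup_span hy', he]
    rw [← this] at hx
    obtain ⟨d, hd, c, h⟩ := mem_sup_span.1 hx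
    exact ⟨d, hd.2, c, h⟩
  have hYM : ∀ m ∈ Dt D t, B y m = 0 := fun m hm => hB.zero_comm (hy.2 m hm)
  have hDM := le_Dt D t
  -- final assembly from a functional
  have fin : ∀ f : V →ₗ[F] F, (∀ d ∈ D, f d = B x0 d) → f y = 1 →
      (∀ v s, (v :: s).Perm t → y ∉ Dt D s → ∃ p ∈ Dt D s, (∀ d ∈ Dt D s, B p d = f d) ∧ B p p ≠ 0) →
      ∃ u, (∀ d ∈ D, B d u = B d x0) ∧ B u u = 0 ∧ (∃ y ∈ rad B (Dt D t), B y u ≠ 0) ∧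
      ∀ v s, (v :: s).Perm t → kap B (Dt D (u :: s)) ≤ kap B (Dt D s) ∨
        kap B (Dt D (u :: s)) ≤ kap B D + P := by
    intro f hfD hfy hfac
    obtain ⟨u, hu, huu⟩ := hB.real hn hy f (by rw [hfy]; exact one_ne_zero)
    have hyu : B y u ≠ 0 := by
      intro h
      have := hB.zero_comm h
      rw [hu y hy.1, hfy] at this
      exact one_ne_zero this
    refine ⟨u, ?_, huu, ⟨y, hy, hyu⟩, ?_⟩
    · intro d hd
      rw [hB.symm u d, hu d (hDM hd), hfD d hd, ← hB.symm]
    · intro v s hp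
      have hle : Dt D s ≤ Dt D t :=
        Dt_mono le_rfl (fun x hx => hp.subset (List.mem_cons_of_mem _ hx))
      rw [Dt_cons]
      by_cases hys : y ∈ Dt D s
      · left
        exact (hB.kap_pair (r := y) ⟨hys, perp_anti hle hy.2⟩ hyu).le
      · right
        obtain ⟨p, hp1, hp2, hp3⟩ := hfac v s hp hys
        have h1 := hB.kap_L3 (v := u) hp1 (fun d hd => by rw [hp2 d hd, hu d (hle hd)])
          (by rw [huu]; exact hp3.symm)
        have h2 := Submodule.finrank_mono (rad_facet hB hp hy hys hY)
        have h3 := rad_Dt_inf hB hr hrx ht0 hX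
        have h4 := (ht.perm hp.symm).2.finrank
        have h5 := hp.length_eq
        rw [List.length_cons] at h5
        unfold kap at *
        omega
  -- coordinate functionals
  have hcex : ∀ v, ∃ c : V →ₗ[F] F, (∀ d ∈ D, c d = 0) ∧ ∀ x ∈ t, c x = if x = v then 1 else 0 :=
    fun v => ht.functional (fun x => if x = v then 1 else 0)
  choose c hcD hct using hcex
  have hcs : ∀ v s, (v :: s).Perm t → ∀ d ∈ Dt D s, c v d = 0 := by
    intro v s hp
    have hvs : v ∉ s := (List.nodup_cons.1 ((ht.perm hp.symm).nodup)).1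
    have : Dt D s ≤ LinearMap.ker (c v) := by
      refine Dt_le (fun d hd => hcD v d hd) (fun x hx => ?_)
      rw [LinearMap.mem_ker, hct v x (hp.subset (List.mem_cons_of_mem _ hx)), if_neg]
      rintro rfl; exact hvs hx
    exact fun d hd => this hd
  have hcv : ∀ v ∈ t, c v v = 1 := fun v hv => by rw [hct v v hv, if_pos rfl]
  have hcy : ∀ v s, (v :: s).Perm t → y ∉ Dt D s → c v y ≠ 0 := fun v s hp h h0 =>
    h (coord_mem hp (c v) (hcs v s hp) (hcv v (perm_mem hp)) hy.1 h0)
  by_cases hI : ∀ v ∈ t, c v y = 0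
  · obtain ⟨h, h1, h2⟩ := exists_functional hyD (1 - B x0 y)
    refine fin (B x0 + h) ?_ ?_ ?_
    · intro d hd; rw [LinearMap.add_apply, h1 d hd, add_zero]
    · rw [LinearMap.add_apply, h2]; ring
    · intro v s hp hys
      exact absurd (hI v (perm_mem hp)) (hcy v s hp hys)
  push Not at hI
  obtain ⟨i0, hi0, hi0y⟩ := hI
  have hp0 : (i0 :: t.erase i0).Perm t := (List.perm_cons_erase hi0).symm
  obtain ⟨s0, hp0⟩ : ∃ s0, (i0 :: s0).Perm t := ⟨_, hp0⟩
  have hs0t : Dt D s0 ≤ Dt D t :=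
    Dt_mono le_rfl (fun x hx => hp0.subset (List.mem_cons_of_mem _ hx))
  have hDs0 := le_Dt D s0
  have hys0 : y ∉ Dt D s0 := fun h => hi0y (hcs i0 s0 hp0 y h)
  have hrad0 := rad_facet hB hp0 hy hys0 hY
  -- n_v
  have hnex : ∀ v, ∃ p ∈ Dt D s0, ∀ d ∈ Dt D s0, B p d = (c v y)⁻¹ * c v d := by
    intro v
    obtain ⟨p, hp, h⟩ := hB.rep (Dt D s0) ((c v y)⁻¹ • c v) (by
      intro x hx
      rw [LinearMap.smul_apply, hcD v x (hrad0 hx).2, smul_zero])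
    exact ⟨p, hp, fun d hd => by rw [h d hd]; rfl⟩
  choose nn hn1 hn2 using hnex
  obtain ⟨kl, hklt, hkl⟩ : ∃ kl ∈ t, c kl y ≠ 0 ∧ (kl ≠ i0 ∨ ∀ v ∈ t, c v y ≠ 0 → v = i0) := by
    by_cases h : ∃ v ∈ t, c v y ≠ 0 ∧ v ≠ i0
    · obtain ⟨v, h1, h2, h3⟩ := h
      exact ⟨v, h1, h2, Or.inl h3⟩
    · push Not at h
      exact ⟨i0, hi0, hi0y, Or.inr h⟩
  have hms0 : ∀ v ∈ t, v ≠ i0 → v ∈ Dt D s0 := by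
    intro v hv hne
    have := hp0.symm.subset hv
    rcases List.mem_cons.1 this with h | h
    · exact absurd h hne
    · exact mem_Dt h
  obtain ⟨I, hIdef⟩ : ∃ I, I = t.filter (fun v => c v y ≠ 0 ∧ v ≠ i0 ∧ v ≠ kl) := ⟨_, rfl⟩
  have hImem : ∀ v, v ∈ I ↔ v ∈ t ∧ c v y ≠ 0 ∧ v ≠ i0 ∧ v ≠ kl := by
    intro v; rw [hIdef, List.mem_filter]; simp
  have hInd : Ind D (I.map nn) := by
    refine Ind_of_functional (hIdef ▸ ht.nodup.filter _) nn (fun v => B (v - kl)) ?_ ?_ ?_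
    · intro a ha d hd
      obtain ⟨h1, _⟩ := (hImem a).1 ha
      rw [subB, hB.symm d a, hB.symm d kl, hX a h1 d hd, hX kl hklt d hd, sub_self]
    · intro a ha b hb hab
      obtain ⟨h1, h2, h3, h4⟩ := (hImem a).1 ha
      obtain ⟨g1, g2, g3, g4⟩ := (hImem b).1 hb
      have hk : kl ≠ i0 := hkl.2.resolve_right (fun h => h3 (h a h1 h2))
      have hm : a - kl ∈ Dt D s0 := Submodule.sub_mem _ (hms0 a h1 h3) (hms0 kl hklt hk)
      show B (a - kl) (nn b) = 0
      rw [hB.symm (nn b), hn2 b _ hm, map_sub, hct b a h1, hct b kl hklt, if_neg hab,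
        if_neg (Ne.symm g4), sub_self, mul_zero, map_zero]
    · intro a ha
      obtain ⟨h1, h2, h3, h4⟩ := (hImem a).1 ha
      have hk : kl ≠ i0 := hkl.2.resolve_right (fun h => h3 (h a h1 h2))
      have hm : a - kl ∈ Dt D s0 := Submodule.sub_mem _ (hms0 a h1 h3) (hms0 kl hklt hk)
      show B (a - kl) (nn a) ≠ 0
      rw [hB.symm (nn a), hn2 a _ hm, map_sub, hct a a h1, hct a kl hklt, if_pos rfl,
        if_neg (Ne.symm h4), sub_zero, mul_one]
      rw [Ne, map_eq_zero]
      exact inv_ne_zero h2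
  have hInd2 : Ind D (y :: I.map nn) := by
    refine ⟨fun h => hys0 ?_, hInd⟩
    have : Dt D (I.map nn) ≤ Dt D s0 := by
      refine Dt_le hDs0 (fun x hx => ?_)
      obtain ⟨b, hb, rfl⟩ := List.mem_map.1 hx
      exact hn1 b
    exact this h
  have htr : ∀ z : V, ∃ x : F, x + σ x = B z z := fun z => hB.hf.trace_surj _ (hB.fix z)
  choose xx hxx using htr
  obtain ⟨h, hhD, hh⟩ := hInd2.functional (fun z => (if z = y then 1 else xx z) - B x0 z)
  obtain ⟨f, hf⟩ : ∃ f : V →ₗ[F] F, ∀ z, f z = B x0 z + h z := ⟨B x0 + h, fun _ => rfl⟩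
  have hfD : ∀ d ∈ D, f d = B x0 d := fun d hd => by rw [hf, hhD d hd, add_zero]
  have hfy : f y = 1 := by
    rw [hf, hh y List.mem_cons_self, if_pos rfl]; ring
  have hfr : f r = 1 := by rw [hfD r hr.1, hB.symm r, hrx, map_one]
  have hfI : ∀ v ∈ I, f (nn v) + σ (f (nn v)) = B (nn v) (nn v) := by
    intro v hv
    have hne : nn v ≠ y := fun h => hys0 (h ▸ hn1 v)
    rw [← hxx, hf, hh (nn v) (List.mem_cons_of_mem _ (List.mem_map_of_mem hv)), if_neg hne]
    simp
  have hfi0 : f (nn i0) + σ (f (nn i0)) = B (nn i0) (nn i0) := by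
    have h0 : ∀ d ∈ Dt D s0, B (nn i0) d = 0 := fun d hd => by
      rw [hn2 i0 d hd, hcs i0 s0 hp0 d hd, mul_zero]
    have h1 : nn i0 ∈ rad B (Dt D s0) := ⟨hn1 i0, fun d hd => hB.zero_comm (h0 d hd)⟩
    have h2 := hrad0 h1
    have h3 : f (nn i0) = 0 := by
      rw [hfD _ h2.2]
      apply hB.zero_comm
      rw [← hX v0 hv0 _ h2.2]
      exact hB.zero_comm (h2.1.2 v0 (mem_Dt hv0))
    rw [h3, h0 _ (hn1 i0), map_zero, add_zero]
  have hfrad : ∀ z ∈ rad B (Dt D s0), f z = 0 := by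
    intro z hz
    have h2 := hrad0 hz
    rw [hfD _ h2.2]
    apply hB.zero_comm
    rw [← hX v0 hv0 _ h2.2]
    exact hB.zero_comm (h2.1.2 v0 (mem_Dt hv0))
  obtain ⟨p, hp1, hp2⟩ := hB.rep (Dt D s0) f hfrad
  obtain ⟨cc, hcc, hc1, hc2⟩ := hB.hf.three (- B p p)
    (- B p p - (B (nn kl) (nn kl) - (f (nn kl) + σ (f (nn kl)))))
  obtain ⟨β, hβ⟩ := hB.hf.trace_surj cc hcc
  have hrM : ∀ m ∈ D, B r m = 0 := fun m hm => hB.zero_comm (hr.2 m hm)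
  have hry : B r y = 0 := hy.2 r (hDM hr.1)
  refine fin (f + B (β • r)) ?_ ?_ ?_
  · intro d hd
    rw [LinearMap.add_apply, smulB, hrM d hd, mul_zero, add_zero, hfD d hd]
  · rw [LinearMap.add_apply, smulB, hry, mul_zero, add_zero, hfy]
  · intro v s hp hys
    have hvt := perm_mem hp
    have hα := hcy v s hp hys
    have hrs0 : r ∈ Dt D s0 := hDs0 hr.1
    have hnr : B (nn v) r = 0 := by rw [hn2 v r hrs0, hcD v r hr.1, mul_zero]
    obtain ⟨q, hq⟩ : ∃ q, q = p + β • r - nn v := ⟨_, rfl⟩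
    have hqs0 : q ∈ Dt D s0 := by
      rw [hq]
      exact Submodule.sub_mem _ (Submodule.add_mem _ hp1 (Submodule.smul_mem _ _ hrs0)) (hn1 v)
    have hqd : ∀ d ∈ Dt D s0, B q d = f d + σ β * B r d - (c v y)⁻¹ * c v d := by
      intro d hd
      rw [hq, subB, addB, smulB, hp2 d hd, hn2 v d hd]
    have hqM := hs0t hqs0
    refine ⟨q + (- (c v q) / c v y) • y, ?_, ?_, ?_⟩
    · refine coord_mem hp (c v) (hcs v s hp) (hcv v hvt)
        (Submodule.add_mem _ hqM (Submodule.smul_mem _ _ hy.1)) ?_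
      rw [map_add, map_smul, smul_eq_mul]
      field_simp
      ring
    · intro w hw
      have hwt : w ∈ Dt D t :=
        (Dt_mono le_rfl (fun x hx => hp.subset (List.mem_cons_of_mem _ hx)) : Dt D s ≤ Dt D t) hw
      obtain ⟨lam, hlam⟩ : ∃ lam, lam = c i0 w / c i0 y := ⟨_, rfl⟩
      obtain ⟨w0, hw0⟩ : ∃ w0, w0 = w - lam • y := ⟨_, rfl⟩
      have hw0s : w0 ∈ Dt D s0 := by
        refine coord_mem hp0 (c i0) (hcs i0 s0 hp0) (hcv i0 hi0) ?_ ?_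
        · rw [hw0]; exact Submodule.sub_mem _ hwt (Submodule.smul_mem _ _ hy.1)
        · rw [hw0, map_sub, map_smul, smul_eq_mul, hlam, div_mul_cancel₀ _ hi0y, sub_self]
      have hww : w = w0 + lam • y := by rw [hw0]; abel
      have hcw : c v w0 = - (lam * c v y) := by
        rw [hw0, map_sub, hcs v s hp w hw, map_smul, smul_eq_mul, zero_sub]
      have h1 : B q y = 0 := hy.2 q hqM
      have h3 : f w = f w0 + lam := by rw [hww, map_add, map_smul, hfy, smul_eq_mul, mul_one]
      have h4 : B (β • r) w = σ β * B r w0 := by rw [smulB, hww, map_add, Bsmul, hry]; ring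
      have h5 : B q w = B q w0 := by rw [hww, map_add, Bsmul, h1, mul_zero, add_zero]
      rw [addB, smulB, hYM w hwt, mul_zero, add_zero, h5, hqd w0 hw0s, hcw, LinearMap.add_apply, h3, h4]
      field_simp
      ring
    · have h1 : B q y = 0 := hy.2 q hqM
      have h2 : B y q = 0 := hB.zero_comm h1
      have hrn : B r (nn v) = 0 := hB.zero_comm hnr
      have hval : B q q = B p p + cc + (B (nn v) (nn v) - (f (nn v) + σ (f (nn v)))) := by
        have e1 : B (nn v) p = σ (f (nn v)) := by rw [hB.symm p, hp2 _ (hn1 v)]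
        have e2 : B r p = 1 := by rw [hB.symm p, hp2 r hrs0, hfr, map_one]
        have e3 : B r r = 0 := hr.2 r hr.1
        have e4 : B p r = 1 := by rw [hp2 r hrs0, hfr]
        have e5 : B p (nn v) = f (nn v) := hp2 _ (hn1 v)
        rw [← hβ, hq]
        simp only [map_sub, map_add, LinearMap.sub_apply, LinearMap.add_apply, smulB, Bsmul, e1, e2, e3, e4, e5, hnr, hrn]
        ring
      rw [addB, smulB, map_add, Bsmul, h1, map_add, Bsmul, h2, hYM y hy.1, hval]
      simp only [mul_zero, add_zero]
      by_cases hvk : v = kl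
      · rw [hvk]
        intro h
        exact hc2 (by linear_combination h)
      · have hz : f (nn v) + σ (f (nn v)) = B (nn v) (nn v) := by
          by_cases hvi : v = i0
          · rw [hvi]; exact hfi0
          · exact hfI v ((hImem v).2 ⟨hvt, hα, hvi, hvk⟩)
        rw [hz, sub_self, add_zero]
        intro h
        exact hc1 (by linear_combination h)

theorem Gen (hB : Herm B) (hn : Nondeg B) [FiniteDimensional F V] [Finite F]
    (hQ : 9 ≤ Nat.card F) {D : Submodule F V} {x0 r : V} {t : List V} (hr : r ∈ rad B D)
    (hrx : B r x0 = 1)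
    (ht : Ind D t) (hX : ∀ v ∈ t, ∀ d ∈ D, B d v = B d x0) (P : ℕ) (hlen : t.length = P + 1)
    (he : finrank F ↥(rad B (Dt D t) ⊓ D) + 1 ≤ finrank F (rad B (Dt D t)))
    (he2 : finrank F ↥(rad B (Dt D t) ⊓ D) + P ≤ finrank F (rad B (Dt D t)) + 2) :
    ∃ u, (∀ d ∈ D, B d u = B d x0) ∧ B u u = 0 ∧ (∃ y ∈ rad B (Dt D t), B y u ≠ 0) ∧
      ∀ v s, (v :: s).Perm t → kap B (Dt D (u :: s)) ≤ kap B (Dt D s) ∨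
        kap B (Dt D (u :: s)) ≤ kap B D + P := by
  by_cases h : finrank F ↥(rad B (Dt D t) ⊓ D) + 2 ≤ finrank F (rad B (Dt D t))
  · obtain ⟨u, h1, h2, h3, h4⟩ := Gen1 hB hn hQ ht hX P hlen h he2
    exact ⟨u, h1, h2, h3, fun v s hp => Or.inl (h4 v s hp)⟩
  · exact Gen2 hB hn hr hrx ht hX P hlen (by omega)

end Gen2

end UEH

namespace UEH

section R0

open Module

variable {F : Type} [Field F] {σ : F →+* F}
variable {V : Type} [AddCommGroup V] [Module F V]

/-- add a hyperbolic plane -/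
noncomputable def hyp (B : V →ₛₗ[σ] V →ₗ[F] F) : (V × (F × F)) →ₛₗ[σ] (V × (F × F)) →ₗ[F] F :=
  LinearMap.mk₂'ₛₗ σ (RingHom.id F) (fun x y => B x.1 y.1 + σ x.2.1 * y.2.2 + σ x.2.2 * y.2.1)
    (by intro x x' y; simp; ring) (by intro c x y; simp [smulB]; ring)
    (by intro x y y'; simp; ring) (by intro c x y; simp; ring)

variable {B : V →ₛₗ[σ] V →ₗ[F] F}

theorem hyp_apply (x y : V × (F × F)) :
    hyp B x y = B x.1 y.1 + σ x.2.1 * y.2.2 + σ x.2.2 * y.2.1 := rfl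

theorem hyp_herm (hB : Herm B) : Herm (hyp B) where
  hf := hB.hf
  symm := by
    intro v w
    rw [hyp_apply, hyp_apply, hB.symm v.1 w.1]
    simp only [map_add, map_mul, hB.hf.invol]
    ring

theorem hyp_nondeg (hn : Nondeg B) : Nondeg (hyp B) := by
  rintro ⟨v, a, b⟩ h
  have h1 : v = 0 := hn v (fun w => by simpa [hyp_apply] using h (w, 0, 0))
  have h2 : b = 0 := by simpa [hyp_apply] using h (0, 1, 0)
  have h3 : a = 0 := by simpa [hyp_apply] using h (0, 0, 1)
  rw [h1, h2, h3]; rfl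

theorem kap_Dt_le (hB : Herm B) [FiniteDimensional F V] (D : Submodule F V) (t : List V) :
    kap B (Dt D t) ≤ kap B D + 2 * t.length := by
  induction t with
  | nil => rw [Dt_nil]; simp
  | cons x t ih =>
    rw [Dt_cons, List.length_cons]
    have := (hB.kap_step (Dt D t) x).2
    omega

/-- admissible lists -/
def Okx (B : V →ₛₗ[σ] V →ₗ[F] F) (D : Submodule F V) (x0 : V) : Set (List V) :=
  {t | (∀ v ∈ t, (∀ d ∈ D, B d v = B d x0) ∧ B v v = 0) ∧ Ind D t}

theorem gram_sub {E : Type} [AddCommGroup E] [Module F E] {BE : E →ₛₗ[σ] E →ₗ[F] F}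
    {k : Type} [Field k] {l : List E} {f : E →ₗ[F] V}
    (h : ∀ x ∈ l, ∀ y ∈ l, B (f x) (f y) = BE x y) :
    pf k (gram B) (del k (Finsupp.single (l.map f) 1)) = pf k (gram BE) (del k (Finsupp.single l 1)) := by
  have h1 := del_map (k := k) f (Finsupp.single l 1)
  rw [pf_single] at h1
  rw [h1, pf_pf]
  have := sp_map (P := ⊥) (pf k (gram B ∘ List.map f) - pf k (gram BE)) (fun s hs => by
    rw [LinearMap.sub_apply, pf_single, pf_single, Submodule.mem_bot, sub_eq_zero]
    congr 1
    exact gram_map (fun x hx y hy => h x (hs.1.subset hx) y (hs.1.subset hy))) (del_single_sp (k := k) l)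
  rwa [Submodule.mem_bot, LinearMap.sub_apply, sub_eq_zero] at this

/-- realizing lists of `E` in `V` -/
theorem realize {E : Type} [AddCommGroup E] [Module F E] {BE : E →ₛₗ[σ] E →ₗ[F] F}
    {k : Type} [Field k] (hBE : Herm BE) (hB : Herm B) (hn : Nondeg B) [FiniteDimensional F E]
    [FiniteDimensional F V] {D : Submodule F V} {x0 : V} (ι : V →ₗ[F] E) (π : E →ₗ[F] V)
    (hπ : ∀ v, π (ι v) = v) (hι : ∀ v w, BE (ι v) (ι w) = B v w) {l : List E}
    (hl : l ∈ Okx BE (D.map ι) (ι x0)) (hk : kap BE (Dt (D.map ι) l) ≤ finrank F V) :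
    ∃ l' ∈ Okx B D x0, l'.length = l.length ∧
      pf k (gram B) (del k (Finsupp.single l' 1)) = pf k (gram BE) (del k (Finsupp.single l 1)) := by
  have hiso : IsoOn BE B (D.map ι) π := by
    constructor
    · rintro _ ⟨x, hx, rfl⟩ _ ⟨y, hy, rfl⟩
      rw [hπ, hπ, hι]
    · rintro _ ⟨x, hx, rfl⟩ h
      rw [hπ] at h; rw [h, map_zero]
  obtain ⟨f, hf1, hf2⟩ := EET hBE hB hn hk (D.map ι) (le_Dt _ _) π hiso
  have hfD : ∀ d ∈ D, f (ι d) = d := fun d hd => by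
    rw [hf1 _ (Submodule.mem_map_of_mem hd), hπ]
  have hmap : D = (D.map ι).map f := by
    ext x
    constructor
    · intro hx; exact ⟨ι x, Submodule.mem_map_of_mem hx, hfD x hx⟩
    · rintro ⟨_, ⟨y, hy, rfl⟩, rfl⟩
      rw [hfD y hy]; exact hy
  have hm : ∀ x ∈ l, x ∈ Dt (D.map ι) l := fun x hx => mem_Dt hx
  refine ⟨l.map f, ⟨?_, ?_⟩, by simp, gram_sub (fun x hx y hy => hf2.1 x (hm x hx) y (hm y hy))⟩
  · intro v hv
    obtain ⟨x, hx, rfl⟩ := List.mem_map.1 hv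
    refine ⟨fun d hd => ?_, ?_⟩
    · have h1 := hf2.1 (ι d) (le_Dt _ _ (Submodule.mem_map_of_mem hd)) x (hm x hx)
      rw [hfD d hd, (hl.1 x hx).1 _ (Submodule.mem_map_of_mem hd), hι] at h1
      exact h1
    · rw [hf2.1 x (hm x hx) x (hm x hx), (hl.1 x hx).2]
  · rw [Ind_iff_finrank, Dt_smul f hmap rfl, finrank_map_on hf2.2, hl.2.finrank, List.length_map]
    congr 1
    exact finrank_map_on (fun x _ h => by rw [← hπ x, h, map_zero])

theorem gram_smul (g : UU B) (t : List V) : gram B (g • t) = gram B t := by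
  have h : g • t = t.map (g.1 : V →ₗ[F] V) := rfl
  rw [h]
  exact gram_map (fun x _ y _ => g.2 x y)

theorem gram_co {k : Type} [Field k] {H : Subgroup (UU B)} {a : List V →₀ k}
    (ha : a ∈ co k H (List V)) : pf k (gram B) a = 0 := by
  have := co_map (P := ⊥) (pf k (gram B)) (fun h hh x => by
    rw [pf_single, pf_single, gram_smul, sub_self]; exact Submodule.zero_mem _) ha
  rwa [Submodule.mem_bot] at this

theorem co_gram (hB : Herm B) (hn : Nondeg B) [FiniteDimensional F V] {k : Type} [Field k]
    {D : Submodule F V} {x0 : V} {z : List V →₀ k} (hz : z ∈ sp k (Okx B D x0))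
    (h0 : pf k (gram B) z = 0) : z ∈ co k (Gam B D) (List V) := by
  classical
  let rep : List (List F) → List V := fun g =>
    if h : ∃ t ∈ Okx B D x0, gram B t = g then h.choose else []
  have hrep : ∀ t ∈ Okx B D x0, rep (gram B t) ∈ Okx B D x0 ∧ gram B (rep (gram B t)) = gram B t := by
    intro t ht
    have h : ∃ t' ∈ Okx B D x0, gram B t' = gram B t := ⟨t, ht, rfl⟩
    have : rep (gram B t) = h.choose := dif_pos h
    rw [this]; exact h.choose_spec
  have := sp_map (P := co k (Gam B D) (List V)) (LinearMap.id - pf k rep ∘ₗ pf k (gram B))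
    (fun t ht => by
      rw [LinearMap.sub_apply, LinearMap.comp_apply, pf_single, pf_single, LinearMap.id_apply]
      obtain ⟨h1, h2⟩ := hrep t ht
      obtain ⟨g, hg, e⟩ := witt_lists hB hn h1.2 ht.2 h2 (fun x hx x' hx' d hd => by
        rw [(h1.1 x hx).1 d hd, (ht.1 x' hx').1 d hd])
      have h3 := co_basic (k := k) hg (rep (gram B t))
      rw [e] at h3
      exact h3) hz
  rwa [LinearMap.sub_apply, LinearMap.comp_apply, h0, map_zero, sub_zero] at this

/-- chain version of `realize` -/
theorem realize_chain {E : Type} [AddCommGroup E] [Module F E] {BE : E →ₛₗ[σ] E →ₗ[F] F}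
    {k : Type} [Field k] (hBE : Herm BE) (hB : Herm B) (hn : Nondeg B) [FiniteDimensional F E]
    [FiniteDimensional F V] {D : Submodule F V} {x0 : V} (ι : V →ₗ[F] E) (π : E →ₗ[F] V)
    (hπ : ∀ v, π (ι v) = v) (hι : ∀ v w, BE (ι v) (ι w) = B v w) (p : ℕ) {Z : List E →₀ k}
    (hZ : Z ∈ sp k {l | l ∈ Okx BE (D.map ι) (ι x0) ∧ kap BE (Dt (D.map ι) l) ≤ finrank F V ∧
      l.length = p}) :
    ∃ Y ∈ sp k (OkL (Okx B D x0) p), pf k (gram B) (del k Y) = pf k (gram BE) (del k Z) := by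
  have hsub : sp k {l | l ∈ Okx BE (D.map ι) (ι x0) ∧ kap BE (Dt (D.map ι) l) ≤ finrank F V ∧
      l.length = p} ≤ ((sp k (OkL (Okx B D x0) p)).map (pf k (gram B) ∘ₗ del k)).comap
        (pf k (gram BE) ∘ₗ del k) := by
    intro Z hZ
    rw [Submodule.mem_comap]
    refine sp_map _ ?_ hZ
    rintro l ⟨h1, h2, h3⟩
    obtain ⟨l', h4, h5, h6⟩ := realize (k := k) hBE hB hn ι π hπ hι h1 h2
    have hm : l' ∈ OkL (Okx B D x0) p := ⟨h4, by omega⟩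
    exact ⟨Finsupp.single l' 1, single_mem_sp hm 1, h6⟩
  obtain ⟨Y, h1, h2⟩ := hsub hZ
  exact ⟨Y, h1, h2⟩

/-- formal cone on Gram data -/
def consC (c : F) (g : List (List F)) : List (List F) := (0 :: List.replicate g.length c) :: g

theorem gram_consC {c : F} {w : V} {s : List V} (hw : B w w = 0) (h : ∀ x ∈ s, B w x = c) :
    gram B (w :: s) = consC c (gram B s) := by
  unfold consC
  rw [gram_length]
  show ((w :: s).map (B w)) :: gram B s = _
  rw [List.map_cons, hw]
  congr 2
  rw [← List.length_map (f := B w)]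
  rw [List.eq_replicate_iff]
  refine ⟨rfl, ?_⟩
  intro b hb
  obtain ⟨x, hx, rfl⟩ := List.mem_map.1 hb
  exact h x hx

theorem kap_two (hB : Herm B) [FiniteDimensional F V] {D : Submodule F V} {r x0 v w : V}
    (hr : r ∈ rad B D) (hrx : B r x0 = 1) (hv : ∀ d ∈ D, B d v = B d x0) (hvv : B v v = 0)
    (hw : ∀ d ∈ D, B d w = B d x0) (hww : B w w = 0) (hc : B w v + σ (B w v) ≠ 0) :
    kap B (D ⊔ F ∙ v ⊔ F ∙ w) ≤ kap B D + 1 := by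
  have hrv : B r v = 1 := by rw [hv r hr.1, hrx]
  have h1 : kap B (D ⊔ F ∙ v) = kap B D := hB.kap_pair hr (by rw [hrv]; exact one_ne_zero)
  rw [← h1]
  have hvr : B v r = 1 := by rw [hB.symm r, hrv, map_one]
  refine hB.kap_L3 (p := v + σ (B w v) • r) ?_ ?_ ?_
  · exact Submodule.add_mem _ (Submodule.mem_sup_right (Submodule.mem_span_singleton_self v))
      (Submodule.smul_mem _ _ (Submodule.mem_sup_left hr.1))
  · intro x hx
    obtain ⟨d, hd, a, rfl⟩ := mem_sup_span.1 hx
    have e1 : B v d = B w d := by rw [hB.symm d v, hB.symm d w, hv d hd, hw d hd]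
    have e2 : B r d = 0 := hB.zero_comm (hr.2 d hd)
    simp only [addB, smulB, map_add, Bsmul, LinearMap.add_apply, e1, e2, hvv, hrv, hB.hf.invol]
    ring
  · rw [hww]
    have e3 : B r r = 0 := hr.2 r hr.1
    simp only [map_add, LinearMap.add_apply, smulB, Bsmul, hvv, hrv, hvr, e3, hB.hf.invol]
    intro h
    exact hc (by linear_combination -h)

theorem R0_key (hB : Herm B) (hn : Nondeg B) [FiniteDimensional F V] [Finite F]
    (hQ : 9 ≤ Nat.card F) {k : Type} [Field k] {D : Submodule F V} {x0 r : V} (hr : r ∈ rad B D)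
    (hrx : B r x0 = 1) (d : ℕ) (hd : 2 ≤ d) (hk : kap B D + 2 * d ≤ finrank F V + 1)
    (c : F) (hc : c + σ c ≠ 0) (t : List V) (ht : t ∈ OkL (Okx B D x0) (d + 1)) :
    ∃ Y ∈ sp k (OkL (Okx B D x0) (d + 2)), pf k (gram B) (del k Y) =
      Finsupp.single (gram B t) 1 - pf k (consC c) (pf k (gram B) (del k (Finsupp.single t 1))) := by
  classical
  obtain ⟨htOk, htlen⟩ := ht
  obtain ⟨E, _, _, _, BE, hBE, hnE, ι, π, hπ, hι, w, hwD, hww, hwt, hwV⟩ :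
    ∃ (E : Type) (_ : AddCommGroup E) (_ : Module F E) (_ : FiniteDimensional F E)
      (BE : E →ₛₗ[σ] E →ₗ[F] F) (_ : Herm BE) (_ : Nondeg BE) (ι : V →ₗ[F] E) (π : E →ₗ[F] V)
      (_ : ∀ v, π (ι v) = v) (_ : ∀ v w, BE (ι v) (ι w) = B v w) (w : E),
      (∀ d ∈ D, BE (ι d) w = B d x0) ∧ BE w w = 0 ∧ (∀ v ∈ t, BE w (ι v) = c) ∧
      w ∉ LinearMap.range ι := by
    obtain ⟨h, h1, h2⟩ := htOk.2.functional (fun v => c - B x0 v)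
    obtain ⟨w0, hw0⟩ := hB.rep_top hn (B x0 + h)
    obtain ⟨s, hs⟩ := hB.hf.trace_surj (- B w0 w0) (by rw [map_neg, hB.fix])
    refine ⟨V × (F × F), inferInstance, inferInstance, inferInstance, hyp B, hyp_herm hB,
      hyp_nondeg hn, LinearMap.inl F V (F × F), LinearMap.fst F V (F × F), fun v => rfl, ?_,
      (w0, s, 1), ?_, ?_, ?_, ?_⟩
    · intro v w; simp [hyp_apply]
    · intro d hd
      have : B d w0 = B d x0 := by
        rw [hB.symm w0, hw0, LinearMap.add_apply, h1 d hd, add_zero, ← hB.symm]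
      simp [hyp_apply, this]
    · simp only [hyp_apply, map_one]
      linear_combination hs
    · intro v hv
      have : B w0 v = c := by rw [hw0, LinearMap.add_apply, h2 v hv]; ring
      simp [hyp_apply, this]
    · rintro ⟨x, hx⟩
      have := congrArg (fun z => z.2.2) hx
      simp at this
  obtain ⟨D', hD'⟩ : ∃ D', D' = D.map ι := ⟨_, rfl⟩
  have hιinj : ∀ x, ι x = 0 → x = 0 := fun x h => by rw [← hπ x, h, map_zero]
  have hiso : ∀ M : Submodule F V, IsoOn B BE M ι := fun M =>
    ⟨fun x _ y _ => hι x y, fun x _ h => hιinj x h⟩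
  have hkD : kap BE D' = kap B D := by rw [hD', (hiso D).kap_map]
  have hr' : ι r ∈ rad BE D' := by
    rw [hD', (hiso D).rad_map]; exact Submodule.mem_map_of_mem hr
  have hrx' : BE (ι r) (ι x0) = 1 := by rw [hι, hrx]
  have hDt : Dt D' (t.map ι) = (Dt D t).map ι := Dt_smul ι hD' rfl
  have htE : t.map ι ∈ Okx BE D' (ι x0) := by
    constructor
    · intro v hv
      obtain ⟨x, hx, rfl⟩ := List.mem_map.1 hv
      rw [hD']
      refine ⟨?_, by rw [hι, (htOk.1 x hx).2]⟩
      rintro _ ⟨d, hd, rfl⟩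
      rw [hι, hι, (htOk.1 x hx).1 d hd]
    · rw [Ind_iff_finrank, hDt, finrank_map_on (hiso _).2, htOk.2.finrank, List.length_map, hD',
        finrank_map_on (hiso _).2]
  have hw1 : ∀ d ∈ D', BE d w = BE d (ι x0) := by
    rw [hD']; rintro _ ⟨d, hd, rfl⟩
    rw [hwD d hd, hι]
  have hτ : w :: t.map ι ∈ Okx BE D' (ι x0) := by
    constructor
    · intro v hv
      rcases List.mem_cons.1 hv with rfl | hv
      · exact ⟨hw1, hww⟩
      · exact htE.1 v hv
    · refine ⟨?_, htE.2⟩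
      rw [hDt]
      rintro ⟨x, _, hx⟩
      exact hwV ⟨x, hx⟩
  have hwt' : ∀ x ∈ t.map ι, BE w x = c := by
    intro x hx
    obtain ⟨v, hv, rfl⟩ := List.mem_map.1 hx
    exact hwt v hv
  have hτlen : (w :: t.map ι).length = (d + 1) + 1 := by simp [htlen]
  -- what the boundary of τ is
  have hgoal : pf k (gram BE) (del k (Finsupp.single (w :: t.map ι) 1)) =
      Finsupp.single (gram B t) 1 - pf k (consC c) (pf k (gram B) (del k (Finsupp.single t 1))) := by
    rw [del_cons', map_sub, pf_single, gram_map (fun x _ y _ => hι x y), pf_pf]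
    congr 1
    have h1 := gram_sub (k := k) (B := BE) (BE := B) (l := t) (f := ι) (fun x _ y _ => hι x y)
    rw [← h1, pf_pf]
    have := sp_map (P := ⊥) (pf k (gram BE ∘ List.cons w) - pf k (consC c ∘ gram BE)) (fun s hs => by
      rw [LinearMap.sub_apply, pf_single, pf_single, Submodule.mem_bot, sub_eq_zero]
      congr 1
      exact gram_consC hww (fun x hx => hwt' x (hs.1.subset hx))) (del_single_sp (k := k) (t.map ι))
    rwa [Submodule.mem_bot, LinearMap.sub_apply, sub_eq_zero] at this
  suffices ∃ Z ∈ sp k {l | l ∈ Okx BE (D.map ι) (ι x0) ∧ kap BE (Dt (D.map ι) l) ≤ finrank F V ∧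
      l.length = d + 2}, del k Z = del k (Finsupp.single (w :: t.map ι) 1) by
    obtain ⟨Z, hZ1, hZ2⟩ := this
    obtain ⟨Y, hY1, hY2⟩ := realize_chain hBE hB hn ι π hπ hι (d + 2) hZ1
    exact ⟨Y, hY1, by rw [hY2, hZ2, hgoal]⟩
  rw [← hD']
  by_cases hkτ : kap BE (Dt D' (w :: t.map ι)) ≤ finrank F V
  · have hm : (w :: t.map ι) ∈ {l | l ∈ Okx BE D' (ι x0) ∧ kap BE (Dt D' l) ≤ finrank F V ∧
      l.length = d + 2} := ⟨hτ, hkτ, by simp [htlen]⟩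
    exact ⟨_, single_mem_sp hm 1, rfl⟩
  have hrd := rad_Dt_inf hBE hr' hrx' (List.cons_ne_nil w (t.map ι)) (fun v hv => (hτ.1 v hv).1)
  have hdim := hτ.2.finrank
  rw [hτlen] at hdim
  have he : finrank F ↥(rad BE (Dt D' (w :: t.map ι)) ⊓ D') + d ≤
      finrank F (rad BE (Dt D' (w :: t.map ι))) + 1 := by
    rw [← hkD] at hk
    unfold kap at hk hkτ
    omega
  obtain ⟨u, hu1, hu2, ⟨y, hy, hyu⟩, hu4⟩ := Gen hBE hnE hQ hr' hrx' hτ.2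
    (fun v hv => (hτ.1 v hv).1) (d + 1) hτlen (by omega) (by omega)
  have huτ : u ∉ Dt D' (w :: t.map ι) := notMem_of_pair hBE hy hyu
  refine ⟨pf k (List.cons u) (del k (Finsupp.single (w :: t.map ι) 1)), ?_, by
    rw [del_cons, del_del, map_zero, sub_zero]⟩
  refine pf_sp _ ?_ (del_single_sp (k := k) (w :: t.map ι))
  rintro s ⟨hs1, hs2⟩
  obtain ⟨v, hv⟩ := facet_perm hs1 hs2
  have hsle : Dt D' s ≤ Dt D' (w :: t.map ι) := Dt_mono le_rfl (fun x hx => hs1.subset hx)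
  refine ⟨⟨?_, fun h => huτ (hsle h), hτ.2.sublist hs1⟩, ?_, by simp [htlen] at hs2 ⊢; omega⟩
  · intro x hx
    rcases List.mem_cons.1 hx with rfl | hx
    · exact ⟨hu1, hu2⟩
    · exact hτ.1 x (hs1.subset hx)
  · rcases hu4 v s hv with h | h
    · refine h.trans ?_
      by_cases hvw : v = w
      · rw [hvw] at hv
        rw [Dt_perm D' hv.cons_inv, hDt, (hiso _).kap_map]
        exact hB.kap_le hn _
      · have hws : w ∈ s := by
          have := hv.symm.subset (List.mem_cons_self (a := w))
          rcases List.mem_cons.1 this with h | h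
          · exact absurd h.symm hvw
          · exact h
        have hp1 := List.perm_cons_erase hws
        have hp2 : (v :: s.erase w).Perm (t.map ι) := by
          have : (w :: v :: s.erase w).Perm (w :: t.map ι) :=
            (List.Perm.swap _ _ _).trans ((hp1.symm.cons v).trans hv)
          exact this.cons_inv
        rcases hse : s.erase w with _ | ⟨v1, s1⟩
        · rw [hse] at hp2
          have := hp2.length_eq
          simp [htlen] at this; omega
        · rw [hse] at hp1 hp2
          have hv1 : v1 ∈ t.map ι := hp2.subset (by simp)
          have e : Dt D' s = Dt (D' ⊔ F ∙ v1 ⊔ F ∙ w) s1 := by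
            rw [Dt_perm D' (hp1.trans (List.Perm.swap _ _ _)), Dt_cons', Dt_cons']
          have h1 := kap_Dt_le hBE (D' ⊔ F ∙ v1 ⊔ F ∙ w) s1
          have h2 := kap_two hBE hr' hrx' (htE.1 v1 hv1).1 (htE.1 v1 hv1).2 hw1 hww
            (by rw [hwt' v1 hv1]; exact hc)
          have h3 := hp2.length_eq
          simp [htlen] at h3
          rw [e]
          omega
    · omega

theorem R0 (hB : Herm B) (hn : Nondeg B) [FiniteDimensional F V] [Finite F]
    (hQ : 9 ≤ Nat.card F) {k : Type} [Field k] {D : Submodule F V} {x0 r : V} (hr : r ∈ rad B D)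
    (hrx : B r x0 = 1) (d : ℕ) (hd : 2 ≤ d) (hk : kap B D + 2 * d ≤ finrank F V + 1)
    (z : List V →₀ k) (hz : z ∈ sp k (OkL (Okx B D x0) (d + 1)))
    (h0 : del k z ∈ co k (Gam B D) (List V)) :
    ∃ y ∈ sp k (OkL (Okx B D x0) (d + 2)), z - del k y ∈ co k (Gam B D) (List V) := by
  classical
  obtain ⟨c, hc⟩ := hB.hf.trace_surj 1 (map_one σ)
  have hc : c + σ c ≠ 0 := by rw [hc]; exact one_ne_zero
  have hsub : sp k (OkL (Okx B D x0) (d + 1)) ≤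
      ((sp k (OkL (Okx B D x0) (d + 2))).map (pf k (gram B) ∘ₗ del k)).comap
        (pf k (gram B) - pf k (consC c) ∘ₗ pf k (gram B) ∘ₗ del k) := by
    intro z hz
    rw [Submodule.mem_comap]
    refine sp_map _ ?_ hz
    intro t ht
    obtain ⟨Y, h1, h2⟩ := R0_key (k := k) hB hn hQ hr hrx d hd hk c hc t ht
    refine ⟨Y, h1, ?_⟩
    rw [LinearMap.sub_apply, pf_single]
    exact h2
  obtain ⟨y, hy1, hy2⟩ := hsub hz
  refine ⟨y, hy1, ?_⟩
  simp only [LinearMap.sub_apply, LinearMap.comp_apply, gram_co h0, map_zero, sub_zero] at hy2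
  refine co_gram hB hn (x0 := x0) (Submodule.sub_mem _ ?_ ?_) (by rw [map_sub, hy2, sub_self])
  · exact Finsupp.supported_mono (fun t ht => ht.1) hz
  · refine del_sp ?_ hy1
    intro l hl s hs1 hs2
    exact ⟨fun v hv => hl.1.1 v (hs1.subset hv), hl.1.2.sublist hs1⟩

end R0

end UEH

namespace UEH

section RowPrep

open Module

variable {F : Type} [Field F] {σ : F →+* F}
variable {V : Type} [AddCommGroup V] [Module F V] {B : V →ₛₗ[σ] V →ₗ[F] F}

theorem Okx_sub {D : Submodule F V} {x0 : V} : ∀ t ∈ Okx B D x0, ∀ s, s.Sublist t → s ∈ Okx B D x0 :=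
  fun t ht s hs => ⟨fun v hv => ht.1 v (hs.subset hv), ht.2.sublist hs⟩

theorem Okx_nil {D : Submodule F V} {x0 : V} : ([] : List V) ∈ Okx B D x0 :=
  ⟨fun v hv => absurd hv (List.not_mem_nil), trivial⟩

theorem Okx_smul [FiniteDimensional F V] {D : Submodule F V} {x0 : V} :
    ∀ h ∈ Gam B D, ∀ t ∈ Okx B D x0, h • t ∈ Okx B D x0 := by
  intro h hh t ht
  have hinj : ∀ x, (h.1 : V →ₗ[F] V) x = 0 → x = 0 := fun x hx => h.1.injective (by rw [map_zero]; exact hx)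
  have hD : D = D.map (h.1 : V →ₗ[F] V) := by
    ext x
    constructor
    · intro hx
      exact ⟨x, hx, hh x hx⟩
    · rintro ⟨y, hy, rfl⟩
      have : (h.1 : V →ₗ[F] V) y = y := hh y hy
      rw [this]; exact hy
  constructor
  · intro v hv
    have hv' : v ∈ t.map (h.1 : V →ₗ[F] V) := hv
    obtain ⟨x, hx, rfl⟩ := List.mem_map.1 hv'
    refine ⟨fun d hd => ?_, ?_⟩
    · rw [← (ht.1 x hx).1 d hd]
      have h1 : h • d = d := hh d hd
      conv_lhs => rw [← h1]
      exact UU.iso h d x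
    · rw [← (ht.1 x hx).2]
      exact UU.iso h x x
  · rw [Ind_iff_finrank, Dt_smul (h.1 : V →ₗ[F] V) hD (rfl : h • t = t.map (h.1 : V →ₗ[F] V)),
      finrank_map_on (fun x _ => hinj x), ht.2.finrank, smul_list_length]

theorem Okx_single {D : Submodule F V} (hB : Herm B) {x0 r v : V} (hr : r ∈ rad B D) (hrx : B r x0 = 1)
    (hv : ∀ d ∈ D, B d v = B d x0) (hvv : B v v = 0) : [v] ∈ OkL (Okx B D x0) 1 := by
  refine ⟨⟨?_, ?_, trivial⟩, rfl⟩
  · intro x hx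
    rw [List.mem_singleton] at hx
    rw [hx]; exact ⟨hv, hvv⟩
  · rw [Dt_nil]
    exact notMem_of_pair hB hr (by rw [hv r hr.1, hrx]; exact one_ne_zero)

theorem Okx_hex (hB : Herm B) (hn : Nondeg B) [FiniteDimensional F V] {k : Type} [Field k]
    {D : Submodule F V} {x0 r : V} (hr : r ∈ rad B D) (hrx : B r x0 = 1) (hx0 : B x0 x0 = 0)
    (p : ℕ) (hp : kap B D + p ≤ finrank F V) (z : List V →₀ k) (hz : z ∈ sp k (OkL (Okx B D x0) p))
    (h0 : del k z = 0) : ∃ y ∈ sp k (OkL (Okx B D x0) (p + 1)), del k y = z := by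
  obtain ⟨D1, hD1⟩ : ∃ D1, D1 = D ⊓ LinearMap.ker (B x0) := ⟨_, rfl⟩
  obtain ⟨T0, hT0⟩ : ∃ T0, T0 = perp B D1 := ⟨_, rfl⟩
  obtain ⟨X, hX⟩ : ∃ X : Set V, X = {v | (∀ d ∈ D, B d v = B d x0) ∧ B v v = 0} := ⟨_, rfl⟩
  have hxr : B x0 r = 1 := by rw [hB.symm r, hrx, map_one]
  have hdec : ∀ d ∈ D, d - B x0 d • r ∈ D1 := by
    intro d hd
    rw [hD1]
    refine ⟨Submodule.sub_mem _ hd (Submodule.smul_mem _ _ hr.1), ?_⟩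
    rw [SetLike.mem_coe, LinearMap.mem_ker, map_sub, Bsmul, hxr]; ring
  have hXT : ∀ v, (∀ d ∈ D, B d v = B d x0) → v ∈ T0 := by
    intro v hv
    rw [hT0, mem_perp]
    intro d hd
    rw [hD1] at hd
    rw [hv d hd.1]
    exact hB.zero_comm hd.2
  have hTX : ∀ v ∈ T0, B r v = 1 → ∀ d ∈ D, B d v = B d x0 := by
    intro v hv hrv d hd
    rw [hT0, mem_perp] at hv
    have h1 := hv _ (hdec d hd)
    rw [subB, smulB, hrv, ← hB.symm] at h1
    linear_combination h1
  have hrr : B r r = 0 := hr.2 r hr.1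
  have hrT : r ∈ T0 := by
    rw [hT0, mem_perp]
    intro d hd
    rw [hD1] at hd
    exact hr.2 d hd.1
  have hEq : ∀ q, OkL (Okx B D x0) q = OkT X T0 D q := by
    intro q
    ext l
    constructor
    · rintro ⟨⟨h1, h2⟩, h3⟩
      exact ⟨fun x hx => ⟨by rw [hX]; exact h1 x hx, hXT x (h1 x hx).1⟩, h2, h3⟩
    · rintro ⟨h1, h2, h3⟩
      refine ⟨⟨fun x hx => ?_, h2⟩, h3⟩
      have := (h1 x hx).1
      rw [hX] at this
      exact this
  rw [hEq] at hz ⊢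
  refine acyc X r T0 ?_ _ T0 rfl le_rfl hrT ⟨x0, ?_, hXT x0 (fun _ _ => rfl)⟩ D hr.1 p ?_ z hz h0
  · intro T H hT hH hrH hxH
    obtain ⟨x, hxX, hxH⟩ := hxH
    rw [hX] at hxX
    have hrx1 : B r x = 1 := by rw [hxX.1 r hr.1, hrx]
    obtain ⟨y, hyT, hyH⟩ := exists_mem_not hH
    obtain ⟨y', hy'⟩ : ∃ y', y' = y - (B r y - 1) • x := ⟨_, rfl⟩
    have h1 : B r y' = 1 := by rw [hy', map_sub, Bsmul, hrx1]; ring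
    have hyr : B y' r = 1 := by rw [hB.symm r, h1, map_one]
    have h2 : y' ∈ T := by
      rw [hy']; exact Submodule.sub_mem _ hyT (Submodule.smul_mem _ _ (hH.le hxH))
    have h3 : y' ∉ H := by
      intro h
      refine hyH ?_
      have : y = y' + (B r y - 1) • x := by rw [hy']; abel
      rw [this]
      exact Submodule.add_mem _ h (Submodule.smul_mem _ _ hxH)
    obtain ⟨c, hc⟩ := hB.hf.trace_surj (- B y' y') (by rw [map_neg, hB.fix])
    have h4 : y' + c • r ∈ T := Submodule.add_mem _ h2 (Submodule.smul_mem _ _ (hH.le hrH))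
    refine ⟨y' + c • r, ?_, h4, ?_⟩
    · rw [hX]
      refine ⟨hTX _ (hT h4) (by rw [map_add, Bsmul, h1, hrr]; ring), ?_⟩
      simp only [map_add, LinearMap.add_apply, smulB, Bsmul, h1, hyr, hrr]
      linear_combination hc
    · intro h
      refine h3 ?_
      have : y' = (y' + c • r) - c • r := by abel
      rw [this]
      exact Submodule.sub_mem _ h (Submodule.smul_mem _ _ hrH)
  · rw [hX]; exact ⟨fun _ _ => rfl, hx0⟩
  · have e1 : finrank F ↥(T0 ⊓ D) ≤ finrank F (rad B D) := by
      refine Submodule.finrank_mono ?_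
      rintro v ⟨hv1, hv2⟩
      refine mem_rad.2 ⟨hv2, fun d hd => ?_⟩
      have h1 : B r v = 0 := hB.zero_comm (hr.2 v hv2)
      rw [hT0, SetLike.mem_coe, mem_perp] at hv1
      have h2 := hv1 _ (hdec d hd)
      rw [subB, smulB, h1] at h2
      linear_combination h2
    have e2 : finrank F D1 < finrank F D := by
      refine Submodule.finrank_lt_finrank_of_lt (lt_of_le_of_ne (by rw [hD1]; exact inf_le_left) ?_)
      intro h
      have h1 : r ∈ D1 := by rw [h]; exact hr.1
      rw [hD1] at h1
      have h2 : B x0 r = 0 := h1.2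
      rw [hxr] at h2
      exact one_ne_zero h2
    have e3 := hB.finrank_perp hn D1
    rw [← hT0] at e3
    unfold kap at hp
    omega

end RowPrep

section ZS

variable (k : Type) [Field k] {G : Type} [Group G] {A : Type} [MulAction G A]

/-- chains that can be eliminated -/
noncomputable def ZS (H : Subgroup G) (Ok : Set (List A)) (p j : ℕ) :
    Submodule k (List G × List A →₀ k) :=
  ((sp k (Ln G (j + 2) ×ˢ OkL Ok p) ⊓ (co k H (List G × List A)).comap (dX k (List G) A)).map
    (dG k G (List A))) ⊔ co k H (List G × List A)

variable {k}

theorem mem_ZS {H : Subgroup G} {Ok : Set (List A)} {p j : ℕ} {c : List G × List A →₀ k} :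
    c ∈ ZS k H Ok p j ↔ ∃ x ∈ sp k (Ln G (j + 2) ×ˢ OkL Ok p),
      dX k (List G) A x ∈ co k H (List G × List A) ∧
        dG k G (List A) x - c ∈ co k H (List G × List A) := by
  constructor
  · intro h
    obtain ⟨y, ⟨x, hx, rfl⟩, i, hi, rfl⟩ := Submodule.mem_sup.1 h
    refine ⟨x, hx.1, hx.2, ?_⟩
    rw [sub_add_cancel_left]
    exact Submodule.neg_mem _ hi
  · rintro ⟨x, h1, h2, h3⟩
    have : c = dG k G (List A) x + (- (dG k G (List A) x - c)) := by abel
    rw [this]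
    exact Submodule.add_mem_sup ⟨x, ⟨h1, h2⟩, rfl⟩ (Submodule.neg_mem _ h3)

theorem ZS_co {H : Subgroup G} {Ok : Set (List A)} {p j : ℕ} {c : List G × List A →₀ k}
    (h : c ∈ co k H (List G × List A)) : c ∈ ZS k H Ok p j := Submodule.mem_sup_right h

theorem ZS_Bd {H : Subgroup G} {Ok : Set (List A)}
    (hsub : ∀ t ∈ Ok, ∀ s, s.Sublist t → s ∈ Ok) {p j : ℕ} {t : List A}
    (ht : t ∈ OkL Ok (p + 1)) {a : List G →₀ k}
    (ha : a ∈ Bd k (H ⊓ MulAction.stabilizer G t) j) :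
    dX k (List G) A (tn k a (Finsupp.single t 1)) ∈ ZS k H Ok p j :=
  mem_ZS.2 (Zof_Bd H Ok hsub p j t ht a ha)

/-- boundaries over a subgroup fixing `[x]` and `[y]` -/
theorem ZS_two {H K : Subgroup G} {Ok : Set (List A)} {j : ℕ} {x y : A}
    (hx : [x] ∈ OkL Ok 1) (hy : [y] ∈ OkL Ok 1) (hK : K ≤ H) (hKx : ∀ h ∈ K, h • x = x)
    (hKy : ∀ h ∈ K, h • y = y) {a : List G →₀ k} (ha : a ∈ Bd k K j) :
    tn k a (Finsupp.single [y] 1 - Finsupp.single [x] 1) ∈ ZS k H Ok 1 j := by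
  obtain ⟨i, hi, _, ⟨e, he, rfl⟩, rfl⟩ := Submodule.mem_sup.1 ha
  rw [map_add, LinearMap.add_apply]
  have hco : ∀ v : A, (∀ h ∈ K, h • v = v) → tn k i (Finsupp.single [v] 1) ∈ co k H (List G × List A) := by
    intro v hv
    rw [tn_single_right]
    refine pf_co (H := K) (H' := H) _ (fun h hh x => ?_) hi
    refine ⟨h, hK hh, Prod.ext rfl ?_⟩
    show [v] = h • [v]
    rw [smul_list_cons, smul_list_nil, hv h hh]
  refine Submodule.add_mem _ (ZS_co ?_) ?_
  · rw [map_sub]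
    exact Submodule.sub_mem _ (hco y hKy) (hco x hKx)
  · refine mem_ZS.2 ⟨tn k e (Finsupp.single [y] 1 - Finsupp.single [x] 1), ?_, ?_, ?_⟩
    · exact tn_sp he (Submodule.sub_mem _ (single_mem_sp hy 1) (single_mem_sp hx 1))
    · rw [liftR_tn, map_sub, del_cons', del_cons', del_nil]
      simp
    · rw [liftL_tn, sub_self]
      exact Submodule.zero_mem _

end ZS

end UEH

namespace UEH

section Rows

open Module

variable {F : Type} [Field F] {σ : F →+* F}
variable {V : Type} [AddCommGroup V] [Module F V] {B : V →ₛₗ[σ] V →ₗ[F] F}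

theorem sup_perp (hB : Herm B) (hn : Nondeg B) [FiniteDimensional F V] {E : Submodule F V}
    (hE : rad B E = ⊥) : E ⊔ perp B E = ⊤ := by
  refine Submodule.eq_top_of_finrank_eq ?_
  have h1 := Submodule.finrank_sup_add_finrank_inf_eq E (perp B E)
  have h2 := hB.finrank_perp hn E
  have h3 : E ⊓ perp B E = ⊥ := hE
  rw [h3, finrank_bot] at h1
  omega

theorem scale (hB : Herm B) (hn : Nondeg B) [FiniteDimensional F V] {E M : Submodule F V}
    (hE : rad B E = ⊥) (hM : M ≤ E) {u : V} (hu : u ∈ E) (huM : u ∉ M) (hp : ∀ m ∈ M, B m u = 0)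
    {ζ : F} (hζ : ζ * σ ζ = 1) :
    ∃ g : UU B, g ∈ Gam B M ∧ g • u = ζ • u ∧ ∀ h ∈ Gam B E, g * h = h * g := by
  have hζ0 : ζ ≠ 0 := by rintro rfl; rw [zero_mul] at hζ; exact zero_ne_one hζ
  obtain ⟨N, hN⟩ : ∃ N, N = M ⊔ perp B E := ⟨_, rfl⟩
  have huN : u ∉ N := by
    intro h
    rw [hN] at h
    obtain ⟨a, ha, e, he, rfl⟩ := Submodule.mem_sup.1 h
    have he' : e ∈ rad B E := ⟨by
      have : e = (a + e) - a := by abel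
      rw [this]; exact Submodule.sub_mem _ hu (hM ha), he⟩
    rw [hE, Submodule.mem_bot] at he'
    rw [he', add_zero] at huM
    exact huM ha
  have hpN : ∀ m ∈ N, B m u = 0 := by
    intro m hm
    rw [hN] at hm
    obtain ⟨a, ha, e, he, rfl⟩ := Submodule.mem_sup.1 hm
    rw [addB, hp a ha, hB.zero_comm (he u hu), add_zero]
  obtain ⟨φ, hφ1, hφ2⟩ : ∃ φ : V →ₗ[F] F, (∀ d ∈ N, φ d = 0) ∧ φ u = 1 := by
    obtain ⟨φ, h1, h2⟩ := exists_functional huN (1 : F)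
    exact ⟨φ, h1, h2⟩
  obtain ⟨f, hf⟩ : ∃ f : V →ₗ[F] V, f = LinearMap.id + (ζ - 1) • φ.smulRight u := ⟨_, rfl⟩
  have hfv : ∀ v, f v = v + (ζ - 1) • φ v • u := by intro v; rw [hf]; rfl
  have hfm : ∀ m ∈ N, ∀ c : F, f (m + c • u) = m + (c * ζ) • u := by
    intro m hm c
    rw [hfv, map_add, map_smul, hφ1 m hm, hφ2, zero_add, smul_eq_mul, mul_one, smul_smul, add_assoc,
      ← add_smul]
    congr 2; ring
  have hiso : IsoOn B B (N ⊔ F ∙ u) f := by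
    constructor
    · intro x hx y hy
      obtain ⟨m, hm, c, rfl⟩ := mem_sup_span.1 hx
      obtain ⟨m', hm', c', rfl⟩ := mem_sup_span.1 hy
      rw [hfm m hm, hfm m' hm']
      have e1 := hpN m hm
      have e2 := hB.zero_comm (hpN m' hm')
      simp only [map_add, LinearMap.add_apply, smulB, Bsmul, e1, e2, map_mul]
      linear_combination (σ c * c' * B u u) * hζ
    · intro x hx h0
      obtain ⟨m, hm, c, rfl⟩ := mem_sup_span.1 hx
      rw [hfm m hm] at h0
      have h1 := congrArg φ h0
      rw [map_add, map_smul, hφ1 m hm, hφ2, map_zero, zero_add, smul_eq_mul, mul_one] at h1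
      have hc : c = 0 := (mul_eq_zero.1 h1).resolve_right hζ0
      rw [hc, zero_mul, zero_smul, add_zero] at h0
      rw [h0, hc, zero_smul, add_zero]
  obtain ⟨g, hg⟩ := witt hB hn hiso
  have hgN : ∀ m ∈ N, g • m = m := by
    intro m hm
    rw [hg m (Submodule.mem_sup_left hm)]
    have := hfm m hm 0
    rwa [zero_smul, zero_mul, zero_smul, add_zero] at this
  have hgp : ∀ e ∈ perp B E, g • e = e := fun e he =>
    hgN e (by rw [hN]; exact Submodule.mem_sup_right he)
  refine ⟨g, fun m hm => hgN m (by rw [hN]; exact Submodule.mem_sup_left hm), ?_, ?_⟩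
  · rw [hg u (Submodule.mem_sup_right (Submodule.mem_span_singleton_self u))]
    have := hfm 0 (Submodule.zero_mem _) 1
    rwa [one_smul, zero_add, one_mul, zero_add] at this
  · intro h hh
    have hgE : ∀ v ∈ E, g • v ∈ E := by
      intro v hv
      have : g • v ∈ perp B (perp B E) := by
        rw [mem_perp]
        intro e he
        rw [← hgp e he, UU.iso]
        exact hB.zero_comm (he v hv)
      rwa [hB.perp_perp hn] at this
    have hhp : ∀ v ∈ perp B E, h • v ∈ perp B E := by
      intro v hv
      rw [mem_perp]
      intro e he
      rw [← hh e he, UU.iso]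
      exact hv e he
    apply Subtype.ext
    apply LinearEquiv.ext
    intro v
    show g • h • v = h • g • v
    have hv : v ∈ E ⊔ perp B E := by rw [sup_perp hB hn hE]; trivial
    obtain ⟨a, ha, e, he, rfl⟩ := Submodule.mem_sup.1 hv
    have t1 : h • a = a := hh a ha
    have t2 : h • g • a = g • a := hh _ (hgE a ha)
    rw [UU.smul_add, UU.smul_add, UU.smul_add, UU.smul_add, t1, t2, hgp e he, hgp _ (hhp e he)]

variable (B) in
/-- the vanishing statement -/
def Vd (k : Type) [Field k] (j : ℕ) : Prop :=
  ∀ D : Submodule F V, kap B D + (2 * j + 1) ≤ finrank F V → Vanish k (Gam B D) j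

variable (B) in
/-- the surjectivity statement -/
def Sd (k : Type) [Field k] (j : ℕ) : Prop :=
  ∀ (D : Submodule F V) (r w : V), r ∈ rad B D → B r w ≠ 0 → kap B D + 2 * j ≤ finrank F V + 1 →
    Onto k (Gam B (D ⊔ F ∙ w)) (Gam B D) j

theorem hull (hB : Herm B) (hn : Nondeg B) [FiniteDimensional F V] {k : Type} [Field k] {j : ℕ}
    (hS : Sd B k j) : ∀ (N : ℕ) (D : Submodule F V), finrank F (rad B D) = N →
    kap B D + 2 * j ≤ finrank F V + 1 →
    ∃ E, D ≤ E ∧ rad B E = ⊥ ∧ kap B E = kap B D ∧ Onto k (Gam B E) (Gam B D) j := by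
  intro N
  induction N using Nat.strong_induction_on with
  | _ N ih =>
    intro D hN hk
    by_cases h0 : rad B D = ⊥
    · exact ⟨D, le_rfl, h0, rfl, Onto.rfl'⟩
    · obtain ⟨r, hr, hr0⟩ := Submodule.exists_mem_ne_zero_of_ne_bot h0
      obtain ⟨w, hw⟩ := exists_pair hB hn hr0
      have hlt := Submodule.finrank_lt_finrank_of_lt (hB.rad_pair_lt hr hw)
      have hkap := hB.kap_pair hr hw
      obtain ⟨E, h1, h2, h3, h4⟩ := ih _ (by rw [← hN]; exact hlt) (D ⊔ F ∙ w) rfl (by rw [hkap]; exact hk)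
      exact ⟨E, le_sup_left.trans h1, h2, h3.trans hkap,
        Onto.trans (Gam_anti le_sup_left) h4 (hS D r w hr hw hk)⟩

theorem kap_Okx (hB : Herm B) [FiniteDimensional F V] {D : Submodule F V} {x0 r : V}
    (hr : r ∈ rad B D) (hrx : B r x0 = 1) {s : List V} (hs : s ∈ Okx B D x0) (p : ℕ)
    (hl : s.length = p + 1) : kap B (Dt D s) ≤ kap B D + 2 * p := by
  cases s with
  | nil => simp at hl
  | cons v s =>
    rw [Dt_cons']
    have h1 := kap_Dt_le hB (D ⊔ F ∙ v) s
    rw [hB.kap_pair hr (by rw [(hs.1 v (by simp)).1 r hr.1, hrx]; exact one_ne_zero)] at h1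
    simp only [List.length_cons] at hl
    have : s.length = p := by omega
    rwa [this] at h1

theorem row_one (hB : Herm B) (hn : Nondeg B) [FiniteDimensional F V] {k : Type} [Field k]
    {D : Submodule F V} {x0 r : V} (hr : r ∈ rad B D) (hrx : B r x0 = 1) (j : ℕ)
    (hk : kap B D + 2 * (1 + j) ≤ finrank F V + 1) (hV : Vd B k j) (hS : Sd B k j)
    {t : List V} (ht : t ∈ OkL (Okx B D x0) (1 + 1)) {a : List (UU B) →₀ k}
    (ha : a ∈ Cyc k (Gam B (Dt D t)) j) :
    dX k (List (UU B)) V (tn k a (Finsupp.single t 1)) ∈ ZS k (Gam B D) (Okx B D x0) 1 j := by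
  obtain ⟨E, hE1, hE2, hE3, hE4⟩ := hull hB hn hS _ (Dt D t) rfl (by
    have := kap_Okx hB hr hrx ht.1 1 ht.2
    omega)
  obtain ⟨b, hb, hab⟩ := hE4 a ha
  have e0 : tn k a (Finsupp.single t 1) = tn k (a - b) (Finsupp.single t 1) + tn k b (Finsupp.single t 1) := by
    rw [map_sub, LinearMap.sub_apply, sub_add_cancel]
  rw [e0, map_add]
  refine Submodule.add_mem _ (ZS_Bd Okx_sub ht (by rw [Gam_stab]; exact hab)) ?_
  obtain ⟨x, y, rfl⟩ : ∃ x y, t = [x, y] := by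
    have := ht.2
    match t, this with
    | [x, y], _ => exact ⟨x, y, rfl⟩
  obtain ⟨hxD, hxx⟩ := ht.1.1 x (by simp)
  obtain ⟨hyD, hyy⟩ := ht.1.1 y (by simp)
  have hxE : x ∈ E := hE1 (mem_Dt (by simp))
  have hyE : y ∈ E := hE1 (mem_Dt (by simp))
  have hDE : D ≤ E := (le_Dt _ _).trans hE1
  have hrD : r ∈ D := hr.1
  have hrr : B r r = 0 := hr.2 r hr.1
  have hrr' : ∀ d ∈ D, B d r = 0 := hr.2
  -- points differing by an element of D are equivalent
  have step1 : ∀ v v', (∀ d ∈ D, B d v = B d x0) → B v v = 0 → (∀ d ∈ D, B d v' = B d x0) →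
      B v' v' = 0 → v ∈ E → v' - v ∈ D →
      tn k b (Finsupp.single [v'] 1 - Finsupp.single [v] 1) ∈ ZS k (Gam B D) (Okx B D x0) 1 j := by
    intro v v' hv hvv hv' hvv' hvE hd
    have hbv : b ∈ Bd k (Gam B (D ⊔ F ∙ v)) j := by
      refine hV _ ?_ (Cyc_mono (Gam_anti ?_) j hb)
      · rw [hB.kap_pair hr (by rw [hv r hrD, hrx]; exact one_ne_zero)]; omega
      · exact sup_le hDE ((Submodule.span_singleton_le_iff_mem _ _).2 hvE)
    refine ZS_two (Okx_single hB hr hrx hv hvv) (Okx_single hB hr hrx hv' hvv')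
      (K := Gam B (D ⊔ F ∙ v)) (Gam_anti le_sup_left) ?_ ?_ hbv
    · intro h hh; exact (Gam_mem_sup_span.1 hh).2
    · intro h hh
      refine hh v' ?_
      have : v' = (v' - v) + v := by abel
      rw [this]
      exact Submodule.add_mem _ (Submodule.mem_sup_left hd)
        (Submodule.mem_sup_right (Submodule.mem_span_singleton_self v))
  -- moving by a group element commuting with Γ(E)
  have step2 : ∀ (g : UU B) (z : V), g ∈ Gam B D → (∀ h ∈ Gam B E, g * h = h * g) → g • z = z →
      (∀ d ∈ D, B d z = B d x0) → B z z = 0 → z ∈ E →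
      tn k b (Finsupp.single [g • x] 1 - Finsupp.single [x] 1) ∈ ZS k (Gam B D) (Okx B D x0) 1 j := by
    intro g z hg hc hgz hz hzz hzE
    have h1 := comm_smul g⁻¹ (fun h hh => by
      have := hc h hh
      rw [inv_mul_eq_iff_eq_mul, ← mul_assoc, this, mul_inv_cancel_right]) hb
    have h2 : tn k (pf k (fun x => g⁻¹ • x) b - b) (Finsupp.single [x] 1 - Finsupp.single [z] 1) ∈
        ZS k (Gam B D) (Okx B D x0) 1 j := by
      refine ZS_two (Okx_single hB hr hrx hz hzz) (Okx_single hB hr hrx hxD hxx) (Gam_anti hDE) ?_ ?_ h1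
      · intro h hh; exact hh z hzE
      · intro h hh; exact hh x hxE
    have h3 := pf_smul_sub (k := k) hg (tn k (pf k (fun x => g⁻¹ • x) b)
      (Finsupp.single [x] 1 - Finsupp.single [z] 1))
    rw [smul_tn, pf_pf] at h3
    have e1 : pf k ((fun x => g • x) ∘ fun x => g⁻¹ • x) b = b := by
      have : ((fun x => g • x) ∘ fun x => g⁻¹ • x : List (UU B) → List (UU B)) = id := by
        funext x; simp
      rw [this]; exact Finsupp.mapDomain_id
    have e2 : pf k (fun x : List V => g • x) (Finsupp.single [x] 1 - Finsupp.single [z] 1) =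
        Finsupp.single [g • x] 1 - Finsupp.single [z] 1 := by
      rw [map_sub, pf_single, pf_single, smul_list_cons, smul_list_cons, smul_list_nil, hgz]
    rw [e1, e2] at h3
    have h4 := Submodule.add_mem _ (ZS_co (Ok := Okx B D x0) (p := 1) (j := j) h3) h2
    convert h4 using 1
    simp only [map_sub, LinearMap.sub_apply]
    abel
  obtain ⟨ζ, hζ, hζ1⟩ := hB.hf.unit
  have hζ1' : ζ - 1 ≠ 0 := sub_ne_zero.2 hζ1
  obtain ⟨s, hs⟩ : ∃ s, s = (ζ - 1)⁻¹ := ⟨_, rfl⟩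
  have hs1 : s * (ζ - 1) = 1 := by rw [hs]; exact inv_mul_cancel₀ hζ1'
  have hs0 : s ≠ 0 := by rintro rfl; rw [zero_mul] at hs1; exact zero_ne_one hs1
  obtain ⟨z0, hz0⟩ : ∃ z0, z0 = x - s • (y - x) := ⟨_, rfl⟩
  have hz0D : ∀ d ∈ D, B d z0 = B d x0 := by
    intro d hd
    rw [hz0, map_sub, Bsmul, map_sub, hxD d hd, hyD d hd]; ring
  obtain ⟨c, hc⟩ := hB.hf.trace_surj (- B z0 z0) (by rw [map_neg, hB.fix])
  obtain ⟨z, hz⟩ : ∃ z, z = z0 + c • r := ⟨_, rfl⟩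
  have hrz0 : B r z0 = 1 := by rw [hz0D r hrD, hrx]
  have hz0r : B z0 r = 1 := by rw [hB.symm r, hrz0, map_one]
  have hzD : ∀ d ∈ D, B d z = B d x0 := by
    intro d hd
    rw [hz, map_add, Bsmul, hrr' d hd, hz0D d hd]; ring
  have hzz : B z z = 0 := by
    rw [hz]
    simp only [map_add, LinearMap.add_apply, smulB, Bsmul, hrz0, hz0r, hrr]
    linear_combination hc
  have hzr : B z r = 1 := by rw [hB.symm r, hzD r hrD, hrx, map_one]
  have hzE : z ∈ E := by
    rw [hz, hz0]
    exact Submodule.add_mem _ (Submodule.sub_mem _ hxE (Submodule.smul_mem _ _ (Submodule.sub_mem _ hyE hxE)))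
      (Submodule.smul_mem _ _ (hDE hrD))
  obtain ⟨μ, hμ⟩ : ∃ μ, μ = - B z x := ⟨_, rfl⟩
  obtain ⟨u, hu⟩ : ∃ u, u = x - z + μ • r := ⟨_, rfl⟩
  have huE : u ∈ E := by
    rw [hu]
    exact Submodule.add_mem _ (Submodule.sub_mem _ hxE hzE) (Submodule.smul_mem _ _ (hDE hrD))
  have huD : ∀ d ∈ D, B d u = 0 := by
    intro d hd
    rw [hu, map_add, map_sub, Bsmul, hrr' d hd, hxD d hd, hzD d hd]; ring
  have huz : B z u = 0 := by
    rw [hu, map_add, map_sub, Bsmul, hzr, hzz, hμ]; ring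
  have hup : ∀ m ∈ D ⊔ F ∙ z, B m u = 0 := by
    intro m hm
    obtain ⟨d, hd, a, rfl⟩ := mem_sup_span.1 hm
    rw [addB, smulB, huD d hd, huz]; ring
  have hune : u ∉ D ⊔ F ∙ z := by
    intro h
    obtain ⟨d, hd, a, e⟩ := mem_sup_span.1 h
    have h1 : a = 0 := by
      have h2 : B r u = 0 := huD r hrD
      rw [e, map_add, Bsmul, hzD r hrD, hrx] at h2
      have h3 : B r d = 0 := hB.zero_comm (hrr' d hd)
      rw [h3] at h2
      linear_combination h2
    rw [h1, zero_smul, add_zero] at e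
    -- so y - x ∈ D
    have h4 : s • (y - x) ∈ D := by
      have : s • (y - x) = u + (c - μ) • r := by
        rw [hu, hz, hz0, sub_smul]; abel
      rw [this, e]
      exact Submodule.add_mem _ hd (Submodule.smul_mem _ _ hrD)
    have h5 : y - x ∈ D := by
      have := Submodule.smul_mem D s⁻¹ h4
      rwa [smul_smul, inv_mul_cancel₀ hs0, one_smul] at this
    have h6 : x ∉ Dt D [y] := ht.1.2.1
    refine h6 ?_
    have : x = y - (y - x) := by abel
    rw [this]
    exact Submodule.sub_mem _ (mem_Dt (by simp)) (le_Dt _ _ h5)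
  obtain ⟨g, hg1, hg2, hg3⟩ := scale hB hn hE2 (sup_le hDE ((Submodule.span_singleton_le_iff_mem _ _).2 hzE))
    huE hune hup hζ
  have hgD : g ∈ Gam B D := Gam_anti le_sup_left hg1
  have hgz : g • z = z := (Gam_mem_sup_span.1 hg1).2
  have hgx : g • x = z + ζ • u - μ • r := by
    have : x = z + u + (- μ) • r := by rw [hu, neg_smul]; abel
    conv_lhs => rw [this]
    have h1 : g • r = r := hgD r hrD
    rw [UU.smul_add, UU.smul_add, UU.smul_smul, hgz, hg2, h1, neg_smul]; abel
  have hgxD : ∀ d ∈ D, B d (g • x) = B d x0 := by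
    intro d hd
    have h1 : g • d = d := hgD d hd
    rw [← hxD d hd]
    conv_lhs => rw [← h1]
    exact UU.iso g d x
  have hgxx : B (g • x) (g • x) = 0 := by rw [UU.iso, hxx]
  have hyg : y - g • x ∈ D := by
    have h1 : y = x + (ζ - 1) • (s • (y - x)) := by
      rw [smul_smul, mul_comm, hs1, one_smul]; abel
    have h2 : s • (y - x) = u + (c - μ) • r := by
      rw [hu, hz, hz0, sub_smul]; abel
    have h3 : y - g • x = ((ζ - 1) * (c - μ)) • r := by
      rw [hgx]
      rw [h2] at h1
      have : x = z + u + (- μ) • r := by rw [hu, neg_smul]; abel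
      rw [h1, this]
      module
    rw [h3]; exact Submodule.smul_mem _ _ hrD
  have hgE : g • x ∈ E := by
    have : g • x = y - (y - g • x) := by abel
    rw [this]; exact Submodule.sub_mem _ hyE (hDE hyg)
  have A1 := step2 g z hgD hg3 hgz hzD hzz hzE
  have A2 := step1 (g • x) y hgxD hgxx hyD hyy hgE hyg
  have A3 := Submodule.add_mem _ A1 A2
  rw [liftR_tn, del_cons', del_cons', del_nil]
  convert A3 using 1
  simp only [map_sub, LinearMap.sub_apply, map_zero, pf_single]
  abel

end Rows

end UEH

namespace UEH

section Step

open Module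

variable {F : Type} [Field F] {σ : F →+* F}
variable {V : Type} [AddCommGroup V] [Module F V] {B : V →ₛₗ[σ] V →ₗ[F] F}

theorem row_ge_two (hB : Herm B) (hn : Nondeg B) [FiniteDimensional F V] [Finite F]
    (hQ : 9 ≤ Nat.card F) {k : Type} [Field k]
    {D : Submodule F V} {x0 r : V} (hr : r ∈ rad B D) (hrx : B r x0 = 1) (p j : ℕ) (hp : 2 ≤ p)
    (hk : kap B D + 2 * (p + j) ≤ finrank F V + 1) (hV : Vd B k j) (hS : Sd B k j)
    {t : List V} (ht : t ∈ OkL (Okx B D x0) (p + 1)) {a : List (UU B) →₀ k}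
    (ha : a ∈ Cyc k (Gam B (Dt D t)) j) :
    dX k (List (UU B)) V (tn k a (Finsupp.single t 1)) ∈ ZS k (Gam B D) (Okx B D x0) p j := by
  by_cases hm : kap B (Dt D t) + (2 * j + 1) ≤ finrank F V
  · exact ZS_Bd Okx_sub ht (by rw [Gam_stab]; exact hV _ hm ha)
  have hkt := kap_Okx hB hr hrx ht.1 p ht.2
  have ht0 : t ≠ [] := by
    rintro rfl
    have := ht.2
    simp at this
  have hrd := rad_Dt_inf hB hr hrx ht0 (fun v hv => (ht.1.1 v hv).1)
  have hdim := ht.1.2.finrank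
  rw [ht.2] at hdim
  have he : finrank F ↥(rad B (Dt D t) ⊓ D) + p ≤ finrank F (rad B (Dt D t)) + 1 := by
    unfold kap at hk hm
    omega
  obtain ⟨u, hu1, hu2, ⟨y, hy, hyu⟩, hu4⟩ := Gen hB hn hQ hr hrx ht.1.2
    (fun v hv => (ht.1.1 v hv).1) p ht.2 (by omega) (by omega)
  have hut : u ∉ Dt D t := notMem_of_pair hB hy hyu
  obtain ⟨b, hb, hab⟩ := hS (Dt D t) y u hy hyu (by omega) a ha
  have e0 : tn k a (Finsupp.single t 1) = tn k (a - b) (Finsupp.single t 1) + tn k b (Finsupp.single t 1) := by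
    rw [map_sub, LinearMap.sub_apply, sub_add_cancel]
  rw [e0, map_add]
  refine Submodule.add_mem _ (ZS_Bd Okx_sub ht (by rw [Gam_stab]; exact hab)) ?_
  have e1 : dX k (List (UU B)) V (tn k b (Finsupp.single t 1)) =
      dX k (List (UU B)) V (tn k b (pf k (List.cons u) (del k (Finsupp.single t 1)))) := by
    rw [liftR_tn, liftR_tn, del_cons, del_del, map_zero, sub_zero]
  rw [e1]
  refine sp_map (dX k (List (UU B)) V ∘ₗ tn k b ∘ₗ pf k (List.cons u)) ?_ (del_single_sp (k := k) t)
  rintro s ⟨hs1, hs2⟩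
  rw [LinearMap.comp_apply, LinearMap.comp_apply, pf_single]
  have hslen : s.length = p := by have := ht.2; omega
  have hsub : Dt D s ≤ Dt D t := Dt_mono le_rfl (fun x hx => hs1.subset hx)
  have hus : u :: s ∈ OkL (Okx B D x0) (p + 1) := by
    refine ⟨⟨?_, fun h => hut (hsub h), ht.1.2.sublist hs1⟩, by simp [hslen]⟩
    intro v hv
    rcases List.mem_cons.1 hv with rfl | hv
    · exact ⟨hu1, hu2⟩
    · exact ht.1.1 v (hs1.subset hv)
  refine ZS_Bd Okx_sub hus ?_
  rw [Gam_stab]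
  refine hV _ ?_ (Cyc_mono (Gam_anti ?_) j hb)
  · obtain ⟨v, hv⟩ := facet_perm hs1 hs2
    have h5 := hu4 v s hv
    have h6 := kap_Okx hB hr hrx (Okx_sub t ht.1 s hs1) (p - 1) (by omega)
    omega
  · rw [Dt_cons]
    exact sup_le_sup_right hsub _

theorem S_step (hB : Herm B) (hn : Nondeg B) [FiniteDimensional F V] [Finite F]
    (hQ : 9 ≤ Nat.card F) {k : Type} [Field k] (d : ℕ) (hd : 2 ≤ d)
    (hV : ∀ j, 1 ≤ j → j < d → Vd B k j) (hS : ∀ j, 1 ≤ j → j < d → Sd B k j) : Sd B k d := by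
  intro D r w hr hrw hk
  -- normalize
  obtain ⟨w', hw'⟩ : ∃ w', w' = (B r w)⁻¹ • w := ⟨_, rfl⟩
  have hrw' : B r w' = 1 := by rw [hw', Bsmul, inv_mul_cancel₀ hrw]
  have hwr' : B w' r = 1 := by rw [hB.symm r, hrw', map_one]
  have hrr : B r r = 0 := hr.2 r hr.1
  obtain ⟨c, hc⟩ := hB.hf.trace_surj (- B w' w') (by rw [map_neg, hB.fix])
  obtain ⟨x0, hx0⟩ : ∃ x0, x0 = w' + c • r := ⟨_, rfl⟩
  have hrx : B r x0 = 1 := by rw [hx0, map_add, Bsmul, hrr, hrw']; ring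
  have hxx : B x0 x0 = 0 := by
    rw [hx0]
    simp only [map_add, LinearMap.add_apply, smulB, Bsmul, hrw', hwr', hrr]
    linear_combination hc
  have hsup : D ⊔ F ∙ w ≤ D ⊔ F ∙ x0 := by
    refine sup_le le_sup_left ((Submodule.span_singleton_le_iff_mem _ _).2 ?_)
    have : w = (B r w) • (x0 - c • r) := by
      rw [hx0, add_sub_cancel_right, hw', smul_smul, mul_inv_cancel₀ hrw, one_smul]
    rw [this]
    exact Submodule.smul_mem _ _ (Submodule.sub_mem _
      (Submodule.mem_sup_right (Submodule.mem_span_singleton_self _))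
      (Submodule.smul_mem _ _ (Submodule.mem_sup_left hr.1)))
  intro a ha
  obtain ⟨S, b, hS1, hb, hab⟩ := Elim (k := k) (Gam B D) (Okx B D x0) Okx_sub Okx_smul Okx_nil d
    (fun p hp z hz h0 => Okx_hex hB hn hr hrx hxx p (by omega) z hz h0)
    (R0 hB hn hQ hr hrx d hd hk)
    (fun p j hp hpj t ht a ha => by
      refine mem_ZS.1 ?_
      rcases Nat.eq_zero_or_pos j with rfl | hj
      · exact ZS_Bd Okx_sub ht (Vanish_zero _ ha)
      · rw [Gam_stab] at ha
        have hk' : kap B D + 2 * (p + j) ≤ finrank F V + 1 := by rw [hpj]; exact hk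
        by_cases h1 : p = 1
        · subst h1
          exact row_one hB hn hr hrx j hk' (hV j hj (by omega)) (hS j hj (by omega)) ht ha
        · exact row_ge_two hB hn hQ hr hrx p j (by omega) hk' (hV j hj (by omega)) (hS j hj (by omega)) ht ha)
    a ha
  have key : ∀ t ∈ S, ∃ b' ∈ Cyc k (Gam B (D ⊔ F ∙ w)) d, b' - b t ∈ co k (Gam B D) (List (UU B)) := by
    intro t ht
    have hx1 := Okx_single hB hr hrx (fun _ _ => rfl) hxx
    have ht1 := hS1 t ht
    obtain ⟨v, rfl⟩ : ∃ v, t = [v] := List.length_eq_one_iff.1 ht1.2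
    obtain ⟨g, hg, hgv⟩ := witt_lists hB hn ht1.1.2 hx1.1.2 (by
        show [[B v v]] = [[B x0 x0]]
        rw [(ht1.1.1 v (by simp)).2, hxx])
      (fun x hx x' hx' d hd => by rw [(ht1.1.1 x hx).1 d hd, (hx1.1.1 x' hx').1 d hd])
    refine ⟨pf k (fun x => g • x) (b [v]), ?_, pf_smul_sub hg _⟩
    refine Cyc_mono (Gam_anti hsup) d (Cyc_conj (H := Gam B D ⊓ MulAction.stabilizer (UU B) [v]) g ?_ (hb [v]))
    intro h hh
    have h1 : Gam B (D ⊔ F ∙ x0) = Gam B D ⊓ MulAction.stabilizer (UU B) [x0] := by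
      rw [Gam_stab, Dt_cons, Dt_nil]
    rw [h1]
    refine ⟨(Gam B D).mul_mem ((Gam B D).mul_mem hg hh.1) ((Gam B D).inv_mem hg), ?_⟩
    show (g * h * g⁻¹) • [x0] = [x0]
    rw [← hgv, smul_smul, inv_mul_cancel_right, mul_smul,
      MulAction.mem_stabilizer_iff.1 hh.2]
  choose! b' hb1 hb2 using key
  refine ⟨∑ t ∈ S, b' t, Submodule.sum_mem _ hb1, Submodule.mem_sup_left ?_⟩
  have : a - ∑ t ∈ S, b' t = (a - ∑ t ∈ S, b t) - ∑ t ∈ S, (b' t - b t) := by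
    rw [Finset.sum_sub_distrib]; abel
  rw [this]
  exact Submodule.sub_mem _ hab (Submodule.sum_mem _ hb2)

end Step

end UEH

namespace UEH

section VStep

open Module

variable {F : Type} [Field F] {σ : F →+* F}
variable {V : Type} [AddCommGroup V] [Module F V] {B : V →ₛₗ[σ] V →ₗ[F] F}

variable (B) in
/-- projection off a hyperbolic plane -/
noncomputable def hproj (r x : V) : V →ₗ[F] V :=
  LinearMap.id - (B r).smulRight x - (B x).smulRight r

theorem hproj_apply (r x v : V) : hproj B r x v = v - B r v • x - B x v • r := rfl

theorem exists_pr (hB : Herm B) {r x : V} (hrr : B r r = 0) (hxx : B x x = 0) (hrx : B r x = 1)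
    (H : Subgroup (UU B)) (hH : ∀ h ∈ H, h • r = r) :
    ∃ φ : ↥H →* UU B, ∀ h v, φ h • v = (v - hproj B r x v) + hproj B r x ((h : UU B) • hproj B r x v) := by
  have hxr : B x r = 1 := by rw [hB.symm r, hrx, map_one]
  obtain ⟨π, hπ⟩ : ∃ π, π = hproj B r x := ⟨_, rfl⟩
  have hπv : ∀ v, π v = v - B r v • x - B x v • r := fun v => by rw [hπ, hproj_apply]
  have hπr : π r = 0 := by rw [hπv, hrr, hxr]; simp
  have hπx : π x = 0 := by rw [hπv, hxx, hrx]; simp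
  have hrπ : ∀ v, B r (π v) = 0 := fun v => by
    rw [hπv, map_sub, map_sub, Bsmul, Bsmul, hrr, hrx]; ring
  have hxπ : ∀ v, B x (π v) = 0 := fun v => by
    rw [hπv, map_sub, map_sub, Bsmul, Bsmul, hxr, hxx]; ring
  have hππ : ∀ v, π (π v) = π v := fun v => by
    rw [hπv (π v), hrπ, hxπ]; simp
  have hrh : ∀ h ∈ H, ∀ v, B r (h • π v) = 0 := by
    intro h hh v
    have h1 : h • r = r := hH h hh
    conv_lhs => rw [← h1]
    rw [UU.iso, hrπ]
  -- h (π v) = π (h π v) + c r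
  have hdec : ∀ h ∈ H, ∀ v, h • π v = π (h • π v) + B x (h • π v) • r := by
    intro h hh v
    conv_rhs => rw [hπv (h • π v), hrh h hh]
    simp
  obtain ⟨L, hL⟩ : ∃ L : UU B → V →ₗ[F] V,
    L = fun h => (LinearMap.id - π) + π ∘ₗ (h.1 : V →ₗ[F] V) ∘ₗ π := ⟨_, rfl⟩
  have hLv : ∀ h v, L h v = (v - π v) + π (h • π v) := fun h v => by rw [hL]; rfl
  have hπL : ∀ h v, π (L h v) = π (h • π v) := by
    intro h v
    rw [hLv, map_add, map_sub, hππ, hππ, sub_self, zero_add]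
  have hmul : ∀ h ∈ H, ∀ h' ∈ H, ∀ v, L (h * h') v = L h (L h' v) := by
    intro h hh h' hh' v
    rw [hLv, hLv h, hπL, hLv h']
    have h1 : (h * h') • π v = h • π (h' • π v) + B x (h' • π v) • r := by
      rw [mul_smul]
      conv_lhs => rw [hdec h' hh' v]
      rw [UU.smul_add, UU.smul_smul, hH h hh]
    have h2 : π (B x (h' • π v) • r) = 0 := by rw [LinearMap.map_smul π _ r, hπr, smul_zero]
    rw [h1, map_add, h2, add_zero]
    abel
  have hone : ∀ v, L 1 v = v := by
    intro v
    rw [hLv, one_smul, hππ]; abel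
  have hLiso : ∀ h ∈ H, ∀ v w, B (L h v) (L h w) = B v w := by
    intro h hh v w
    have h1 : B (π (h • π v)) (π (h • π w)) = B (π v) (π w) := by
      have h2 := UU.iso h (π v) (π w)
      rw [hdec h hh v, hdec h hh w] at h2
      have e1 := hrπ (h • π w)
      have e2 := hB.zero_comm (hrπ (h • π v))
      simp only [map_add, LinearMap.add_apply, smulB, Bsmul, hrr, e1, e2] at h2
      linear_combination h2
    have hx1 : ∀ v w, B (v - π v) (π w) = 0 := by
      intro v w
      have : v - π v = B r v • x + B x v • r := by rw [hπv]; abel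
      rw [this, addB, smulB, smulB, hrπ, hxπ]; ring
    have hx2 : ∀ v w, B (π v) (w - π w) = 0 := fun v w => hB.zero_comm (hx1 w v)
    have e3 : B v w = B (v - π v) (w - π w) + B (π v) (π w) := by
      have h3 := hx1 v w
      have h4 := hx2 v w
      simp only [map_sub, LinearMap.sub_apply] at h3 h4 ⊢
      linear_combination h3 + h4
    rw [e3, hLv, hLv]
    simp only [map_add, LinearMap.add_apply]
    rw [h1, hx1, hx2]; ring
  obtain ⟨φ0, hφ0⟩ : ∃ φ0 : ↥H → UU B, ∀ h v, φ0 h • v = L h v := by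
    refine ⟨fun h => ⟨LinearEquiv.ofLinear (L h) (L (h : UU B)⁻¹) ?_ ?_, ?_⟩, fun h v => rfl⟩
    · ext v
      show L h (L (h : UU B)⁻¹ v) = v
      rw [← hmul h h.2 _ (H.inv_mem h.2), mul_inv_cancel, hone]
    · ext v
      show L (h : UU B)⁻¹ (L h v) = v
      rw [← hmul _ (H.inv_mem h.2) h h.2, inv_mul_cancel, hone]
    · exact fun v w => hLiso h h.2 v w
  have hext : ∀ g g' : UU B, (∀ v, g • v = g' • v) → g = g' := fun g g' h =>
    Subtype.ext (LinearEquiv.ext h)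
  refine ⟨⟨⟨φ0, ?_⟩, ?_⟩, ?_⟩
  · exact hext _ _ (fun v => by rw [hφ0, one_smul]; exact hone v)
  · exact fun a b => hext _ _ (fun v => by rw [hφ0, mul_smul, hφ0, hφ0]; exact hmul a a.2 b b.2 v)
  · intro h v
    have := hφ0 h v
    rw [hLv, hπ] at this
    exact this

theorem V_degen (hB : Herm B) (hn : Nondeg B) [FiniteDimensional F V] {k : Type} [Field k] {d : ℕ}
    (hS : Sd B k d) {D E : Submodule F V} (hD : rad B D = ⊥)
    (hk : kap B D + (2 * d + 1) ≤ finrank F V) (hDE : D ≤ E) (hE : rad B E ≠ ⊥)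
    (ih : ∀ E' : Submodule F V, E < E' → Cyc k (Gam B E') d ≤ Bd k (Gam B D) d) :
    Cyc k (Gam B E) d ≤ Bd k (Gam B D) d := by
  obtain ⟨r, hr, hr0⟩ := Submodule.exists_mem_ne_zero_of_ne_bot hE
  have hrr : B r r = 0 := hr.2 r hr.1
  have hrD : r ∉ D := by
    intro h
    have : r ∈ rad B D := ⟨h, fun e he => hr.2 e (hDE he)⟩
    rw [hD, Submodule.mem_bot] at this
    exact hr0 this
  obtain ⟨φ, hφ1, hφ2⟩ := exists_functional hrD (1 : F)
  obtain ⟨x', hx'⟩ := hB.rep_top hn φ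
  have hx'v : ∀ v, B x' v = φ v := fun v => by rw [hx']
  have hx'r : B x' r = 1 := by rw [hx'v, hφ2]
  have hrx' : B r x' = 1 := by rw [hB.symm x', hx'r, map_one]
  obtain ⟨c, hc⟩ := hB.hf.trace_surj (- B x' x') (by rw [map_neg, hB.fix])
  obtain ⟨x, hx⟩ : ∃ x, x = x' + c • r := ⟨_, rfl⟩
  have hrx : B r x = 1 := by rw [hx, map_add, Bsmul, hrr, hrx']; ring
  have hxx : B x x = 0 := by
    rw [hx]
    simp only [map_add, LinearMap.add_apply, smulB, Bsmul, hrx', hx'r, hrr]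
    linear_combination hc
  have hrE : ∀ e ∈ E, B r e = 0 := fun e he => hB.zero_comm (hr.2 e he)
  have hxD : ∀ d ∈ D, B x d = 0 := by
    intro d hd
    rw [hx, addB, smulB, hx'v, hφ1 d hd, hrE d (hDE hd)]; ring
  have hDr : D ⊔ F ∙ r ≤ E := sup_le hDE ((Submodule.span_singleton_le_iff_mem _ _).2 hr.1)
  have hHr : ∀ h ∈ Gam B (D ⊔ F ∙ r), h • r = r := fun h hh => (Gam_mem_sup_span.1 hh).2
  obtain ⟨pr, hpr⟩ := exists_pr hB hrr hxx hrx (Gam B (D ⊔ F ∙ r)) hHr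
  obtain ⟨f, hf⟩ := exists_equivariant (Gam B (D ⊔ F ∙ r)) pr
  have hxE : x ∉ E := by
    intro h
    have := hrE x h
    rw [hrx] at this
    exact one_ne_zero this
  have hπr : hproj B r x r = 0 := by
    rw [hproj_apply, hrr, hB.symm r x, hrx]; simp
  have hπx : hproj B r x x = 0 := by rw [hproj_apply, hxx, hrx]; simp
  have hππ : ∀ v, hproj B r x (hproj B r x v) = hproj B r x v := by
    intro v
    conv_lhs => rw [hproj_apply r x v, map_sub, map_sub, map_smul, map_smul, hπr, hπx]
    simp
  -- pr fixes E' + x when h fixes E', r ∈ E' ≤ E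
  have hprE : ∀ E' : Submodule F V, E' ≤ E → r ∈ E' → ∀ u : ↥(Gam B (D ⊔ F ∙ r)),
      (u : UU B) ∈ Gam B E' → pr u ∈ Gam B (E' ⊔ F ∙ x) := by
    intro E' hE' hrE' u hu
    refine Gam_mem_sup_span.2 ⟨?_, ?_⟩
    · intro e he
      have h1 : hproj B r x e ∈ E' := by
        rw [hproj_apply, hrE e (hE' he), zero_smul, sub_zero]
        exact Submodule.sub_mem _ he (Submodule.smul_mem _ _ hrE')
      have h2 : (u : UU B) • hproj B r x e = hproj B r x e := hu _ h1
      rw [hpr, h2, hππ]; abel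
    · rw [hpr, hπx]
      have : (u : UU B) • (0 : V) = 0 := map_zero (u : UU B).1
      rw [this, map_zero]; abel
  -- pr is the identity on Γ(D + r + x)
  have hprid : ∀ u : ↥(Gam B (D ⊔ F ∙ r)), (u : UU B) • x = x → pr u = u := by
    intro u hu
    apply Subtype.ext
    apply LinearEquiv.ext
    intro v
    show pr u • v = (u : UU B) • v
    have hur : (u : UU B) • r = r := hHr u u.2
    have h1 : hproj B r x ((u : UU B) • hproj B r x v) = (u : UU B) • hproj B r x v := by
      have e1 : B r ((u : UU B) • hproj B r x v) = B r (hproj B r x v) := by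
        have := UU.iso (u : UU B) r (hproj B r x v)
        rwa [hur] at this
      have e2 : B x ((u : UU B) • hproj B r x v) = B x (hproj B r x v) := by
        have := UU.iso (u : UU B) x (hproj B r x v)
        rwa [hu] at this
      rw [hproj_apply r x ((u : UU B) • hproj B r x v), e1, e2]
      have h3 := hππ v
      rw [hproj_apply r x (hproj B r x v)] at h3
      have h4 : B r (hproj B r x v) = 0 := by
        rw [hproj_apply, map_sub, map_sub, Bsmul, Bsmul, hrr, hrx]; ring
      have h5 : B x (hproj B r x v) = 0 := by
        rw [hproj_apply, map_sub, map_sub, Bsmul, Bsmul, hxx, hB.symm r x, hrx, map_one]; ring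
      rw [h4, h5]; simp
    have h6 : (u : UU B) • (v - hproj B r x v) = v - hproj B r x v := by
      have : v - hproj B r x v = B r v • x + B x v • r := by rw [hproj_apply]; abel
      rw [this, UU.smul_add, UU.smul_smul, UU.smul_smul, hur, hu]
    rw [hpr, h1]
    conv_lhs => rw [← h6]
    rw [← UU.smul_add, sub_add_cancel]
  have hkr : kap B (D ⊔ F ∙ r) ≤ kap B D + 2 := by
    have := kap_Dt_le hB D [r]
    rw [Dt_cons, Dt_nil] at this
    simpa using this
  have hrrad : r ∈ rad B (D ⊔ F ∙ r) :=
    ⟨Submodule.mem_sup_right (Submodule.mem_span_singleton_self r), fun e he => hr.2 e (hDr he)⟩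
  have hle1 : Gam B (D ⊔ F ∙ r ⊔ F ∙ x) ≤ Gam B D := Gam_anti (le_sup_left.trans le_sup_left)
  have hle2 : Gam B (D ⊔ F ∙ r) ≤ Gam B D := Gam_anti le_sup_left
  intro a ha
  obtain ⟨b, hb, hab⟩ := hS (D ⊔ F ∙ r) r x hrrad (by rw [hrx]; exact one_ne_zero) (by omega) a
    (Cyc_mono (Gam_anti hDr) d ha)
  have hprD : ∀ u : ↥(Gam B (D ⊔ F ∙ r)), pr u ∈ Gam B (D ⊔ F ∙ r ⊔ F ∙ x) := fun u =>
    hprE (D ⊔ F ∙ r) hDr hrrad.1 u u.2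
  have hFa : pf k (List.map f) a ∈ Bd k (Gam B D) d := by
    refine ih (E ⊔ F ∙ x) (lt_of_le_of_ne le_sup_left ?_) ?_
    · intro h
      refine hxE ?_
      rw [h]
      exact Submodule.mem_sup_right (Submodule.mem_span_singleton_self x)
    · refine pf_map_Cyc (H := Gam B E) f ?_ ha
      intro u hu
      exact ⟨pr ⟨u, Gam_anti hDr hu⟩, hprE E le_rfl hr.1 ⟨u, Gam_anti hDr hu⟩ hu,
        fun y => hf ⟨u, Gam_anti hDr hu⟩ y⟩
  have hFab : pf k (List.map f) (a - b) ∈ Bd k (Gam B D) d :=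
    pf_map_Bd f (fun u hu => ⟨pr ⟨u, hu⟩, hle1 (hprD ⟨u, hu⟩), fun y => hf ⟨u, hu⟩ y⟩) hab
  have hFb : pf k (List.map f) b - pf k (List.map id) b ∈ Bd k (Gam B D) d := by
    refine pr_homologous (H := Gam B (D ⊔ F ∙ r ⊔ F ∙ x)) id f ?_ hb
    intro u hu
    obtain ⟨hu1, hu2⟩ := Gam_mem_sup_span.1 hu
    refine ⟨u, hle1 hu, fun y => rfl, fun y => ?_⟩
    have h1 := hf ⟨u, hu1⟩ y
    rw [hprid ⟨u, hu1⟩ hu2] at h1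
    exact h1
  have e1 : pf k (List.map (id : UU B → UU B)) b = b := by
    rw [List.map_id_fun]; exact Finsupp.mapDomain_id
  rw [e1] at hFb
  have e2 : a = (a - b) + pf k (List.map f) a - pf k (List.map f) (a - b) -
      (pf k (List.map f) b - b) := by
    rw [map_sub]; abel
  rw [e2]
  exact Submodule.sub_mem _ (Submodule.sub_mem _ (Submodule.add_mem _ (Bd_mono hle2 d hab) hFa) hFab) hFb

theorem Vanish_bot {G : Type} [Group G] {k : Type} [Field k] (j : ℕ) :
    Vanish k (⊥ : Subgroup G) j := by
  rintro b ⟨hb1, hb2⟩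
  have h0 : del k b = 0 := by
    have h1 : del k b ∈ co k (⊥ : Subgroup G) (List G) := hb2
    have h2 : (LinearMap.id : (List G →₀ k) →ₗ[k] (List G →₀ k)) (del k b) ∈
        (⊥ : Submodule k (List G →₀ k)) := by
      refine co_map LinearMap.id ?_ h1
      intro h hh x
      rw [Subgroup.mem_bot] at hh
      rw [hh, one_smul, sub_self]
      exact Submodule.zero_mem _
    exact (Submodule.mem_bot k).1 h2
  refine Submodule.mem_sup_right ⟨pf k (List.cons 1) b, ?_, ?_⟩
  · refine pf_sp _ ?_ hb1
    intro l hl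
    simp only [Set.mem_ofPred_eq] at hl
    show (1 :: l).length = j + 2
    rw [List.length_cons, hl]
  · rw [del_cons, h0, map_zero, sub_zero]

/-- a finite `ℓ`-group acting on a nonzero space in characteristic `ℓ` fixes a nonzero vector -/
theorem p_fixed [Finite V] {ℓ : ℕ} [hℓ : Fact ℓ.Prime] [CharP F ℓ] {S : Subgroup (UU B)}
    (hp : IsPGroup ℓ S) {P : Submodule F V} (hP : P ≠ ⊥) (hSP : ∀ s ∈ S, ∀ w ∈ P, s • w ∈ P) :
    ∃ v ∈ P, v ≠ 0 ∧ ∀ s ∈ S, s • v = v := by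
  let act : MulAction ↥S ↥P :=
    { smul := fun s w => ⟨(s : UU B) • (w : V), hSP s s.2 w w.2⟩
      one_smul := fun w => Subtype.ext (one_smul (UU B) (w : V))
      mul_smul := fun s t w => Subtype.ext (mul_smul (s : UU B) (t : UU B) (w : V)) }
  obtain ⟨u, hu, hu0⟩ := Submodule.exists_mem_ne_zero_of_ne_bot hP
  have hdvd : ℓ ∣ Nat.card ↥P := by
    have h1 : addOrderOf (⟨u, hu⟩ : P) = ℓ := by
      refine addOrderOf_eq_prime ?_ ?_
      · apply Subtype.ext
        show ℓ • u = 0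
        rw [← Nat.cast_smul_eq_nsmul F, CharP.cast_eq_zero, zero_smul]
      · intro h
        exact hu0 (congrArg Subtype.val h)
    rw [← h1]
    exact addOrderOf_dvd_natCard _
  obtain ⟨v, hv, hv0⟩ := hp.exists_fixed_point_of_prime_dvd_card_of_fixed_point (↥P) hdvd
    (a := 0) (by
      intro s
      apply Subtype.ext
      exact map_zero (s : UU B).1)
  refine ⟨v, v.2, fun h => hv0 (Subtype.ext h.symm), fun s hs => ?_⟩
  exact congrArg Subtype.val (hv ⟨s, hs⟩)

theorem V_nondeg (hB : Herm B) (hn : Nondeg B) [FiniteDimensional F V] [Finite F] {k : Type} [Field k]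
    {d : ℕ} (hS : Sd B k (d + 1)) (ℓ : ℕ) [hℓ : Fact ℓ.Prime] [CharP k ℓ] [CharP F ℓ]
    {D : Submodule F V} (hD : rad B D = ⊥)
    (hk : kap B D + (2 * (d + 1) + 1) ≤ finrank F V) :
    ∀ (N : ℕ) (E : Submodule F V), finrank F V - finrank F E = N → D ≤ E →
      Cyc k (Gam B E) (d + 1) ≤ Bd k (Gam B D) (d + 1) := by
  intro N
  induction N using Nat.strong_induction_on with
  | _ N ihN =>
    intro E hN hDE
    have ih : ∀ E' : Submodule F V, E < E' → Cyc k (Gam B E') (d + 1) ≤ Bd k (Gam B D) (d + 1) := by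
      intro E' hE'
      have h1 := Submodule.finrank_lt_finrank_of_lt hE'
      have h2 := Submodule.finrank_le E'
      exact ihN _ (by omega) E' rfl (hDE.trans hE'.le)
    by_cases hE : rad B E = ⊥
    swap
    · exact V_degen hB hn hS hD hk hDE hE ih
    haveI : Finite V := Module.finite_of_finite F
    obtain ⟨S⟩ : Nonempty (Sylow ℓ ↥(Gam B E)) := inferInstance
    obtain ⟨S', hS'⟩ : ∃ S' : Subgroup (UU B), S' = (S : Subgroup ↥(Gam B E)).map (Gam B E).subtype := ⟨_, rfl⟩
    have hS'le : S' ≤ Gam B E := by rw [hS']; exact Subgroup.map_subtype_le _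
    have hrel : S'.relIndex (Gam B E) = (S : Subgroup ↥(Gam B E)).index := by
      rw [hS', Subgroup.relIndex, Subgroup.subgroupOf,
        Subgroup.comap_map_eq_self_of_injective (Subgroup.subtype_injective _)]
    have hp : IsPGroup ℓ S' := by rw [hS']; exact S.isPGroup'.map _
    have hO : Onto k S' (Gam B E) (d + 1) := by
      refine Onto_of_index S' _ hS'le ?_ _
      rw [hrel, Ne, CharP.cast_eq_zero_iff k ℓ]
      exact S.not_dvd_index
    intro a ha
    obtain ⟨b, hb, hab⟩ := hO a ha
    suffices b ∈ Bd k (Gam B D) (d + 1) by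
      have e : a = (a - b) + b := by abel
      rw [e]
      exact Submodule.add_mem _ (Bd_mono (Gam_anti hDE) _ hab) this
    by_cases hT : E = ⊤
    · refine Bd_mono (bot_le : (⊥ : Subgroup (UU B)) ≤ _) _ (Vanish_bot (d + 1) ?_)
      refine Cyc_mono ?_ _ hb
      intro h hh
      have h1 := hS'le hh
      rw [Subgroup.mem_bot]
      apply Subtype.ext
      apply LinearEquiv.ext
      intro v
      exact h1 v (by rw [hT]; trivial)
    · have hpne : perp B E ≠ ⊥ := by
        intro h
        have h1 := sup_perp hB hn hE
        rw [h, sup_bot_eq] at h1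
        exact hT h1
      obtain ⟨v, hv, hv0, hvS⟩ := p_fixed hp hpne (fun s hs w hw => by
        intro e he
        have h1 : s • e = e := hS'le hs e he
        have h2 := UU.iso s e w
        rw [h1] at h2
        rw [h2]
        exact hw e he)
      refine ih (E ⊔ F ∙ v) ?_ (Cyc_mono ?_ _ hb)
      · refine lt_of_le_of_ne le_sup_left ?_
        intro h
        have hvE : v ∈ E := by
          rw [h]
          exact Submodule.mem_sup_right (Submodule.mem_span_singleton_self v)
        have : v ∈ rad B E := ⟨hvE, hv⟩
        rw [hE, Submodule.mem_bot] at this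
        exact hv0 this
      · intro s hs
        exact Gam_mem_sup_span.2 ⟨hS'le hs, hvS s hs⟩

theorem V_step (hB : Herm B) (hn : Nondeg B) [FiniteDimensional F V] [Finite F] {k : Type} [Field k]
    {d : ℕ} (hS : Sd B k (d + 1)) (ℓ : ℕ) [hℓ : Fact ℓ.Prime] [CharP k ℓ] [CharP F ℓ] :
    Vd B k (d + 1) := by
  intro D hk
  obtain ⟨E, hDE, hE, hkE, hO⟩ := hull hB hn hS _ D rfl (by omega)
  have h1 := V_nondeg (k := k) hB hn hS ℓ hE (by rw [hkE]; exact hk) _ E rfl le_rfl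
  intro a ha
  obtain ⟨b, hb, hab⟩ := hO a ha
  have e : a = (a - b) + b := by abel
  rw [e]
  exact Submodule.add_mem _ hab (Bd_mono (Gam_anti hDE) _ (h1 hb))

theorem VS_all (hB : Herm B) (hn : Nondeg B) [FiniteDimensional F V] [Finite F]
    (hQ : 9 ≤ Nat.card F) {k : Type} [Field k] (ℓ : ℕ) [hℓ : Fact ℓ.Prime] [CharP k ℓ] [CharP F ℓ]
    {m : ℕ} (hm0 : (m : k) ≠ 0) (hm : ∀ c : F, c * σ c = 1 → c ^ m = 1) :
    ∀ d, 1 ≤ d → Vd B k d ∧ Sd B k d := by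
  intro d
  induction d using Nat.strong_induction_on with
  | _ d ih =>
    intro hd
    have hSd : Sd B k d := by
      rcases Nat.lt_or_ge d 2 with h | h
      · obtain rfl : d = 1 := by omega
        intro D r w _ _ hk a ha
        refine ⟨0, Submodule.zero_mem _, ?_⟩
        rw [sub_zero]
        exact V_one k hB hn hm0 hm D (by omega) ha
      · exact S_step hB hn hQ d h (fun j h1 h2 => (ih j h2 h1).1) (fun j h1 h2 => (ih j h2 h1).2)
    obtain ⟨e, rfl⟩ : ∃ e, d = e + 1 := ⟨d - 1, by omega⟩
    exact ⟨V_step hB hn hSd ℓ, hSd⟩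

end VStep

end UEH

namespace UEH

section Final

open Module

theorem HF_of_card {F : Type} [Field F] [Fintype F] {q : ℕ} (hq : 3 ≤ q)
    (hcard : Fintype.card F = q * q) (σ : F →+* F) (hσ : ∀ x, σ x = x ^ q) : HF σ := by
  classical
  obtain ⟨g, hg⟩ := IsCyclic.exists_generator (α := Fˣ)
  obtain ⟨p, rfl⟩ : ∃ p, q = p + 1 := ⟨q - 1, by omega⟩
  have hord : orderOf g = p * (p + 2) := by
    rw [orderOf_eq_card_of_forall_mem_zpowers hg, Nat.card_eq_fintype_card, Fintype.card_units, hcard]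
    have : (p + 1) * (p + 1) = p * (p + 2) + 1 := by ring
    omega
  have hinv : ∀ x, σ (σ x) = x := by
    intro x
    rw [hσ, hσ, ← pow_mul, ← hcard, FiniteField.pow_card]
  refine ⟨hinv, ?_, ?_, ?_, ?_⟩
  · intro a ha
    rcases eq_or_ne a 0 with rfl | h0
    · exact ⟨0, by simp⟩
    obtain ⟨u, rfl⟩ : ∃ u : Fˣ, (u : F) = a := ⟨Units.mk0 a h0, rfl⟩
    obtain ⟨i, hi⟩ := (mem_powers_iff_mem_zpowers.2 (hg u))
    have hi' : g ^ i = u := hi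
    have h1 : u ^ p = 1 := by
      rw [hσ] at ha
      have : u ^ (p + 1) = u := Units.ext (by push_cast; exact ha)
      rw [pow_succ] at this
      exact mul_eq_right.1 this
    rw [← hi', ← pow_mul, ← orderOf_dvd_iff_pow_eq_one, hord, mul_comm p] at h1
    have h2 : (p + 2) ∣ i := Nat.dvd_of_mul_dvd_mul_right (by omega) h1
    obtain ⟨j, rfl⟩ := h2
    refine ⟨((g ^ j : Fˣ) : F), ?_⟩
    rw [hσ, ← hi']
    push_cast
    ring
  · intro a ha
    have : ∃ c : F, c + σ c ≠ 0 := by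
      by_contra hcon
      push Not at hcon
      obtain ⟨P, hP⟩ : ∃ P : Polynomial F, P = Polynomial.X ^ (p + 1) + Polynomial.X := ⟨_, rfl⟩
      have hdeg : P.natDegree = p + 1 := by
        rw [hP]
        rw [Polynomial.natDegree_add_eq_left_of_natDegree_lt]
        · simp
        · simp; omega
      have hP0 : P ≠ 0 := by
        intro h
        rw [h] at hdeg
        simp at hdeg
      have h1 := Polynomial.card_roots' P
      have h2 : (Finset.univ : Finset F) ⊆ P.roots.toFinset := by
        intro c _
        rw [Multiset.mem_toFinset, Polynomial.mem_roots hP0, Polynomial.IsRoot, hP]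
        simp only [Polynomial.eval_add, Polynomial.eval_pow, Polynomial.eval_X]
        rw [← hσ, add_comm]
        exact hcon c
      have h3 := Finset.card_le_card h2
      have h4 := Multiset.toFinset_card_le P.roots
      rw [Finset.card_univ, hcard] at h3
      nlinarith
    obtain ⟨c, hc⟩ := this
    refine ⟨a / (c + σ c) * c, ?_⟩
    rw [map_mul, map_div₀, map_add, hinv, ha, add_comm (σ c) c]
    field_simp
  · refine ⟨((g ^ p : Fˣ) : F), ?_, ?_⟩
    · rw [hσ]
      have h1 : g ^ (p * (p + 2)) = 1 := by rw [← hord]; exact pow_orderOf_eq_one g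
      have h2 : ((g ^ (p * (p + 2)) : Fˣ) : F) = 1 := by rw [h1]; rfl
      push_cast at h2 ⊢
      rw [← h2]
      ring
    · intro h
      have h1 : g ^ p = 1 := Units.ext h
      rw [← orderOf_dvd_iff_pow_eq_one, hord] at h1
      have := Nat.le_of_dvd (by omega) h1
      nlinarith
  · intro a b
    obtain ⟨e, he⟩ : ∃ e : F, e = ((g ^ (p + 2) : Fˣ) : F) := ⟨_, rfl⟩
    have he0 : e ≠ 0 := by rw [he]; exact Units.ne_zero _
    have he1 : e ≠ 1 := by
      intro h
      rw [he] at h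
      have h1 : g ^ (p + 2) = 1 := Units.ext h
      rw [← orderOf_dvd_iff_pow_eq_one, hord] at h1
      have := Nat.le_of_dvd (by omega) h1
      nlinarith
    have hes : σ e = e := by
      have h1 : g ^ (p * (p + 2)) = 1 := by rw [← hord]; exact pow_orderOf_eq_one g
      have h2 : ((g ^ (p * (p + 2)) : Fˣ) : F) = 1 := by rw [h1]; rfl
      rw [hσ, he]
      push_cast at h2 ⊢
      calc ((g : F) ^ (p + 2)) ^ (p + 1) = (g : F) ^ (p * (p + 2)) * (g : F) ^ (p + 2) := by ring
        _ = _ := by rw [h2, one_mul]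
    by_cases h0 : (0 : F) ≠ a ∧ (0 : F) ≠ b
    · exact ⟨0, map_zero σ, h0⟩
    by_cases h1 : (1 : F) ≠ a ∧ (1 : F) ≠ b
    · exact ⟨1, map_one σ, h1⟩
    refine ⟨e, hes, ?_, ?_⟩
    · rintro rfl
      simp only [ne_eq, not_and_or, not_not] at h0 h1
      rcases h0 with h0 | h0
      · exact he0 h0.symm
      rcases h1 with h1 | h1
      · exact he1 h1.symm
      · exact zero_ne_one (h0.trans h1.symm)
    · rintro rfl
      simp only [ne_eq, not_and_or, not_not] at h0 h1
      rcases h0 with h0 | h0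
      · rcases h1 with h1 | h1
        · exact zero_ne_one (h0.trans h1.symm)
        · exact he1 h1.symm
      · exact he0 h0.symm

/-- the standard Hermitian form -/
noncomputable def stdB {F : Type} [Field F] (σ : F →+* F) (n : ℕ) :
    (Fin n → F) →ₛₗ[σ] (Fin n → F) →ₗ[F] F :=
  LinearMap.mk₂'ₛₗ σ (RingHom.id F) (fun v w => ∑ i, σ (v i) * w i)
    (by intro a b c; simp [add_mul, Finset.sum_add_distrib])
    (by intro c a b; simp [Finset.mul_sum, mul_assoc])
    (by intro a b c; simp [mul_add, Finset.sum_add_distrib])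
    (by intro c a b; simp only [Pi.smul_apply, smul_eq_mul, Finset.mul_sum, RingHom.id_apply]
        exact Finset.sum_congr rfl (fun i _ => by ring))

theorem stdB_apply {F : Type} [Field F] (σ : F →+* F) (n : ℕ) (v w : Fin n → F) :
    stdB σ n v w = ∑ i, σ (v i) * w i := rfl

theorem main {ℓ r : ℕ} (hℓ : ℓ.Prime) (hr : 1 ≤ r)
    (hne : ℓ ^ r ≠ 2) (F : Type) [Field F] [Fintype F]
    (hcard : Fintype.card F = ℓ ^ (2 * r)) (n d : ℕ) (hd0 : 0 < d) (hdn : 2 * d < n) :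
    Subsingleton
      (GroupHomologyBar.Homology (↥(bilinIsoms F (pairForm F (fun s t : F => s ^ ℓ ^ r * t) n)))
        (ZMod ℓ) d) := by
  haveI : Fact ℓ.Prime := ⟨hℓ⟩
  haveI : CharP F ℓ := charP_of_card_eq_prime_pow hcard
  obtain ⟨q, hq⟩ : ∃ q, q = ℓ ^ r := ⟨_, rfl⟩
  have hq3 : 3 ≤ q := by
    have h1 : ℓ ≤ ℓ ^ r := Nat.le_self_pow (by omega) ℓ
    have := hℓ.two_le
    omega
  have hcq : Fintype.card F = q * q := by rw [hcard, hq, ← pow_add]; congr 1; omega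
  obtain ⟨σ, hσ⟩ : ∃ σ : F →+* F, ∀ x, σ x = x ^ q :=
    ⟨iterateFrobenius F ℓ r, fun x => by rw [hq, iterateFrobenius_def]⟩
  have hf := HF_of_card hq3 hcq σ hσ
  have hform : pairForm F (fun s t : F => s ^ ℓ ^ r * t) n = fun v w => stdB σ n v w := by
    funext v w
    rw [stdB_apply, pairForm]
    exact Finset.sum_congr rfl (fun i _ => by rw [hσ, hq])
  have hB : Herm (stdB σ n) := by
    refine ⟨hf, fun v w => ?_⟩
    rw [stdB_apply, stdB_apply, map_sum]
    exact Finset.sum_congr rfl (fun i _ => by rw [map_mul, hf.invol, mul_comm])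
  have hn : Nondeg (stdB σ n) := by
    intro v hv
    funext i
    have h1 := hv (Pi.single i 1)
    rw [stdB_apply, Finset.sum_eq_single i] at h1
    · simpa using h1
    · intro j _ hj
      rw [Pi.single_eq_of_ne hj, map_zero, zero_mul]
    · intro h; exact absurd (Finset.mem_univ i) h
  have hQ : 9 ≤ Nat.card F := by rw [Nat.card_eq_fintype_card, hcq]; nlinarith
  have hm0 : ((q + 1 : ℕ) : ZMod ℓ) ≠ 0 := by
    rw [hq]
    push_cast
    rw [CharP.cast_eq_zero, zero_pow (by omega), zero_add]
    exact one_ne_zero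
  have hm : ∀ c : F, c * σ c = 1 → c ^ (q + 1) = 1 := by
    intro c hc
    rw [pow_succ', ← hσ]; exact hc
  have hV := (VS_all (k := ZMod ℓ) hB hn hQ ℓ hm0 hm d hd0).1 ⊥ (by
    have h1 : rad (stdB σ n) ⊥ = ⊥ := bot_inf_eq _
    rw [kap, h1, finrank_bot, Module.finrank_fin_fun]
    omega)
  have htop : Gam (stdB σ n) ⊥ = ⊤ := by
    rw [eq_top_iff]
    intro g _ v hv
    rw [Submodule.mem_bot] at hv
    rw [hv]
    exact map_zero g.1
  rw [htop] at hV
  obtain ⟨e, rfl⟩ : ∃ e, d = e + 1 := ⟨d - 1, by omega⟩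
  rw [hform]
  exact homology_subsingleton e hV

end Final

end UEH

open GroupHomologyBar in
/-- Vanishing of the homology of the Euclidean unitary groups `U(n, 𝔽_{ℓ^{2r}}, σ)` with
the involution `σ(x) = x^{ℓ^r}`, at the characteristic, for `ℓ^r ≠ 2`:
`H_d(U(n, 𝔽_{ℓ^{2r}}, σ); 𝔽_ℓ) = 0` for `0 < 2d < n`.  Here `U(n,F,σ)` is realized as
the group of linear automorphisms of `Fⁿ` preserving the Hermitian form
`ω(v,w) = ∑ᵢ σ(vᵢ) wᵢ`. -/
theorem U_euclidean_homology_vanishing (ℓ r : ℕ) (hℓ : ℓ.Prime) (hr : 1 ≤ r)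
    (hne : ℓ ^ r ≠ 2) (F : Type) [Field F] [Fintype F]
    (hcard : Fintype.card F = ℓ ^ (2 * r)) (n d : ℕ) (hd0 : 0 < d) (hdn : 2 * d < n) :
    Subsingleton
      (Homology (↥(bilinIsoms F (pairForm F (fun s t : F => s ^ ℓ ^ r * t) n)))
        (ZMod ℓ) d) := by
  exact UEH.main hℓ hr hne F hcard n d hd0 hdn
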